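/- Let m > 1 be an integer, Ω ⊂ ℝ^{2m} open connected, and let u_k ∈ C^{2m}(Ω) satisfy (−Δ)^m u_k = Q_k e^{2m u_k} in Ω with Q_k → Q_0 locally uniformly (Q_0 continuous and bounded) and ∫_Ω e^{2m u_k} dx ≤ C for all k. Let x_0 ∈ Ω be a point such that sup_{B_R(x_0)} u_k → +∞ as k → ∞ for every 0 < R < dist(x_0, ∂Ω). Then there exist points x_k → x_0 and radii r_k → 0⁺ such that the rescaled functions v_k(x) := u_k(x_k + r_k x) + log r_k satisfy v_k ≤ 0 on balls B_{L_k}(0) with L_k → +∞, and v_k(0) ≥ −log 2; moreover, after passing to a subsequence, either (a) v_k → v in C^{2m−1,α}_loc(ℝ^{2m}) for every α ∈ [0,1), where v ∈ C^{2m}(ℝ^{2m}) satisfies (−Δ)^m v = Q_0(x_0) e^{2m v} on ℝ^{2m}; or (b) v_k → −∞ almost everywhere on ℝ^{2m} and there exist positive numbers γ_k → +∞ such that v_k/γ_k → p in C^{2m−1,α}_loc(ℝ^{2m}), where p is a polynomial of degree at most 2m−2. -/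

import Mathlib

open MeasureTheory Metric Filter Set
open scoped ENNReal Topology

/-- The Euclidean Laplacian of `f : ℝ^n → ℝ` (trace of the Hessian, computed as the sum of
second directional derivatives along the standard orthonormal basis). -/
noncomputable def lap {n : ℕ} (f : EuclideanSpace ℝ (Fin n) → ℝ) :
    EuclideanSpace ℝ (Fin n) → ℝ :=
  fun x => ∑ i : Fin n,
    fderiv ℝ (fun y => fderiv ℝ f y (EuclideanSpace.single i 1)) x (EuclideanSpace.single i 1)

/-- The `α`-Hölder seminorm, over a set `K`, of the `ℓ`-th iterated derivative of `f`. -/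
noncomputable def holderSeminormOn {n : ℕ} (ℓ : ℕ) (α : ℝ)
    (K : Set (EuclideanSpace ℝ (Fin n))) (f : EuclideanSpace ℝ (Fin n) → ℝ) : ℝ :=
  ⨆ p : {q : EuclideanSpace ℝ (Fin n) × EuclideanSpace ℝ (Fin n) //
      q.1 ∈ K ∧ q.2 ∈ K ∧ q.1 ≠ q.2},
    ‖iteratedFDeriv ℝ ℓ f (p : (EuclideanSpace ℝ (Fin n)) × (EuclideanSpace ℝ (Fin n))).1 -
      iteratedFDeriv ℝ ℓ f (p : (EuclideanSpace ℝ (Fin n)) × (EuclideanSpace ℝ (Fin n))).2‖ /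
      dist (p : (EuclideanSpace ℝ (Fin n)) × (EuclideanSpace ℝ (Fin n))).1
        (p : (EuclideanSpace ℝ (Fin n)) × (EuclideanSpace ℝ (Fin n))).2 ^ α

/-- Convergence `f_k → g` in `C^{ℓ,α}_loc(U)`: on every compact `K ⊆ U`, all derivatives of
order `≤ ℓ` converge uniformly, and the `α`-Hölder seminorm over `K` of the `ℓ`-th derivative
of `f_k - g` tends to `0`. -/
def TendstoCLocHolder {n : ℕ} (ℓ : ℕ) (α : ℝ) (U : Set (EuclideanSpace ℝ (Fin n)))
    (f : ℕ → EuclideanSpace ℝ (Fin n) → ℝ) (g : EuclideanSpace ℝ (Fin n) → ℝ) : Prop :=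
  ∀ K : Set (EuclideanSpace ℝ (Fin n)), K ⊆ U → IsCompact K →
    (∀ j : ℕ, j ≤ ℓ → TendstoUniformlyOn (fun k x => iteratedFDeriv ℝ j (f k) x)
      (iteratedFDeriv ℝ j g) atTop K) ∧
    Tendsto (fun k => holderSeminormOn ℓ α K (fun x => f k x - g x)) atTop (𝓝 0)

/-- `f_k → -∞` locally uniformly on `U`. -/
def TendstoLocUnifBot {n : ℕ} (U : Set (EuclideanSpace ℝ (Fin n)))
    (f : ℕ → EuclideanSpace ℝ (Fin n) → ℝ) : Prop :=
  ∀ K : Set (EuclideanSpace ℝ (Fin n)), K ⊆ U → IsCompact K →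
    ∀ M : ℝ, ∀ᶠ k in atTop, ∀ x ∈ K, f k x < M

abbrev Euc (n : ℕ) := EuclideanSpace ℝ (Fin n)

section Kernel

variable {n : ℕ} {F : Type} [NormedAddCommGroup F]

theorem hasCompactSupport_of_unitBall {k : Euc n → F} (hs : ∀ y, 1 ≤ ‖y‖ → k y = 0) :
    HasCompactSupport k :=
  HasCompactSupport.intro (isCompact_closedBall (0 : Euc n) 1) fun y hy => hs y (by
    simp only [mem_closedBall, dist_zero_right, not_le] at hy
    exact hy.le)

theorem integrable_of_unitBall {k : Euc n → F} (hk : Continuous k)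
    (hs : ∀ y, 1 ≤ ‖y‖ → k y = 0) : Integrable k :=
  hk.integrable_of_hasCompactSupport (hasCompactSupport_of_unitBall hs)

variable [NormedSpace ℝ F]

theorem fderiv_eq_zero_of_unitBall {k : Euc n → F} (hk : ContDiff ℝ 1 k)
    (hs : ∀ y, 1 ≤ ‖y‖ → k y = 0) : ∀ y, 1 ≤ ‖y‖ → fderiv ℝ k y = 0 := by
  have h1 : ∀ y, 1 < ‖y‖ → fderiv ℝ k y = 0 := by
    intro y hy
    have : k =ᶠ[𝓝 y] fun _ => (0 : F) := by
      filter_upwards [continuous_norm.continuousAt.eventually (lt_mem_nhds hy)] with z hz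
      exact hs z hz.le
    rw [this.fderiv_eq]
    simp
  intro y hy
  have hc : Continuous (fun t : ℝ => fderiv ℝ k (t • y)) :=
    (hk.continuous_fderiv one_ne_zero).comp (by fun_prop)
  have h2 : Tendsto (fun t : ℝ => fderiv ℝ k (t • y)) (𝓝[>] 1) (𝓝 (fderiv ℝ k y)) := by
    have := hc.tendsto 1
    simp only [one_smul] at this
    exact this.mono_left nhdsWithin_le_nhds
  have h3 : Tendsto (fun t : ℝ => fderiv ℝ k (t • y)) (𝓝[>] 1) (𝓝 0) := by
    refine tendsto_const_nhds.congr' ?_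
    filter_upwards [self_mem_nhdsWithin] with t ht
    rw [h1]
    have ht' : (1 : ℝ) < t := ht
    rw [norm_smul, Real.norm_eq_abs, abs_of_pos (by linarith)]
    nlinarith
  exact tendsto_nhds_unique h2 h3

/-- Differentiation under the integral sign against a compactly supported continuous kernel. -/
theorem hasFDerivAt_integral_kernel {H : Type} [NormedAddCommGroup H] [NormedSpace ℝ H]
    [ProperSpace H] {k : Euc n → ℝ} (hk : Continuous k) (hs : ∀ y, 1 ≤ ‖y‖ → k y = 0)
    {A : H → Euc n → F} {A' : H → Euc n → H →L[ℝ] F} (hAc : ∀ p, Continuous (A p))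
    (hA'c : Continuous (Function.uncurry A'))
    (hA : ∀ p y, HasFDerivAt (fun q => A q y) (A' p y) p) (p : H) :
    HasFDerivAt (fun q => ∫ y, k y • A q y) (∫ y, k y • A' p y) p := by
  obtain ⟨B, hB⟩ := ((isCompact_closedBall p 1).prod
    (isCompact_closedBall (0 : Euc n) 1)).exists_bound_of_continuousOn hA'c.continuousOn
  have hA'p : ∀ p, Continuous (A' p) := fun p => hA'c.comp (Continuous.prodMk_right p)
  refine hasFDerivAt_integral_of_dominated_of_fderiv_le (𝕜 := ℝ) (bound := fun y => ‖k y‖ * B)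
    (F' := fun q y => k y • A' q y) (ball_mem_nhds p one_pos) ?_ ?_ ?_ ?_ ?_ ?_
  · exact Eventually.of_forall fun q => (hk.smul (hAc q)).aestronglyMeasurable
  · exact integrable_of_unitBall (hk.smul (hAc p)) fun y hy => by simp [hs y hy]
  · exact (hk.smul (hA'p p)).aestronglyMeasurable
  · refine Eventually.of_forall fun y q hq => ?_
    by_cases hy : 1 ≤ ‖y‖
    · simp [hs y hy]
    · rw [norm_smul]
      refine mul_le_mul_of_nonneg_left ?_ (norm_nonneg _)
      exact hB (q, y) ⟨ball_subset_closedBall hq, by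
        simpa using (not_le.mp hy).le⟩
  · exact integrable_of_unitBall (hk.norm.mul continuous_const) fun y hy => by simp [hs y hy]
  · exact Eventually.of_forall fun y q _ => (hA q y).const_smul (k y)

/-- The weighted average `∫ k(y) g(x - a y) dy`. -/
noncomputable def smear (k : Euc n → ℝ) (a : ℝ) (g : Euc n → F) (x : Euc n) : F :=
  ∫ y, k y • g (x - a • y)

/-- The weighted average `∫ g(x - a y) k(y) dy` for a vector-valued kernel. -/
noncomputable def tsmear (k : Euc n → F) (a : ℝ) (g : Euc n → ℝ) (x : Euc n) : F :=
  ∫ y, g (x - a • y) • k y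

theorem tsmear_eq_smear (k : Euc n → ℝ) (a : ℝ) (g : Euc n → ℝ) :
    tsmear k a g = smear k a g := by
  ext x
  simp only [tsmear, smear, smul_eq_mul, mul_comm]

theorem hasFDerivAt_smear {k : Euc n → ℝ} (hk : Continuous k) (hs : ∀ y, 1 ≤ ‖y‖ → k y = 0)
    (a : ℝ) {g : Euc n → F} (hg : ContDiff ℝ 1 g) (x : Euc n) :
    HasFDerivAt (smear k a g) (smear k a (fderiv ℝ g) x) x := by
  refine hasFDerivAt_integral_kernel hk hs (A := fun x y => g (x - a • y))
    (A' := fun x y => fderiv ℝ g (x - a • y)) ?_ ?_ ?_ x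
  · intro p
    exact hg.continuous.comp (by fun_prop)
  · exact (hg.continuous_fderiv one_ne_zero).comp (by fun_prop)
  · intro p y
    exact (((hg.differentiable one_ne_zero) (p - a • y)).hasFDerivAt).comp p
      ((hasFDerivAt_id p).sub_const (a • y))

theorem fderiv_smear {k : Euc n → ℝ} (hk : Continuous k) (hs : ∀ y, 1 ≤ ‖y‖ → k y = 0)
    (a : ℝ) {g : Euc n → F} (hg : ContDiff ℝ 1 g) :
    fderiv ℝ (smear k a g) = smear k a (fderiv ℝ g) :=
  funext fun x => (hasFDerivAt_smear hk hs a hg x).fderiv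

theorem integrable_smear {k : Euc n → ℝ} (hk : Continuous k) (hs : ∀ y, 1 ≤ ‖y‖ → k y = 0)
    (a : ℝ) {g : Euc n → F} (hg : Continuous g) (x : Euc n) :
    Integrable fun y => k y • g (x - a • y) :=
  integrable_of_unitBall (hk.smul (hg.comp (by fun_prop))) fun y hy => by simp [hs y hy]

theorem integrable_tsmear {k : Euc n → F} (hk : Continuous k) (hs : ∀ y, 1 ≤ ‖y‖ → k y = 0)
    (a : ℝ) {g : Euc n → ℝ} (hg : Continuous g) (x : Euc n) :
    Integrable fun y => g (x - a • y) • k y :=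
  integrable_of_unitBall ((hg.comp (by fun_prop)).smul hk) fun y hy => by simp [hs y hy]

theorem continuous_smear_uncurry {k : Euc n → ℝ} (hk : Continuous k)
    (hs : ∀ y, 1 ≤ ‖y‖ → k y = 0) {g : Euc n → F} (hg : Continuous g) :
    Continuous fun p : ℝ × Euc n => smear k p.1 g p.2 := by
  unfold smear
  have := continuous_parametric_integral_of_continuous (μ := volume)
    (f := fun (p : ℝ × Euc n) (y : Euc n) => k y • g (p.2 - p.1 • y))
    (s := closedBall (0 : Euc n) 1) ?_ (isCompact_closedBall _ _)
  · refine this.congr fun p => ?_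
    refine setIntegral_eq_integral_of_forall_compl_eq_zero fun y hy => ?_
    simp only [mem_closedBall, dist_zero_right, not_le] at hy
    simp [hs y hy.le]
  · exact (hk.comp continuous_snd).smul (hg.comp (by fun_prop))

theorem continuous_smear {k : Euc n → ℝ} (hk : Continuous k)
    (hs : ∀ y, 1 ≤ ‖y‖ → k y = 0) (a : ℝ) {g : Euc n → F} (hg : Continuous g) :
    Continuous (smear k a g) :=
  (continuous_smear_uncurry hk hs hg).comp (Continuous.prodMk_right a)

theorem contDiff_smear {k : Euc n → ℝ} (hk : Continuous k) (hs : ∀ y, 1 ≤ ‖y‖ → k y = 0)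
    (a : ℝ) (N : ℕ) : ∀ {F : Type} [NormedAddCommGroup F] [NormedSpace ℝ F] {g : Euc n → F},
    ContDiff ℝ N g → ContDiff ℝ N (smear k a g) := by
  induction N with
  | zero =>
    intro F _ _ g hg
    exact contDiff_zero.2 (continuous_smear hk hs a hg.continuous)
  | succ N ih =>
    intro F _ _ g hg
    have h1 : ContDiff ℝ 1 g := hg.of_le (by exact_mod_cast Nat.le_add_left 1 N)
    have hg' := hg
    rw [show ((N + 1 : ℕ) : WithTop ℕ∞) = (N : WithTop ℕ∞) + 1 by push_cast; rfl] at hg' ⊢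
    rw [contDiff_succ_iff_fderiv] at hg' ⊢
    refine ⟨fun x => (hasFDerivAt_smear hk hs a h1 x).differentiableAt, by simp, ?_⟩
    rw [fderiv_smear hk hs a h1]
    exact ih hg'.2.2

theorem smear_zero [CompleteSpace F] {k : Euc n → ℝ} (g : Euc n → F) (x : Euc n) :
    smear k 0 g x = (∫ y, k y) • g x := by
  simp only [smear, zero_smul, sub_zero, integral_smul_const]

theorem norm_smear_le {k : Euc n → ℝ} (hk : Continuous k) (hs : ∀ y, 1 ≤ ‖y‖ → k y = 0)
    {a : ℝ} (ha : 0 ≤ a) {g : Euc n → F} {x : Euc n} {N : ℝ}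
    (hN : ∀ z ∈ closedBall x a, ‖g z‖ ≤ N) :
    ‖smear k a g x‖ ≤ (∫ y, |k y|) * N := by
  rw [← integral_mul_const]
  refine norm_integral_le_of_norm_le
    ((integrable_of_unitBall hk hs).abs.mul_const N) (Eventually.of_forall fun y => ?_)
  by_cases hy : 1 ≤ ‖y‖
  · simp [hs y hy]
  · rw [norm_smul]
    refine mul_le_mul_of_nonneg_left (hN _ ?_) (norm_nonneg _)
    rw [mem_closedBall, dist_eq_norm, sub_sub_cancel_left, norm_neg, norm_smul,
      Real.norm_of_nonneg ha]
    exact mul_le_of_le_one_right ha (not_le.mp hy).le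

theorem hasFDerivAt_tsmear {k : Euc n → F} (hk : ContDiff ℝ 1 k)
    (hs : ∀ y, 1 ≤ ‖y‖ → k y = 0) {a : ℝ} (ha : 0 < a) {g : Euc n → ℝ} (hg : Continuous g)
    (x : Euc n) : HasFDerivAt (tsmear k a g) (a⁻¹ • tsmear (fderiv ℝ k) a g x) x := by
  have hdiff := hk.differentiable one_ne_zero
  have key : ∀ (G : Type) [NormedAddCommGroup G] [NormedSpace ℝ G] (l : Euc n → G) (x : Euc n),
      ∫ t, g t • ((a ^ n)⁻¹ • l (a⁻¹ • (x - t))) = tsmear l a g x := by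
    intro G _ _ l x
    rw [← integral_sub_left_eq_self (fun t => g t • ((a ^ n)⁻¹ • l (a⁻¹ • (x - t)))) volume x]
    have := Measure.integral_comp_smul (μ := (volume : Measure (Euc n)))
      (fun y => g (x - y) • (l (a⁻¹ • y))) a
    simp only [finrank_euclideanSpace, Fintype.card_fin, inv_smul_smul₀ ha.ne'] at this
    rw [tsmear, this, abs_of_pos (by positivity), ← integral_smul]
    refine integral_congr_ae (Eventually.of_forall fun y => ?_)
    simp only [sub_sub_cancel]
    rw [smul_comm]
  set ka : Euc n → F := fun z => (a ^ n)⁻¹ • k (a⁻¹ • z) with hka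
  have hkac : ContDiff ℝ 1 ka := (hk.comp (contDiff_id.const_smul a⁻¹)).const_smul _
  have hkas : HasCompactSupport ka := by
    refine HasCompactSupport.intro (isCompact_closedBall (0 : Euc n) a) fun y hy => ?_
    simp only [mem_closedBall, dist_zero_right, not_le] at hy
    simp only [hka]
    rw [hs, smul_zero]
    rw [norm_smul, norm_inv, Real.norm_of_nonneg ha.le, inv_mul_eq_div, le_div_iff₀ ha]
    linarith
  have hd : ∀ z, fderiv ℝ ka z = (a ^ n)⁻¹ • (a⁻¹ • fderiv ℝ k (a⁻¹ • z)) := by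
    intro z
    have h1 : HasFDerivAt (fun z : Euc n => a⁻¹ • z) (a⁻¹ • ContinuousLinearMap.id ℝ (Euc n)) z :=
      (hasFDerivAt_id z).const_smul a⁻¹
    have h2 := ((hdiff (a⁻¹ • z)).hasFDerivAt.comp z h1).const_smul ((a ^ n)⁻¹)
    rw [show ka = (a ^ n)⁻¹ • (k ∘ fun z => a⁻¹ • z) from rfl, h2.fderiv]
    ext v
    simp
  have h := hkas.hasFDerivAt_convolution_right (μ := volume) (ContinuousLinearMap.lsmul ℝ ℝ)
    hg.locallyIntegrable hkac x
  have e1 : (convolution g ka (ContinuousLinearMap.lsmul ℝ ℝ) volume) = tsmear k a g := by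
    ext x
    rw [← key F k x]
    rfl
  rw [e1] at h
  have e2 : a⁻¹ • tsmear (fderiv ℝ k) a g x = convolution g (fderiv ℝ ka)
      (ContinuousLinearMap.precompR (Euc n) (ContinuousLinearMap.lsmul ℝ ℝ)) volume x := by
    rw [← key _ (fderiv ℝ k) x, ← integral_smul]
    refine integral_congr_ae (Eventually.of_forall fun t => ?_)
    beta_reduce
    rw [hd, smul_comm a⁻¹ (g t), smul_comm a⁻¹ (a ^ n)⁻¹]
    rfl
  rw [e2]
  exact h

end Kernel

section Laplacian

variable {n : ℕ}

theorem Filter.EventuallyEq.lap {f g : Euc n → ℝ} {x : Euc n} (h : f =ᶠ[𝓝 x] g) :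
    lap f =ᶠ[𝓝 x] lap g := by
  have h1 : ∀ᶠ y in 𝓝 x, fderiv ℝ f =ᶠ[𝓝 y] fderiv ℝ g :=
    (h.fderiv (𝕜 := ℝ)).eventuallyEq_nhds
  filter_upwards [h1] with y hy
  unfold _root_.lap
  refine Finset.sum_congr rfl fun i _ => ?_
  have : (fun z => fderiv ℝ f z (EuclideanSpace.single i 1)) =ᶠ[𝓝 y]
      fun z => fderiv ℝ g z (EuclideanSpace.single i 1) := by
    filter_upwards [hy] with z hz
    rw [hz]
  rw [this.fderiv_eq]

theorem Filter.EventuallyEq.lap_iterate {f g : Euc n → ℝ} {x : Euc n} (m : ℕ)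
    (h : f =ᶠ[𝓝 x] g) : _root_.lap^[m] f =ᶠ[𝓝 x] _root_.lap^[m] g := by
  induction m generalizing f g with
  | zero => exact h
  | succ m ih => exact ih h.lap

theorem ContDiff.fderiv_dir {g : Euc n → ℝ} {N : ℕ} (hg : ContDiff ℝ (N + 1 : ℕ) g) (e : Euc n) :
    ContDiff ℝ N (fun x => fderiv ℝ g x e) :=
  (hg.fderiv_right (m := N) (by norm_cast)).clm_apply contDiff_const

theorem ContDiff.lap {g : Euc n → ℝ} {N : ℕ} (hg : ContDiff ℝ (N + 2 : ℕ) g) :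
    ContDiff ℝ N (lap g) := by
  unfold _root_.lap
  refine ContDiff.sum fun i _ => ?_
  exact (ContDiff.fderiv_dir (N := N + 1) hg _).fderiv_dir _

theorem ContDiff.lap_iterate {g : Euc n → ℝ} {N m : ℕ} (hg : ContDiff ℝ (N + 2 * m : ℕ) g) :
    ContDiff ℝ N (_root_.lap^[m] g) := by
  induction m generalizing g with
  | zero => exact hg
  | succ m ih =>
    exact ih (ContDiff.lap (N := N + 2 * m) (by rwa [show N + 2 * m + 2 = N + 2 * (m + 1) by ring]))

theorem ContDiff.continuous_lap_iterate {g : Euc n → ℝ} {m : ℕ}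
    (hg : ContDiff ℝ (2 * m : ℕ) g) : Continuous (_root_.lap^[m] g) :=
  (ContDiff.lap_iterate (N := 0) (by simpa using hg)).continuous

theorem fderiv_smear_apply {k : Euc n → ℝ} (hk : Continuous k) (hs : ∀ y, 1 ≤ ‖y‖ → k y = 0)
    (a : ℝ) {g : Euc n → ℝ} (hg : ContDiff ℝ 1 g) (x e : Euc n) :
    fderiv ℝ (smear k a g) x e = smear k a (fun z => fderiv ℝ g z e) x := by
  rw [fderiv_smear hk hs a hg]
  unfold smear
  rw [ContinuousLinearMap.integral_apply
    (integrable_smear hk hs a (hg.continuous_fderiv one_ne_zero) x)]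
  rfl

theorem fderiv_smear_kernel_apply {k : Euc n → ℝ} (hk : ContDiff ℝ 1 k)
    (hs : ∀ y, 1 ≤ ‖y‖ → k y = 0) {a : ℝ} (ha : 0 < a) {g : Euc n → ℝ} (hg : Continuous g)
    (x e : Euc n) :
    fderiv ℝ (smear k a g) x e = a⁻¹ * smear (fun y => fderiv ℝ k y e) a g x := by
  rw [← tsmear_eq_smear, (hasFDerivAt_tsmear hk hs ha hg x).fderiv, ← tsmear_eq_smear]
  unfold tsmear
  rw [smul_apply, smul_eq_mul, ContinuousLinearMap.integral_apply
    (integrable_tsmear (hk.continuous_fderiv one_ne_zero)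
      (fderiv_eq_zero_of_unitBall hk hs) a hg x)]
  rfl

theorem smear_sum {ι : Type} (s : Finset ι) {k : Euc n → ℝ} (hk : Continuous k)
    (hs : ∀ y, 1 ≤ ‖y‖ → k y = 0)
    (a : ℝ) {g : ι → Euc n → ℝ} (hg : ∀ i, Continuous (g i)) (x : Euc n) :
    smear k a (fun z => ∑ i ∈ s, g i z) x = ∑ i ∈ s, smear k a (g i) x := by
  unfold smear
  rw [← integral_finsetSum _ fun i _ => integrable_smear hk hs a (hg i) x]
  simp only [smul_eq_mul, Finset.mul_sum]

theorem lap_smear {k : Euc n → ℝ} (hk : Continuous k) (hs : ∀ y, 1 ≤ ‖y‖ → k y = 0)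
    (a : ℝ) {g : Euc n → ℝ} (hg : ContDiff ℝ 2 g) :
    lap (smear k a g) = smear k a (lap g) := by
  ext x
  have hg1 : ContDiff ℝ 1 g := hg.of_le (by norm_num)
  have hge : ∀ e : Euc n, ContDiff ℝ 1 (fun z => fderiv ℝ g z e) := fun e =>
    ContDiff.fderiv_dir (N := 1) hg e
  unfold lap
  rw [smear_sum _ hk hs a fun i => ((ContDiff.fderiv_dir (N := 0) (hge _) _).continuous)]
  refine Finset.sum_congr rfl fun i _ => ?_
  rw [show (fun y => fderiv ℝ (smear k a g) y (EuclideanSpace.single i 1)) =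
      smear k a (fun z => fderiv ℝ g z (EuclideanSpace.single i 1)) from
      funext fun y => fderiv_smear_apply hk hs a hg1 y _]
  exact fderiv_smear_apply hk hs a (hge _) x _

theorem lap_iterate_smear {k : Euc n → ℝ} (hk : Continuous k) (hs : ∀ y, 1 ≤ ‖y‖ → k y = 0)
    (a : ℝ) {m : ℕ} {g : Euc n → ℝ} (hg : ContDiff ℝ (2 * m : ℕ) g) :
    lap^[m] (smear k a g) = smear k a (lap^[m] g) := by
  induction m generalizing g with
  | zero => rfl
  | succ m ih =>
    have h2 : ContDiff ℝ 2 g := hg.of_le (by norm_cast; omega)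
    simp only [Function.iterate_succ, Function.comp_apply]
    rw [lap_smear hk hs a h2]
    exact ih (ContDiff.lap (N := 2 * m) hg)

theorem smear_kernel_sum {ι : Type} (s : Finset ι) {k : ι → Euc n → ℝ}
    (hk : ∀ i, Continuous (k i)) (hs : ∀ i, ∀ y, 1 ≤ ‖y‖ → k i y = 0)
    (a : ℝ) {g : Euc n → ℝ} (hg : Continuous g) (x : Euc n) :
    smear (fun z => ∑ i ∈ s, k i z) a g x = ∑ i ∈ s, smear (k i) a g x := by
  unfold smear
  rw [← integral_finsetSum _ fun i _ => integrable_smear (hk i) (hs i) a hg x]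
  simp only [smul_eq_mul, Finset.sum_mul]

theorem fderiv_apply_eq_zero_of_unitBall {k : Euc n → ℝ} (hk : ContDiff ℝ 1 k)
    (hs : ∀ y, 1 ≤ ‖y‖ → k y = 0) (e : Euc n) : ∀ y, 1 ≤ ‖y‖ → fderiv ℝ k y e = 0 :=
  fun y hy => by rw [fderiv_eq_zero_of_unitBall hk hs y hy]; rfl

theorem lap_eq_zero_of_unitBall {k : Euc n → ℝ} (hk : ContDiff ℝ 2 k)
    (hs : ∀ y, 1 ≤ ‖y‖ → k y = 0) : ∀ y, 1 ≤ ‖y‖ → lap k y = 0 := fun y hy =>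
  Finset.sum_eq_zero fun _ _ => fderiv_apply_eq_zero_of_unitBall
    (ContDiff.fderiv_dir (N := 1) hk _)
    (fderiv_apply_eq_zero_of_unitBall (hk.of_le (by norm_num)) hs _) _ y hy

theorem lap_smear_kernel {k : Euc n → ℝ} (hk : ContDiff ℝ 2 k) (hs : ∀ y, 1 ≤ ‖y‖ → k y = 0)
    {a : ℝ} (ha : 0 < a) {g : Euc n → ℝ} (hg : Continuous g) (x : Euc n) :
    lap (smear k a g) x = (a⁻¹) ^ 2 * smear (lap k) a g x := by
  have hk1 : ContDiff ℝ 1 k := hk.of_le (by norm_num)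
  have hke : ∀ e : Euc n, ContDiff ℝ 1 (fun z => fderiv ℝ k z e) := fun e =>
    ContDiff.fderiv_dir (N := 1) hk e
  have hs1 := fun e => fderiv_apply_eq_zero_of_unitBall hk1 hs e
  unfold lap
  rw [smear_kernel_sum _ (fun i => ((ContDiff.fderiv_dir (N := 0) (hke _) _).continuous))
    (fun i => fderiv_apply_eq_zero_of_unitBall (hke _) (hs1 _) _) a hg, Finset.mul_sum]
  refine Finset.sum_congr rfl fun i _ => ?_
  rw [show (fun y => fderiv ℝ (smear k a g) y (EuclideanSpace.single i 1)) =
      fun y => a⁻¹ • smear (fun z => fderiv ℝ k z (EuclideanSpace.single i 1)) a g y from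
      funext fun y => fderiv_smear_kernel_apply hk1 hs ha hg y _]
  rw [fderiv_fun_const_smul]
  · rw [smul_apply, fderiv_smear_kernel_apply (hke _) (hs1 _) ha hg, smul_eq_mul]
    ring
  · rw [← tsmear_eq_smear]
    exact (hasFDerivAt_tsmear (hke _) (hs1 _) ha hg x).differentiableAt

theorem lap_const_mul (c : ℝ) {f : Euc n → ℝ} (hf : ContDiff ℝ 2 f) :
    lap (fun x => c * f x) = fun x => c * lap f x := by
  have h1 : (fun y => fderiv ℝ (fun x => c * f x) y) = fun y => c • fderiv ℝ f y := by
    ext1 y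
    exact fderiv_const_mul ((hf.differentiable two_ne_zero) y) c
  ext x
  unfold lap
  rw [Finset.mul_sum]
  refine Finset.sum_congr rfl fun i _ => ?_
  have h2 : (fun y => fderiv ℝ (fun x => c * f x) y (EuclideanSpace.single i 1)) =
      fun y => c * fderiv ℝ f y (EuclideanSpace.single i 1) := by
    ext y
    rw [congrFun h1 y]
    rfl
  rw [h2, fderiv_const_mul]
  · rfl
  · exact ((ContDiff.fderiv_dir (N := 1) hf _).differentiable one_ne_zero) x

theorem lap_iterate_const_mul (c : ℝ) {m : ℕ} {f : Euc n → ℝ}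
    (hf : ContDiff ℝ (2 * m : ℕ) f) :
    lap^[m] (fun x => c * f x) = fun x => c * lap^[m] f x := by
  induction m generalizing f with
  | zero => rfl
  | succ m ih =>
    have h2 : ContDiff ℝ 2 f := hf.of_le (by norm_cast; omega)
    simp only [Function.iterate_succ, Function.comp_apply]
    rw [lap_const_mul c h2]
    exact ih (ContDiff.lap (N := 2 * m) hf)

theorem contDiff_smear_kernel {k : Euc n → ℝ} {N : ℕ} (hk : ContDiff ℝ N k)
    (hs : ∀ y, 1 ≤ ‖y‖ → k y = 0) {a : ℝ} (ha : 0 < a) {g : Euc n → ℝ} (hg : Continuous g) :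
    ContDiff ℝ N (smear k a g) := by
  induction N generalizing k with
  | zero => exact contDiff_zero.2 (continuous_smear hk.continuous hs a hg)
  | succ N ih =>
    have hk1 : ContDiff ℝ 1 k := hk.of_le (by exact_mod_cast Nat.le_add_left 1 N)
    rw [show ((N + 1 : ℕ) : WithTop ℕ∞) = (N : WithTop ℕ∞) + 1 by push_cast; rfl,
      contDiff_succ_iff_fderiv_apply]
    refine ⟨fun x => ?_, by simp, fun e => ?_⟩
    · rw [← tsmear_eq_smear]
      exact (hasFDerivAt_tsmear hk1 hs ha hg x).differentiableAt
    · simp only [fderiv_smear_kernel_apply hk1 hs ha hg]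
      exact contDiff_const.mul (ih (hk.fderiv_dir e) (fderiv_apply_eq_zero_of_unitBall hk1 hs e))

theorem lap_iterate_smear_kernel {m : ℕ} {k : Euc n → ℝ} (hk : ContDiff ℝ (2 * m : ℕ) k)
    (hs : ∀ y, 1 ≤ ‖y‖ → k y = 0) {a : ℝ} (ha : 0 < a) {g : Euc n → ℝ} (hg : Continuous g) :
    lap^[m] (smear k a g) = fun x => (a⁻¹) ^ (2 * m) * smear (lap^[m] k) a g x := by
  induction m generalizing k with
  | zero => simp
  | succ m ih =>
    have h2 : ContDiff ℝ 2 k := hk.of_le (by norm_cast; omega)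
    have hl : ContDiff ℝ (2 * m : ℕ) (lap k) := ContDiff.lap (N := 2 * m) hk
    have hls := lap_eq_zero_of_unitBall h2 hs
    simp only [Function.iterate_succ, Function.comp_apply]
    rw [funext (lap_smear_kernel h2 hs ha hg),
      lap_iterate_const_mul _ (contDiff_smear_kernel hl hls ha hg), ih hl hls]
    ext x
    ring

end Laplacian

section Pizzetti

variable {n : ℕ}

/-- The radial kernel with profile `h` in the variable `‖y‖ ^ 2`. -/
noncomputable def radial (n : ℕ) (h : ℝ → ℝ) (y : Euc n) : ℝ := h (‖y‖ ^ 2)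

theorem continuous_radial {h : ℝ → ℝ} (hc : Continuous h) : Continuous (radial n h) :=
  hc.comp (by fun_prop)

theorem radial_eq_zero {h : ℝ → ℝ} (hs : ∀ s, 1 ≤ s → h s = 0) :
    ∀ y : Euc n, 1 ≤ ‖y‖ → radial n h y = 0 :=
  fun y hy => hs _ (by nlinarith)

theorem hasFDerivAt_radial {H h : ℝ → ℝ} (hH : ∀ s, HasDerivAt H (h s) s) (y : Euc n) :
    HasFDerivAt (radial n H) ((2 * h (‖y‖ ^ 2)) • innerSL ℝ y) y := by
  have := (hH (‖y‖ ^ 2)).comp_hasFDerivAt y (hasStrictFDerivAt_norm_sq y).hasFDerivAt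
  refine this.congr_fderiv ?_
  ext v
  simp
  ring

theorem fderiv_apply_eq_sum (L : Euc n →L[ℝ] ℝ) (y : Euc n) :
    L y = ∑ i, y i * L (EuclideanSpace.single i 1) := by
  conv_lhs => rw [← (EuclideanSpace.basisFun (Fin n) ℝ).sum_repr y]
  simp [map_sum]

theorem hasDerivAt_smear_radius {h H : ℝ → ℝ} (hc : Continuous h) (hs : ∀ s, 1 ≤ s → h s = 0)
    (hH : ∀ s, HasDerivAt H (-h s) s) (hHs : ∀ s, 1 ≤ s → H s = 0)
    {w : Euc n → ℝ} (hw : ContDiff ℝ 2 w) (x : Euc n) (t : ℝ) :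
    HasDerivAt (fun t => smear (radial n h) t w x)
      (t * smear (radial n fun s => 1 / 2 * H s) t (lap w) x) t := by
  have hw1 : ContDiff ℝ 1 w := hw.of_le (by norm_num)
  have hwf := hw1.continuous_fderiv one_ne_zero
  have hHc : Continuous H := continuous_iff_continuousAt.2 fun s => (hH s).continuousAt
  set R : Euc n → ℝ := radial n fun s => 1 / 2 * H s with hR
  have hRc : Continuous R := continuous_radial (by fun_prop)
  have hR0 : ∀ y, 1 ≤ ‖y‖ → R y = 0 := radial_eq_zero fun s hs => by simp [hHs s hs]
  have hRd : ∀ y, HasFDerivAt R ((-h (‖y‖ ^ 2)) • innerSL ℝ y) y := fun y => by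
    refine (hasFDerivAt_radial (fun s => (hH s).const_mul (1 / 2)) y).congr_fderiv ?_
    congr 1
    ring
  have hwe : ∀ e : Euc n, ContDiff ℝ 1 (fun z => fderiv ℝ w z e) := fun e =>
    ContDiff.fderiv_dir (N := 1) hw e
  have hkc := continuous_radial (n := n) hc
  have hk0 := radial_eq_zero (n := n) hs
  have hparts : ∀ e : Euc n, ∫ y, radial n h y * (inner ℝ y e * fderiv ℝ w (x - t • y) e) =
      -(t * smear R t (fun z => fderiv ℝ (fun z => fderiv ℝ w z e) z e) x) := by
    intro e
    have hin : ∀ y, HasFDerivAt (fun y => fderiv ℝ w (x - t • y) e)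
        ((fderiv ℝ (fun z => fderiv ℝ w z e) (x - t • y)).comp
          (-(t • ContinuousLinearMap.id ℝ (Euc n)))) y := by
      intro y
      exact HasFDerivAt.comp y (f := fun y => x - t • y)
        (((hwe e).differentiable one_ne_zero) (x - t • y)).hasFDerivAt
        (((hasFDerivAt_id y).const_smul t).const_sub x)
    have hRc' : Continuous fun y => fderiv ℝ R y e := by
      simp only [fun y => (hRd y).fderiv]
      simp only [smul_apply, innerSL_apply_apply, smul_eq_mul]
      exact (hc.comp (by fun_prop)).neg.mul (by fun_prop)
    have hR'0 : ∀ y, 1 ≤ ‖y‖ → fderiv ℝ R y e = 0 := fun y hy => by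
      rw [(hRd y).fderiv]
      simp [hs (‖y‖ ^ 2) (by nlinarith)]
    have hgc : Continuous fun y => fderiv ℝ w (x - t • y) e :=
      (hwe e).continuous.comp (by fun_prop)
    have hg'c : Continuous fun y => fderiv ℝ (fun y => fderiv ℝ w (x - t • y) e) y e := by
      simp only [fun y => (hin y).fderiv]
      have := ((hwe e).continuous_fderiv one_ne_zero)
      simp only [ContinuousLinearMap.comp_apply]
      exact (this.comp (by fun_prop)).clm_apply (by fun_prop)
    have := integral_mul_fderiv_eq_neg_fderiv_mul_of_integrable (μ := (volume : Measure (Euc n)))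
      (f := fun y => fderiv ℝ w (x - t • y) e) (g := R) (v := e)
      (integrable_of_unitBall (hg'c.mul hRc) fun y hy => by simp [hR0 y hy])
      (integrable_of_unitBall (hgc.mul hRc') fun y hy => by simp [hR'0 y hy])
      (integrable_of_unitBall (hgc.mul hRc) fun y hy => by simp [hR0 y hy])
      (fun y _ => (hin y).differentiableAt) (fun y _ => (hRd y).differentiableAt)
    rw [smear, ← integral_const_mul]
    calc _ = -∫ y, fderiv ℝ w (x - t • y) e * fderiv ℝ R y e := by
          rw [← integral_neg]
          refine integral_congr_ae (Eventually.of_forall fun y => ?_)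
          simp only [(hRd y).fderiv, radial]
          simp
          ring
      _ = _ := by
          rw [this, neg_neg, ← integral_neg]
          refine integral_congr_ae (Eventually.of_forall fun y => ?_)
          simp only [(hin y).fderiv]
          simp
          ring
  have hD := hasFDerivAt_integral_kernel (H := ℝ) hkc hk0
    (A := fun t y => w (x - t • y))
    (A' := fun t y => (fderiv ℝ w (x - t • y)).comp
      (-(ContinuousLinearMap.toSpanSingleton ℝ y)))
    (fun t => hw.continuous.comp (by fun_prop)) ?_ ?_ t
  · have := hD.hasDerivAt
    refine this.congr_deriv ?_
    rw [ContinuousLinearMap.integral_apply]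
    · have e1 : (lap w) = fun z => ∑ i, fderiv ℝ (fun z => fderiv ℝ w z
          (EuclideanSpace.single i 1)) z (EuclideanSpace.single i 1) := rfl
      rw [e1, smear_sum _ hRc hR0 t
        (fun i => ((ContDiff.fderiv_dir (N := 0) (hwe _) _).continuous)), Finset.mul_sum]
      calc _ = ∫ y, ∑ i, -(radial n h y * (inner ℝ y (EuclideanSpace.single i 1) *
            fderiv ℝ w (x - t • y) (EuclideanSpace.single i 1))) := by
            refine integral_congr_ae (Eventually.of_forall fun y => ?_)
            simp only [smul_apply, ContinuousLinearMap.comp_apply, smul_eq_mul,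
              neg_apply, ContinuousLinearMap.toSpanSingleton_apply, one_smul,
              map_neg, Finset.sum_neg_distrib]
            rw [fderiv_apply_eq_sum, ← Finset.mul_sum, mul_neg]
            simp [EuclideanSpace.inner_single_right]
        _ = _ := by
            rw [integral_finsetSum]
            · refine Finset.sum_congr rfl fun i _ => ?_
              rw [integral_neg, hparts, neg_neg]
            · intro i _
              refine (integrable_of_unitBall (hkc.mul (Continuous.mul (by fun_prop)
                ((hwe _).continuous.comp (by fun_prop)))) fun y hy => ?_).neg
              simp [hk0 y hy]
    · refine integrable_of_unitBall (hkc.smul (Continuous.clm_comp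
        (hwf.comp (by fun_prop)) ?_)) fun y hy => by simp [hk0 y hy]
      exact (ContinuousLinearMap.toSpanSingletonCLE (𝕜 := ℝ) (E := Euc n)).continuous.neg
  · refine Continuous.clm_comp (hwf.comp (by fun_prop)) ?_
    exact ((ContinuousLinearMap.toSpanSingletonCLE (𝕜 := ℝ)
      (E := Euc n)).continuous.comp continuous_snd).neg
  · intro p y
    refine HasFDerivAt.comp p (f := fun p : ℝ => x - p • y)
      ((hw1.differentiable one_ne_zero) (x - p • y)).hasFDerivAt ?_
    refine (((hasFDerivAt_id (𝕜 := ℝ) p).smul_const y).const_sub x).congr_fderiv ?_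
    ext
    simp

theorem exists_antideriv_of_unitInterval {h : ℝ → ℝ} (hc : Continuous h)
    (hs : ∀ s, 1 ≤ s → h s = 0) :
    ∃ H : ℝ → ℝ, (∀ s, HasDerivAt H (-h s) s) ∧ ∀ s, 1 ≤ s → H s = 0 := by
  refine ⟨fun s => -∫ t in (1 : ℝ)..s, h t,
    fun s => (hc.integral_hasStrictDerivAt 1 s).hasDerivAt.neg, fun s h1 => ?_⟩
  beta_reduce
  rw [intervalIntegral.integral_congr (g := fun _ => (0 : ℝ))]
  · simp
  · intro t ht
    rw [uIcc_of_le h1] at ht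
    exact hs t ht.1

/-- The Pizzetti expansion of radial averages, with remainder. -/
theorem pizzetti (m : ℕ) : ∀ h : ℝ → ℝ, Continuous h → (∀ s, 1 ≤ s → h s = 0) →
    ∃ (c : ℕ → ℝ) (C : ℝ), 0 ≤ C ∧ (0 < m → c 0 = ∫ y, radial n h y) ∧
      ∀ w : Euc n → ℝ, ContDiff ℝ (2 * m : ℕ) w → ∀ (x : Euc n) (ε : ℝ), 0 ≤ ε → ∀ M : ℝ,
        (∀ z ∈ closedBall x ε, |lap^[m] w z| ≤ M) →
        |smear (radial n h) ε w x - ∑ i ∈ Finset.range m, c i * ε ^ (2 * i) * lap^[i] w x| ≤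
          C * ε ^ (2 * m) * M := by
  induction m with
  | zero =>
    intro h hc hs
    refine ⟨0, ∫ y, |radial n h y|, integral_nonneg fun _ => abs_nonneg _, by simp, ?_⟩
    intro w hw x ε hε M hM
    simpa using norm_smear_le (continuous_radial hc) (radial_eq_zero hs) hε (g := w) (x := x)
      (N := M) hM
  | succ m ih =>
    intro h hc hs
    obtain ⟨H, hH, hHs⟩ := exists_antideriv_of_unitInterval hc hs
    have hHc : Continuous H := continuous_iff_continuousAt.2 fun s => (hH s).continuousAt
    obtain ⟨c, C, hC, -, hcC⟩ := ih (fun s => 1 / 2 * H s) (by fun_prop)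
      (fun s h => by simp [hHs s h])
    refine ⟨fun i => if i = 0 then ∫ y, radial n h y else c (i - 1) / (2 * i), C, hC,
      by simp, ?_⟩
    intro w hw x ε hε M hM
    have hw2 : ContDiff ℝ 2 w := hw.of_le (by norm_cast; omega)
    have hd := hasDerivAt_smear_radius hc hs hH hHs hw2 x
    rw [Finset.sum_range_succ']
    simp only [Nat.add_eq_zero_iff, one_ne_zero, and_false, if_false, if_true,
      Nat.add_sub_cancel, Function.iterate_zero, id_eq, mul_zero, pow_zero, mul_one]
    set G : ℝ → ℝ := fun t => smear (radial n h) t w x -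
      ∑ i ∈ Finset.range m, c i / (2 * ((i + 1 : ℕ) : ℝ)) * t ^ (2 * (i + 1)) *
        lap^[i + 1] w x with hG
    have hGd : ∀ t, HasDerivAt G (t * (smear (radial n fun s => 1 / 2 * H s) t (lap w) x -
        ∑ i ∈ Finset.range m, c i * t ^ (2 * i) * lap^[i] (lap w) x)) t := by
      intro t
      rw [mul_sub, Finset.mul_sum]
      refine (hd t).sub (HasDerivAt.fun_sum fun i _ => ?_)
      have := (((hasDerivAt_pow (2 * (i + 1)) t).const_mul
        (c i / (2 * ((i + 1 : ℕ) : ℝ)))).mul_const (lap^[i + 1] w x))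
      refine this.congr_deriv ?_
      rw [Function.iterate_succ, Function.comp_apply,
        show 2 * (i + 1) - 1 = 2 * i + 1 by omega]
      have : ((i : ℝ) + 1) ≠ 0 := by positivity
      push_cast
      field_simp
      ring
    have hG0 : G 0 = (∫ y, radial n h y) * w x := by
      simp [hG, smear_zero]
    have hb : ∀ t ∈ Icc (0 : ℝ) ε, ‖t * (smear (radial n fun s => 1 / 2 * H s) t (lap w) x -
        ∑ i ∈ Finset.range m, c i * t ^ (2 * i) * lap^[i] (lap w) x)‖ ≤
          C * ε ^ (2 * m + 1) * M := by
      intro t ht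
      have h1 := hcC (lap w) (ContDiff.lap (N := 2 * m) hw) x t ht.1 M fun z hz =>
        hM z (closedBall_subset_closedBall ht.2 hz)
      have hM0 : 0 ≤ M := (abs_nonneg _).trans (hM x (mem_closedBall_self hε))
      rw [norm_mul, Real.norm_of_nonneg ht.1, Real.norm_eq_abs]
      calc _ ≤ ε * (C * ε ^ (2 * m) * M) := by
            have := ht.1
            have := ht.2
            gcongr
            refine h1.trans ?_
            gcongr
        _ = _ := by ring
    have := (convex_Icc (0 : ℝ) ε).norm_image_sub_le_of_norm_hasDerivWithin_le
      (fun t _ => (hGd t).hasDerivWithinAt) hb (left_mem_Icc.2 hε) (right_mem_Icc.2 hε)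
    rw [hG0] at this
    rw [← sub_sub]
    refine this.trans (le_of_eq ?_)
    rw [sub_zero, Real.norm_of_nonneg hε]
    ring

end Pizzetti

section MeanValue

variable {n : ℕ}

theorem exists_profile (n : ℕ) : ∃ h : ℝ → ℝ, (∀ N : ℕ, ContDiff ℝ N h) ∧
    (∀ s, 1 ≤ s → h s = 0) ∧ (∀ s, 0 ≤ h s) ∧ (∀ s, s < 1 → 0 < h s) ∧
    ∫ y, radial n h y = 1 := by
  have hsm : ∀ N : ℕ, ContDiff ℝ N fun s : ℝ => Real.smoothTransition (1 - s) := fun N =>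
    Real.smoothTransition.contDiff.comp (contDiff_const.sub contDiff_id)
  have h0 : ∀ s : ℝ, 1 ≤ s → Real.smoothTransition (1 - s) = 0 := fun s hs =>
    Real.smoothTransition.zero_of_nonpos (by linarith)
  set I := ∫ y, radial n (fun s : ℝ => Real.smoothTransition (1 - s)) y with hI
  have hc : Continuous (radial n (fun s : ℝ => Real.smoothTransition (1 - s))) :=
    continuous_radial (hsm 0).continuous
  have hIpos : 0 < I := by
    refine hc.integral_pos_of_hasCompactSupport_nonneg_nonzero
      (hasCompactSupport_of_unitBall (radial_eq_zero h0))
      (fun y => Real.smoothTransition.nonneg _) (x := 0) ?_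
    simp [radial, Real.smoothTransition.one]
  refine ⟨fun s => I⁻¹ * Real.smoothTransition (1 - s), fun N => contDiff_const.mul (hsm N),
    fun s hs => by simp [h0 s hs], fun s => ?_, fun s hs => ?_, ?_⟩
  · exact mul_nonneg (by positivity) (Real.smoothTransition.nonneg _)
  · exact mul_pos (by positivity) (Real.smoothTransition.pos_of_pos (by linarith))
  · have : radial n (fun s => I⁻¹ * Real.smoothTransition (1 - s)) =
        fun y => I⁻¹ * radial n (fun s : ℝ => Real.smoothTransition (1 - s)) y := rfl
    rw [this, integral_const_mul, ← hI, inv_mul_cancel₀ hIpos.ne']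

/-- The interpolation nodes `(j + 1)⁻²`. -/
noncomputable def node (j : ℕ) : ℝ := (((j : ℝ) + 1)⁻¹) ^ 2

theorem node_injective : Function.Injective node := by
  intro i j h
  unfold node at h
  have := (pow_left_inj₀ (by positivity) (by positivity) two_ne_zero).1 h
  exact_mod_cast add_right_cancel (inv_inj.1 this)

/-- Lagrange coefficients for the nodes `(j + 1)⁻²`. -/
noncomputable def lagr (m j : ℕ) (r : ℝ) : ℝ :=
  (Lagrange.basis (Finset.range m) node j).eval r

theorem sum_pow_eq_lagr (m : ℕ) (b : ℕ → ℝ) (r : ℝ) :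
    ∑ i ∈ Finset.range m, b i * r ^ i =
      ∑ j ∈ Finset.range m, lagr m j r * ∑ i ∈ Finset.range m, b i * node j ^ i := by
  set P : Polynomial ℝ := ∑ i ∈ Finset.range m, Polynomial.C (b i) * Polynomial.X ^ i with hP
  have hev : ∀ s, P.eval s = ∑ i ∈ Finset.range m, b i * s ^ i := by
    intro s
    simp [hP, Polynomial.eval_finsetSum]
  have hdeg : P.degree < (Finset.range m).card := by
    rw [Finset.card_range, ← Polynomial.mem_degreeLT, hP]
    exact Submodule.sum_mem _ fun i hi => Polynomial.mem_degreeLT.2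
      ((Polynomial.degree_C_mul_X_pow_le i _).trans_lt
        (by exact_mod_cast Finset.mem_range.1 hi))
  have := congrArg (Polynomial.eval r) (Lagrange.eq_interpolate node_injective.injOn hdeg)
  rw [hev, Lagrange.interpolate_apply] at this
  rw [this, Polynomial.eval_finsetSum]
  refine Finset.sum_congr rfl fun j _ => ?_
  rw [Polynomial.eval_mul, Polynomial.eval_C, hev, lagr, mul_comm]

theorem smear_rescale {k : Euc n → ℝ} (g : Euc n → ℝ) (a : ℝ) {l : ℝ} (hl : 0 < l) (x : Euc n) :
    smear (fun y => (l ^ n)⁻¹ * k (l⁻¹ • y)) a g x = smear k (a * l) g x := by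
  have := Measure.integral_comp_smul (μ := (volume : Measure (Euc n)))
      (fun y => k (l⁻¹ • y) • g (x - a • y)) l
  simp only [finrank_euclideanSpace, Fintype.card_fin, inv_smul_smul₀ hl.ne', smul_smul] at this
  rw [smear, smear, this, abs_of_pos (by positivity), ← integral_smul]
  refine integral_congr_ae (Eventually.of_forall fun y => ?_)
  simp only [smul_eq_mul, mul_assoc]

/-- A smooth kernel reproducing polyharmonic functions. -/
theorem exists_meanValue_kernel (n : ℕ) {m : ℕ} (hm : 0 < m) : ∃ η : Euc n → ℝ,
    (∀ N : ℕ, ContDiff ℝ N η) ∧ (∀ y, 1 ≤ ‖y‖ → η y = 0) ∧ ∫ y, η y = 1 ∧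
    ∃ C : ℝ, 0 ≤ C ∧ ∀ w : Euc n → ℝ, ContDiff ℝ (2 * m : ℕ) w → ∀ (x : Euc n) (a : ℝ), 0 ≤ a →
      ∀ M : ℝ, (∀ z ∈ closedBall x a, |lap^[m] w z| ≤ M) →
        |w x - smear η a w x| ≤ C * a ^ (2 * m) * M := by
  obtain ⟨h, hsm, hs, hnn, hpos, hint⟩ := exists_profile n
  obtain ⟨c, C, hC, hc0, hP⟩ := pizzetti (n := n) m h (hsm 0).continuous hs
  have hkc : Continuous (radial n h) := continuous_radial (hsm 0).continuous
  have hks := radial_eq_zero (n := n) hs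
  set l : ℕ → ℝ := fun j => ((j : ℝ) + 1)⁻¹ with hl
  have hl0 : ∀ j, 0 < l j := fun j => by positivity
  have hl1 : ∀ j, l j ≤ 1 := fun j => inv_le_one_of_one_le₀ (by
    have : (0 : ℝ) ≤ j := by positivity
    linarith)
  set k : ℕ → Euc n → ℝ := fun j y => ((l j) ^ n)⁻¹ * radial n h ((l j)⁻¹ • y) with hk
  have hksm : ∀ j (N : ℕ), ContDiff ℝ N (k j) := fun j N => by
    refine contDiff_const.mul (ContDiff.comp (hsm N) ?_)
    exact (contDiff_norm_sq ℝ).comp (contDiff_id.const_smul (l j)⁻¹)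
  have hk0 : ∀ j y, 1 ≤ ‖y‖ → k j y = 0 := fun j y hy => by
    simp only [hk]
    rw [hks, mul_zero]
    rw [norm_smul, norm_inv, Real.norm_of_nonneg (hl0 j).le, inv_mul_eq_div, le_div_iff₀ (hl0 j)]
    linarith [hl1 j]
  set η : Euc n → ℝ := fun y => ∑ j ∈ Finset.range m, lagr m j 0 * k j y with hη
  have hηs : ∀ y, 1 ≤ ‖y‖ → η y = 0 := fun y hy => by simp [hη, hk0 _ y hy]
  have hηsm : ∀ N : ℕ, ContDiff ℝ N η := fun N =>
    ContDiff.sum fun j _ => contDiff_const.mul (hksm j N)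
  have hsmear : ∀ (w : Euc n → ℝ), Continuous w → ∀ a x,
      smear η a w x = ∑ j ∈ Finset.range m, lagr m j 0 * smear (radial n h) (a * l j) w x := by
    intro w hw a x
    rw [hη, smear_kernel_sum _ (fun j => (contDiff_const.mul (hksm j 0)).continuous)
      (fun j y hy => by simp [hk0 j y hy]) a hw]
    refine Finset.sum_congr rfl fun j _ => ?_
    rw [← smear_rescale w a (hl0 j)]
    unfold smear
    rw [← integral_const_mul]
    simp only [smul_eq_mul, hk, mul_assoc]
  set D := ∑ j ∈ Finset.range m, |lagr m j 0| * C with hD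
  have hD0 : 0 ≤ D := Finset.sum_nonneg fun j _ => by positivity
  have hest : ∀ w : Euc n → ℝ, ContDiff ℝ (2 * m : ℕ) w → ∀ (x : Euc n) (a : ℝ), 0 ≤ a →
      ∀ M : ℝ, (∀ z ∈ closedBall x a, |lap^[m] w z| ≤ M) →
        |w x - smear η a w x| ≤ D * a ^ (2 * m) * M := by
    intro w hw x a ha M hM
    have hM0 : 0 ≤ M := (abs_nonneg _).trans (hM x (mem_closedBall_self ha))
    have hw0 : w x = ∑ j ∈ Finset.range m, lagr m j 0 *
        ∑ i ∈ Finset.range m, c i * (a * l j) ^ (2 * i) * lap^[i] w x := by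
      have := sum_pow_eq_lagr m (fun i => c i * a ^ (2 * i) * lap^[i] w x) 0
      obtain ⟨m, rfl⟩ := Nat.exists_eq_succ_of_ne_zero hm.ne'
      rw [Finset.sum_range_succ'] at this
      simp only [ne_eq, Nat.add_eq_zero_iff, one_ne_zero, and_false, not_false_eq_true, zero_pow,
        mul_zero, Finset.sum_const_zero, zero_add, pow_zero, mul_one, Function.iterate_zero, id_eq,
        hc0 hm, hint, one_mul] at this
      rw [this]
      refine Finset.sum_congr rfl fun j _ => ?_
      congr 1
      refine Finset.sum_congr rfl fun i _ => ?_
      simp only [node, hl, ← pow_mul, mul_pow]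
      ring
    rw [hsmear w hw.continuous, hw0, ← Finset.sum_sub_distrib]
    refine (Finset.abs_sum_le_sum_abs _ _).trans ?_
    rw [hD, Finset.sum_mul, Finset.sum_mul]
    refine Finset.sum_le_sum fun j _ => ?_
    rw [← mul_sub, abs_mul, mul_assoc, mul_assoc, abs_sub_comm]
    refine mul_le_mul_of_nonneg_left ?_ (abs_nonneg _)
    have hal : a * l j ≤ a := mul_le_of_le_one_right ha (hl1 j)
    have hal0 : 0 ≤ a * l j := mul_nonneg ha (hl0 j).le
    refine (hP w hw x (a * l j) hal0 M
      fun z hz => hM z (closedBall_subset_closedBall hal hz)).trans ?_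
    rw [mul_assoc]
    gcongr
  refine ⟨η, hηsm, hηs, ?_, D, hD0, hest⟩
  have := hest (fun _ => 1) contDiff_const 0 0 le_rfl
    |lap^[m] (fun _ => (1 : ℝ)) (0 : Euc n)| (fun z hz => by
      rw [closedBall_zero, mem_singleton_iff] at hz
      rw [hz])
  rw [zero_pow (by omega), mul_zero, zero_mul, smear_zero] at this
  have := abs_nonpos_iff.1 this
  simp only [smul_eq_mul, mul_one] at this
  linarith

/-- Radial averages of functions with bounded `Δ ^ m` are controlled by averages at finitely
many fixed radii. -/
theorem abs_smear_radial_le (n m : ℕ) {h : ℝ → ℝ} (hc : Continuous h)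
    (hs : ∀ s, 1 ≤ s → h s = 0) {R : ℝ} (hR : 1 ≤ R) : ∃ B : ℝ, 0 ≤ B ∧
    ∀ w : Euc n → ℝ, ContDiff ℝ (2 * m : ℕ) w → ∀ (x : Euc n) (M : ℝ),
      (∀ z ∈ closedBall x R, |lap^[m] w z| ≤ M) →
      |smear (radial n h) R w x| ≤
        B * (∑ j ∈ Finset.range m, |smear (radial n h) ((j : ℝ) + 1)⁻¹ w x| + M) := by
  obtain ⟨c, C, hC, -, hP⟩ := pizzetti (n := n) m h hc hs
  set l : ℕ → ℝ := fun j => ((j : ℝ) + 1)⁻¹ with hl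
  have hl0 : ∀ j, 0 < l j := fun j => by positivity
  have hl1 : ∀ j, l j ≤ 1 := fun j => inv_le_one_of_one_le₀ (by
    have : (0 : ℝ) ≤ j := by positivity
    linarith)
  set S := ∑ j ∈ Finset.range m, |lagr m j (R ^ 2)| with hS
  have hS0 : 0 ≤ S := Finset.sum_nonneg fun _ _ => abs_nonneg _
  refine ⟨S + C * R ^ (2 * m) + S * C, by positivity, fun w hw x M hM => ?_⟩
  have hR0 : 0 ≤ R := by linarith
  have hM0 : 0 ≤ M := (abs_nonneg _).trans (hM x (mem_closedBall_self hR0))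
  set q : ℝ → ℝ := fun r => ∑ i ∈ Finset.range m, c i * r ^ (2 * i) * lap^[i] w x with hq
  set T := ∑ j ∈ Finset.range m, |smear (radial n h) (l j) w x| with hT
  have hT0 : 0 ≤ T := Finset.sum_nonneg fun _ _ => abs_nonneg _
  have h1 : |smear (radial n h) R w x - q R| ≤ C * R ^ (2 * m) * M := hP w hw x R hR0 M hM
  have h2 : ∀ j, |smear (radial n h) (l j) w x - q (l j)| ≤ C * M := fun j => by
    refine (hP w hw x (l j) (hl0 j).le M fun z hz =>
      hM z (closedBall_subset_closedBall ((hl1 j).trans hR) hz)).trans ?_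
    have : (l j) ^ (2 * m) ≤ 1 := pow_le_one₀ (hl0 j).le (hl1 j)
    gcongr
    exact mul_le_of_le_one_right hC this
  have h3 : q R = ∑ j ∈ Finset.range m, lagr m j (R ^ 2) * q (l j) := by
    have := sum_pow_eq_lagr m (fun i => c i * lap^[i] w x) (R ^ 2)
    simp only [node, ← pow_mul] at this
    simp only [hq]
    refine Eq.trans (Finset.sum_congr rfl fun i _ => by ring) (this.trans
      (Finset.sum_congr rfl fun j _ => ?_))
    congr 1
    exact Finset.sum_congr rfl fun i _ => by ring
  have h4 : |q R| ≤ S * (T + C * M) := by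
    rw [h3, hS, Finset.sum_mul]
    refine (Finset.abs_sum_le_sum_abs _ _).trans (Finset.sum_le_sum fun j hj => ?_)
    rw [abs_mul]
    refine mul_le_mul_of_nonneg_left ?_ (abs_nonneg _)
    have h5 : |smear (radial n h) (l j) w x| ≤ T :=
      Finset.single_le_sum (f := fun j => |smear (radial n h) (l j) w x|)
        (fun _ _ => abs_nonneg _) hj
    have := abs_sub_abs_le_abs_sub (q (l j)) (smear (radial n h) (l j) w x)
    rw [abs_sub_comm] at this
    linarith [h2 j]
  have h5 := abs_sub_abs_le_abs_sub (smear (radial n h) R w x) (q R)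
  have h6 : 0 ≤ C * R ^ (2 * m) * T := by positivity
  have h7 : 0 ≤ S * C * T := by positivity
  have h8 : 0 ≤ S * M := by positivity
  nlinarith

end MeanValue

section DerivativeEstimates

variable {n : ℕ}

theorem norm_iteratedFDeriv_fderiv_sub {F : Type} [NormedAddCommGroup F] [NormedSpace ℝ F]
    (i : ℕ) (f g : Euc n → F) (x y : Euc n) :
    ‖iteratedFDeriv ℝ i (fderiv ℝ f) x - iteratedFDeriv ℝ i (fderiv ℝ g) y‖ =
      ‖iteratedFDeriv ℝ (i + 1) f x - iteratedFDeriv ℝ (i + 1) g y‖ := by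
  rw [iteratedFDeriv_succ_eq_comp_right, iteratedFDeriv_succ_eq_comp_right, ← dist_eq_norm,
    ← dist_eq_norm]
  exact ((continuousMultilinearCurryRightEquiv' ℝ i (Euc n) F).symm.dist_map _ _).symm

theorem exists_tendstoLocallyUniformlyOn_of_geometric {F : Type} [NormedAddCommGroup F]
    [CompleteSpace F] {f : ℕ → Euc n → F}
    (h : ∀ R : ℝ, ∃ D : ℝ, ∀ x ∈ closedBall (0 : Euc n) R, ∀ j : ℕ,
      ‖f j x - f (j + 1) x‖ ≤ D * (1 / 2) ^ j) :
    ∃ g : Euc n → F, TendstoLocallyUniformlyOn f g atTop univ := by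
  choose D hD using h
  have hd : ∀ R, ∀ x ∈ closedBall (0 : Euc n) R, ∀ j : ℕ,
      dist (f j x) (f (j + 1) x) ≤ (2 * D R) / 2 / 2 ^ j := fun R x hx j => by
    rw [dist_eq_norm]
    refine (hD R x hx j).trans (le_of_eq ?_)
    rw [one_div, inv_pow]
    field_simp
  have hx : ∀ x : Euc n, x ∈ closedBall (0 : Euc n) ‖x‖ := fun x => by simp
  have hlim : ∀ x, ∃ l, Tendsto (fun j => f j x) atTop (𝓝 l) := fun x =>
    cauchySeq_tendsto_of_complete (cauchySeq_of_le_geometric_two (hd _ x (hx x)))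
  choose g hg using hlim
  refine ⟨g, ?_⟩
  rw [tendstoLocallyUniformlyOn_iff_forall_isCompact isOpen_univ]
  intro K _ hK
  obtain ⟨R, hR⟩ := hK.isBounded.subset_closedBall (0 : Euc n)
  rw [Metric.tendstoUniformlyOn_iff]
  intro ε hε
  have h0 : Tendsto (fun j : ℕ => 2 * D R / 2 ^ j) atTop (𝓝 0) :=
    tendsto_const_nhds.div_atTop (tendsto_pow_atTop_atTop_of_one_lt one_lt_two)
  filter_upwards [h0.eventually (gt_mem_nhds hε)] with j hj x hxK
  rw [dist_comm]
  exact (dist_le_of_le_geometric_two_of_tendsto (hd R x (hR hxK)) (hg x) j).trans_lt hj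

/-- Geometric convergence of all derivatives up to order `ℓ` passes regularity to the limit. -/
theorem contDiff_of_geometric (ℓ : ℕ) : ∀ {F : Type} [NormedAddCommGroup F] [NormedSpace ℝ F]
    [CompleteSpace F] {f : ℕ → Euc n → F} {g : Euc n → F}, (∀ j, ContDiff ℝ ℓ (f j)) →
    (∀ i ≤ ℓ, ∀ R : ℝ, ∃ D : ℝ, ∀ x ∈ closedBall (0 : Euc n) R, ∀ j : ℕ,
      ‖iteratedFDeriv ℝ i (f j) x - iteratedFDeriv ℝ i (f (j + 1)) x‖ ≤ D * (1 / 2) ^ j) →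
    (∀ x, Tendsto (fun j => f j x) atTop (𝓝 (g x))) →
    ContDiff ℝ ℓ g ∧ ∀ i ≤ ℓ, ∀ x,
      Tendsto (fun j => iteratedFDeriv ℝ i (f j) x) atTop (𝓝 (iteratedFDeriv ℝ i g x)) := by
  have hzero : ∀ {F : Type} [NormedAddCommGroup F] [NormedSpace ℝ F] {f : ℕ → Euc n → F}
      {g : Euc n → F} (x : Euc n), Tendsto (fun j => f j x) atTop (𝓝 (g x)) →
      Tendsto (fun j => iteratedFDeriv ℝ 0 (f j) x) atTop (𝓝 (iteratedFDeriv ℝ 0 g x)) := by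
    intro F _ _ f g x h
    simp only [iteratedFDeriv_zero_eq_comp, Function.comp_apply]
    exact ((continuousMultilinearCurryFin0 ℝ (Euc n) F).symm.continuous.tendsto _).comp h
  induction ℓ with
  | zero =>
    intro F _ _ _ f g hf hD hg
    refine ⟨?_, fun i hi x => ?_⟩
    · have h0 : ∀ R : ℝ, ∃ D : ℝ, ∀ x ∈ closedBall (0 : Euc n) R, ∀ j : ℕ,
          ‖f j x - f (j + 1) x‖ ≤ D * (1 / 2) ^ j := by
        intro R
        obtain ⟨D, hD⟩ := hD 0 le_rfl R
        refine ⟨D, fun x hx j => le_trans (le_of_eq ?_) (hD x hx j)⟩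
        simp only [iteratedFDeriv_zero_eq_comp, Function.comp_apply, ← map_sub,
          LinearIsometryEquiv.norm_map]
      obtain ⟨g', hg'⟩ := exists_tendstoLocallyUniformlyOn_of_geometric h0
      have : g = g' := funext fun x =>
        tendsto_nhds_unique (hg x) (hg'.tendsto_at (mem_univ x))
      rw [this, Nat.cast_zero, contDiff_zero, ← continuousOn_univ]
      exact hg'.continuousOn (Frequently.of_forall fun j => (hf j).continuous.continuousOn)
    · obtain rfl : i = 0 := by omega
      exact hzero x (hg x)
  | succ ℓ ih =>
    intro F _ _ _ f g hf hD hg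
    have h1 : ∀ R : ℝ, ∃ D : ℝ, ∀ x ∈ closedBall (0 : Euc n) R, ∀ j : ℕ,
        ‖fderiv ℝ (f j) x - fderiv ℝ (f (j + 1)) x‖ ≤ D * (1 / 2) ^ j := by
      intro R
      obtain ⟨D, hD⟩ := hD 1 (by omega) R
      refine ⟨D, fun x hx j => le_trans (le_of_eq ?_) (hD x hx j)⟩
      rw [← zero_add 1, ← norm_iteratedFDeriv_fderiv_sub]
      simp only [iteratedFDeriv_zero_eq_comp, Function.comp_apply, ← map_sub,
          LinearIsometryEquiv.norm_map]
    obtain ⟨G, hG⟩ := exists_tendstoLocallyUniformlyOn_of_geometric h1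
    have hfd : ∀ j x, HasFDerivAt (f j) (fderiv ℝ (f j) x) x := fun j x =>
      (((hf j).differentiable (by simp)) x).hasFDerivAt
    have hgG : ∀ x, HasFDerivAt g (G x) x := fun x =>
      hasFDerivAt_of_tendstoLocallyUniformlyOn isOpen_univ hG (fun j x _ => hfd j x)
        (fun x _ => hg x) (mem_univ x)
    have hGeq : G = fderiv ℝ g := funext fun x => (hgG x).fderiv.symm
    have hf' : ∀ j, ContDiff ℝ ℓ (fderiv ℝ (f j)) := fun j =>
      (contDiff_succ_iff_fderiv.1 (by exact_mod_cast hf j)).2.2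
    obtain ⟨hc, ht⟩ := ih (f := fun j => fderiv ℝ (f j)) (g := fderiv ℝ g) hf'
      (fun i hi R => by
        obtain ⟨D, hD⟩ := hD (i + 1) (by omega) R
        exact ⟨D, fun x hx j => (norm_iteratedFDeriv_fderiv_sub _ _ _ _ _).trans_le (hD x hx j)⟩)
      (fun x => by
        rw [← hGeq]
        exact hG.tendsto_at (mem_univ x))
    refine ⟨?_, fun i hi x => ?_⟩
    · push_cast
      refine contDiff_succ_iff_fderiv.2 ⟨fun x => (hgG x).differentiableAt, ?_, hc⟩
      simp
    · cases i with
      | zero => exact hzero x (hg x)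
      | succ i =>
        simp only [iteratedFDeriv_succ_eq_comp_right, Function.comp_apply]
        exact ((continuousMultilinearCurryRightEquiv' ℝ i (Euc n) F).symm.continuous.tendsto _).comp
          (ht i (by omega) x)

theorem contDiff_tsmear (ℓ : ℕ) : ∀ {F : Type} [NormedAddCommGroup F] [NormedSpace ℝ F]
    {k : Euc n → F}, ContDiff ℝ ℓ k → (∀ y, 1 ≤ ‖y‖ → k y = 0) → ∀ {a : ℝ}, 0 < a →
    ∀ {g : Euc n → ℝ}, Continuous g → ContDiff ℝ ℓ (tsmear k a g) := by
  induction ℓ with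
  | zero =>
    intro F _ _ k hk hs a ha g hg
    rw [Nat.cast_zero, contDiff_zero]
    have : (fun x => tsmear k a g x) = fun x => ∫ y in closedBall (0 : Euc n) 1,
        g (x - a • y) • k y := by
      funext x
      rw [tsmear, setIntegral_eq_integral_of_forall_compl_eq_zero]
      intro y hy
      rw [hs y, smul_zero]
      simp only [mem_closedBall, dist_zero_right, not_le] at hy
      exact hy.le
    change Continuous fun x => tsmear k a g x
    rw [this]
    refine continuous_parametric_integral_of_continuous
      (f := fun x y => g (x - a • y) • k y) ?_ (isCompact_closedBall _ _)
    have := hk.continuous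
    fun_prop
  | succ ℓ ih =>
    intro F _ _ k hk hs a ha g hg
    have hk1 : ContDiff ℝ 1 k := hk.of_le (by simp)
    push_cast at hk ⊢
    have hd : ∀ x, HasFDerivAt (tsmear k a g) (a⁻¹ • tsmear (fderiv ℝ k) a g x) x :=
      fun x => hasFDerivAt_tsmear hk1 hs ha hg x
    refine contDiff_succ_iff_fderiv.2 ⟨fun x => (hd x).differentiableAt, by simp, ?_⟩
    have : fderiv ℝ (tsmear k a g) = fun x => a⁻¹ • tsmear (fderiv ℝ k) a g x :=
      funext fun x => (hd x).fderiv
    rw [this]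
    exact (ih (contDiff_succ_iff_fderiv.1 hk).2.2 (fderiv_eq_zero_of_unitBall hk1 hs) ha
      hg).const_smul a⁻¹

theorem norm_iteratedFDeriv_tsmear_le (ℓ : ℕ) : ∀ {F : Type} [NormedAddCommGroup F]
    [NormedSpace ℝ F] {k : Euc n → F}, ContDiff ℝ ℓ k → (∀ y, 1 ≤ ‖y‖ → k y = 0) →
    ∀ {a : ℝ}, 0 < a → ∀ {g : Euc n → ℝ}, Continuous g → ∀ x,
    ‖iteratedFDeriv ℝ ℓ (tsmear k a g) x‖ ≤
      a⁻¹ ^ ℓ * ∫ y, |g (x - a • y)| * ‖iteratedFDeriv ℝ ℓ k y‖ := by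
  induction ℓ with
  | zero =>
    intro F _ _ k hk hs a ha g hg x
    simp only [norm_iteratedFDeriv_zero, pow_zero, one_mul]
    refine (norm_integral_le_integral_norm _).trans (le_of_eq ?_)
    simp only [norm_smul, Real.norm_eq_abs]
  | succ ℓ ih =>
    intro F _ _ k hk hs a ha g hg x
    have hk1 : ContDiff ℝ 1 k := hk.of_le (by simp)
    have hk' : ContDiff ℝ ℓ (fderiv ℝ k) :=
      (contDiff_succ_iff_fderiv.1 (by exact_mod_cast hk)).2.2
    have hs' := fderiv_eq_zero_of_unitBall hk1 hs
    have : fderiv ℝ (tsmear k a g) = fun x => a⁻¹ • tsmear (fderiv ℝ k) a g x :=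
      funext fun x => (hasFDerivAt_tsmear hk1 hs ha hg x).fderiv
    rw [← norm_iteratedFDeriv_fderiv, this, iteratedFDeriv_const_smul_apply'
      (contDiff_tsmear ℓ hk' hs' ha hg).contDiffAt, norm_smul, norm_inv, Real.norm_of_nonneg ha.le,
      pow_succ', mul_assoc]
    refine mul_le_mul_of_nonneg_left ?_ (by positivity)
    refine (ih hk' hs' ha hg x).trans (le_of_eq ?_)
    simp only [norm_iteratedFDeriv_fderiv]

theorem iteratedFDeriv_eq_zero_of_unitBall (ℓ : ℕ) : ∀ {F : Type} [NormedAddCommGroup F]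
    [NormedSpace ℝ F] {k : Euc n → F}, ContDiff ℝ ℓ k → (∀ y, 1 ≤ ‖y‖ → k y = 0) →
    ∀ y, 1 ≤ ‖y‖ → ‖iteratedFDeriv ℝ ℓ k y‖ = 0 := by
  induction ℓ with
  | zero =>
    intro F _ _ k hk hs y hy
    rw [norm_iteratedFDeriv_zero, hs y hy, norm_zero]
  | succ ℓ ih =>
    intro F _ _ k hk hs y hy
    rw [← norm_iteratedFDeriv_fderiv]
    exact ih (contDiff_succ_iff_fderiv.1 (by exact_mod_cast hk)).2.2
      (fderiv_eq_zero_of_unitBall (hk.of_le (by simp)) hs) y hy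

theorem norm_iteratedFDeriv_smear_le_integral {ℓ : ℕ} {k : Euc n → ℝ} (hk : ContDiff ℝ ℓ k)
    (hs : ∀ y, 1 ≤ ‖y‖ → k y = 0) {a : ℝ} (ha : 0 < a) {g : Euc n → ℝ} (hg : Continuous g)
    (x : Euc n) :
    ‖iteratedFDeriv ℝ ℓ (smear k a g) x‖ ≤
      a⁻¹ ^ ℓ * smear (fun y => ‖iteratedFDeriv ℝ ℓ k y‖) a (fun z => |g z|) x := by
  rw [← tsmear_eq_smear, ← tsmear_eq_smear]
  exact norm_iteratedFDeriv_tsmear_le ℓ hk hs ha hg x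

theorem norm_iteratedFDeriv_smear_le {ℓ : ℕ} {k : Euc n → ℝ} (hk : ContDiff ℝ ℓ k)
    (hs : ∀ y, 1 ≤ ‖y‖ → k y = 0) {a : ℝ} (ha : 0 < a) {g : Euc n → ℝ} (hg : Continuous g)
    {x : Euc n} {N : ℝ} (hN : ∀ z ∈ closedBall x a, |g z| ≤ N) :
    ‖iteratedFDeriv ℝ ℓ (smear k a g) x‖ ≤ a⁻¹ ^ ℓ * ((∫ y, ‖iteratedFDeriv ℝ ℓ k y‖) * N) := by
  refine (norm_iteratedFDeriv_smear_le_integral hk hs ha hg x).trans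
    (mul_le_mul_of_nonneg_left ?_ (by positivity))
  have := norm_smear_le (k := fun y => ‖iteratedFDeriv ℝ ℓ k y‖)
    (hk.continuous_iteratedFDeriv le_rfl).norm (iteratedFDeriv_eq_zero_of_unitBall ℓ hk hs) ha.le
    (g := fun z => |g z|) (x := x) (N := N) (by simpa using hN)
  simp only [abs_norm] at this
  exact (le_abs_self _).trans this

theorem smear_comm {k k' : Euc n → ℝ} (hk : Continuous k) (hs : ∀ y, 1 ≤ ‖y‖ → k y = 0)
    (hk' : Continuous k') (hs' : ∀ y, 1 ≤ ‖y‖ → k' y = 0) (a b : ℝ) {g : Euc n → ℝ}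
    (hg : Continuous g) (x : Euc n) :
    smear k a (smear k' b g) x = smear k' b (smear k a g) x := by
  unfold smear
  simp only [← integral_smul]
  rw [integral_integral_swap_of_hasCompactSupport]
  · refine integral_congr_ae (Eventually.of_forall fun y => ?_)
    refine integral_congr_ae (Eventually.of_forall fun z => ?_)
    simp only [smul_eq_mul, sub_right_comm]
    ring
  · simp only [Function.uncurry_def]
    fun_prop
  · refine HasCompactSupport.intro ((isCompact_closedBall (0 : Euc n) 1).prod
      (isCompact_closedBall (0 : Euc n) 1)) fun p hp => ?_
    simp only [mem_prod, mem_closedBall, dist_zero_right, not_and_or, not_le] at hp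
    rcases hp with hp | hp
    · simp [Function.uncurry_def, hs _ hp.le]
    · simp [Function.uncurry_def, hs' _ hp.le]

end DerivativeEstimates

section MeanValueEstimates

variable {n : ℕ}

/-- `w` satisfies the approximate mean value property of order `2 m` near `x`. -/
def IsMV (m : ℕ) (η w : Euc n → ℝ) (x : Euc n) (M : ℝ) : Prop :=
  ∀ z ∈ closedBall x 1, ∀ b : ℝ, 0 < b → b ≤ 1 → |w z - smear η b w z| ≤ b ^ (2 * m) * M

/-- The twofold average `P_a P_a w`. -/
noncomputable def smear2 (η : Euc n → ℝ) (a : ℝ) (w : Euc n → ℝ) : Euc n → ℝ :=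
  smear η a (smear η a w)

theorem smear_sub {k : Euc n → ℝ} (hk : Continuous k) (hs : ∀ y, 1 ≤ ‖y‖ → k y = 0) (a : ℝ)
    {f g : Euc n → ℝ} (hf : Continuous f) (hg : Continuous g) (x : Euc n) :
    smear k a (fun z => f z - g z) x = smear k a f x - smear k a g x := by
  unfold smear
  rw [← integral_sub (integrable_smear hk hs a hf x) (integrable_smear hk hs a hg x)]
  simp only [smul_sub]

theorem contDiff_smear2 {η : Euc n → ℝ}
    (hη : ∀ N : ℕ, ContDiff ℝ N η) (hs : ∀ y, 1 ≤ ‖y‖ → η y = 0)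
    {a : ℝ} (ha : 0 < a) {w : Euc n → ℝ} (hw : Continuous w) (N : ℕ) :
    ContDiff ℝ N (smear2 η a w) :=
  contDiff_smear_kernel (hη N) hs ha (contDiff_smear_kernel (hη 0) hs ha hw).continuous

theorem norm_iteratedFDeriv_smear2_le {η : Euc n → ℝ}
    (hη : ∀ N : ℕ, ContDiff ℝ N η) (hs : ∀ y, 1 ≤ ‖y‖ → η y = 0)
    (ℓ : ℕ) : ∃ K : ℝ, 0 ≤ K ∧
    ∀ w : Euc n → ℝ, Continuous w → ∀ (x : Euc n) (a N : ℝ), 0 < a → a ≤ 1 →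
      (∀ z ∈ closedBall x 2, |w z| ≤ N) →
      ‖iteratedFDeriv ℝ ℓ (smear2 η a w) x‖ ≤ K * (a⁻¹ ^ ℓ * N) := by
  refine ⟨(∫ y, ‖iteratedFDeriv ℝ ℓ η y‖) * ∫ y, |η y|,
    mul_nonneg (integral_nonneg fun _ => norm_nonneg _) (integral_nonneg fun _ => abs_nonneg _),
    fun w hw x a N ha ha1 hN => ?_⟩
  have hc := (contDiff_smear_kernel (hη 0) hs ha hw).continuous
  refine (norm_iteratedFDeriv_smear_le (hη ℓ) hs ha hc (N := (∫ y, |η y|) * N)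
    fun z hz => ?_).trans (le_of_eq (by ring))
  refine norm_smear_le (g := w) (hη 0).continuous hs ha.le fun y hy => hN y ?_
  rw [mem_closedBall] at *
  linarith [dist_triangle y z x]

theorem norm_iteratedFDeriv_smear2_sub_le {η : Euc n → ℝ}
    (hη : ∀ N : ℕ, ContDiff ℝ N η) (hs : ∀ y, 1 ≤ ‖y‖ → η y = 0)
    (m ℓ : ℕ) : ∃ K : ℝ, 0 ≤ K ∧
    ∀ w : Euc n → ℝ, Continuous w → ∀ (x : Euc n) (M : ℝ), IsMV m η w x M → ∀ a : ℝ, 0 < a →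
      a ≤ 1 → ‖iteratedFDeriv ℝ ℓ (fun z => smear2 η a w z - smear2 η (a / 2) w z) x‖ ≤
        K * (a⁻¹ ^ ℓ * a ^ (2 * m) * M) := by
  set I := ∫ y, ‖iteratedFDeriv ℝ ℓ η y‖ with hI
  have hI0 : 0 ≤ I := integral_nonneg fun _ => norm_nonneg _
  refine ⟨(1 + 2 ^ ℓ) * (I * 2), by positivity, fun w hw x M hM a ha ha1 => ?_⟩
  have ha2 : 0 < a / 2 := by positivity
  have hc : ∀ {b : ℝ}, 0 < b → ∀ {w : Euc n → ℝ}, Continuous w → Continuous (smear η b w) :=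
    fun hb _ hw => (contDiff_smear_kernel (hη 0) hs hb hw).continuous
  set g : Euc n → ℝ := fun z => smear η a w z - smear η (a / 2) w z with hg
  have hgc : Continuous g := (hc ha hw).sub (hc ha2 hw)
  have hM0 : 0 ≤ M := by
    have := (abs_nonneg _).trans (hM x (mem_closedBall_self zero_le_one) 1 one_pos le_rfl)
    simpa using this
  have hgN : ∀ z ∈ closedBall x a, |g z| ≤ 2 * (a ^ (2 * m) * M) := by
    intro z hz
    have hz1 : z ∈ closedBall x 1 := closedBall_subset_closedBall ha1 hz
    have h1 := hM z hz1 a ha ha1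
    have h2 := hM z hz1 (a / 2) ha2 (by linarith)
    have h3 : (a / 2) ^ (2 * m) * M ≤ a ^ (2 * m) * M := by
      gcongr
      linarith
    simp only [hg]
    rw [abs_le] at *
    constructor <;> linarith [h1.1, h1.2, h2.1, h2.2]
  have heq : (fun z => smear2 η a w z - smear2 η (a / 2) w z) =
      smear η a g + smear η (a / 2) g := by
    funext z
    have hkc := (hη 0).continuous
    simp only [smear2, Pi.add_apply, hg]
    rw [smear_sub hkc hs _ (hc ha hw) (hc ha2 hw), smear_sub hkc hs _ (hc ha hw) (hc ha2 hw),
      smear_comm hkc hs hkc hs a (a / 2) hw]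
    ring
  rw [heq, iteratedFDeriv_add_apply (contDiff_smear_kernel (hη ℓ) hs ha hgc).contDiffAt
    (contDiff_smear_kernel (hη ℓ) hs ha2 hgc).contDiffAt]
  refine (norm_add_le _ _).trans ?_
  have h1 := norm_iteratedFDeriv_smear_le (hη ℓ) hs ha hgc hgN
  have h2 := norm_iteratedFDeriv_smear_le (hη ℓ) hs ha2 hgc (x := x) fun z hz =>
    hgN z (closedBall_subset_closedBall (by linarith) hz)
  rw [← hI] at h1 h2
  have h3 : (a / 2)⁻¹ = 2 * a⁻¹ := by
    field_simp
  rw [h3, mul_pow] at h2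
  refine (add_le_add h1 h2).trans (le_of_eq (by ring))

theorem norm_iteratedFDeriv_smear2_sub_le' {η : Euc n → ℝ}
    (hη : ∀ N : ℕ, ContDiff ℝ N η) (hs : ∀ y, 1 ≤ ‖y‖ → η y = 0)
    (m : ℕ) {ℓ : ℕ} (hℓ : ℓ + 1 ≤ 2 * m) :
    ∃ K : ℝ, 0 ≤ K ∧
    ∀ w : Euc n → ℝ, Continuous w → ∀ (x : Euc n) (M : ℝ), IsMV m η w x M → ∀ a : ℝ, 0 < a →
      a ≤ 1 → ‖iteratedFDeriv ℝ ℓ (smear2 η a w) x - iteratedFDeriv ℝ ℓ (smear2 η (a / 2) w) x‖ ≤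
        K * (a * M) := by
  obtain ⟨K, hK, h⟩ := norm_iteratedFDeriv_smear2_sub_le hη hs m ℓ
  refine ⟨K, hK, fun w hw x M hM a ha ha1 => ?_⟩
  have hM0 : 0 ≤ M := by
    have := (abs_nonneg _).trans (hM x (mem_closedBall_self zero_le_one) 1 one_pos le_rfl)
    simpa using this
  have h1 := h w hw x M hM a ha ha1
  have h2 : iteratedFDeriv ℝ ℓ (fun z => smear2 η a w z - smear2 η (a / 2) w z) x =
      iteratedFDeriv ℝ ℓ (smear2 η a w) x - iteratedFDeriv ℝ ℓ (smear2 η (a / 2) w) x :=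
    iteratedFDeriv_sub_apply (contDiff_smear2 hη hs ha hw ℓ).contDiffAt
      (contDiff_smear2 hη hs (by positivity) hw ℓ).contDiffAt
  rw [h2] at h1
  refine h1.trans ?_
  have h3 : a⁻¹ ^ ℓ * a ^ (2 * m) ≤ a := by
    obtain ⟨d, hd⟩ := Nat.exists_eq_add_of_le hℓ
    rw [hd, add_assoc, pow_add, inv_pow, inv_mul_cancel_left₀ (by positivity), pow_add, pow_one]
    exact mul_le_of_le_one_right ha.le (pow_le_one₀ ha.le ha1)
  gcongr

theorem tendsto_smear2 {η : Euc n → ℝ}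
    (hη : ∀ N : ℕ, ContDiff ℝ N η) (hs : ∀ y, 1 ≤ ‖y‖ → η y = 0)
    {m : ℕ} (hm : 0 < m) {w : Euc n → ℝ} (hw : Continuous w) {x : Euc n} {M : ℝ}
    (hM : IsMV m η w x M) {ε : ℝ} (hε : 0 < ε) (hε1 : ε ≤ 1) :
    Tendsto (fun j : ℕ => smear2 η (ε / 2 ^ j) w x) atTop (𝓝 (w x)) := by
  set I := ∫ y, |η y| with hI
  have hI0 : 0 ≤ I := integral_nonneg fun _ => abs_nonneg _
  have hM0 : 0 ≤ M := by
    have := (abs_nonneg _).trans (hM x (mem_closedBall_self zero_le_one) 1 one_pos le_rfl)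
    simpa using this
  have hb : ∀ b : ℝ, 0 < b → b ≤ 1 → |smear2 η b w x - w x| ≤ (1 + I) * M * b := by
    intro b hb hb1
    have hc : Continuous (smear η b w) := (contDiff_smear_kernel (hη 0) hs hb hw).continuous
    have h1 := hM x (mem_closedBall_self zero_le_one) b hb hb1
    have h2 : |smear η b (fun z => w z - smear η b w z) x| ≤ I * (b ^ (2 * m) * M) :=
      norm_smear_le (g := fun z => w z - smear η b w z) (hη 0).continuous hs hb.le fun z hz =>
        hM z (closedBall_subset_closedBall hb1 hz) b hb hb1
    rw [smear_sub (hη 0).continuous hs b hw hc] at h2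
    have h3 : b ^ (2 * m) ≤ b := pow_le_of_le_one hb.le hb1 (by omega)
    have h4 : b ^ (2 * m) * M ≤ b * M := by gcongr
    have h5 : I * (b ^ (2 * m) * M) ≤ I * (b * M) := by gcongr
    simp only [smear2]
    rw [abs_le] at *
    constructor <;> linarith [h1.1, h1.2, h2.1, h2.2]
  rw [tendsto_iff_dist_tendsto_zero]
  have h0 : Tendsto (fun j : ℕ => (1 + I) * M * (ε / 2 ^ j)) atTop (𝓝 ((1 + I) * M * 0)) :=
    (tendsto_const_nhds.div_atTop
      (tendsto_pow_atTop_atTop_of_one_lt one_lt_two)).const_mul _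
  rw [mul_zero] at h0
  refine squeeze_zero (fun _ => dist_nonneg) (fun j => ?_) h0
  have h1 : (1 : ℝ) ≤ 2 ^ j := one_le_pow₀ one_le_two
  exact hb _ (by positivity) ((div_le_self hε.le h1).trans hε1)

/-- Regularity from the approximate mean value property. -/
theorem contDiff_of_isMV {η : Euc n → ℝ}
    (hη : ∀ N : ℕ, ContDiff ℝ N η) (hs : ∀ y, 1 ≤ ‖y‖ → η y = 0)
    {m : ℕ} (hm : 0 < m) {w : Euc n → ℝ} (hw : Continuous w)
    (hMV : ∀ R : ℝ, ∃ M, ∀ x ∈ closedBall (0 : Euc n) R, IsMV m η w x M) :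
    ContDiff ℝ (2 * m - 1 : ℕ) w ∧ ∀ ε : ℝ, 0 < ε → ε ≤ 1 → ∀ i ≤ 2 * m - 1, ∀ x,
      Tendsto (fun j : ℕ => iteratedFDeriv ℝ i (smear2 η (ε / 2 ^ j) w) x) atTop
        (𝓝 (iteratedFDeriv ℝ i w x)) := by
  have key : ∀ ε : ℝ, 0 < ε → ε ≤ 1 → ContDiff ℝ (2 * m - 1 : ℕ) w ∧ ∀ i ≤ 2 * m - 1, ∀ x,
      Tendsto (fun j : ℕ => iteratedFDeriv ℝ i (smear2 η (ε / 2 ^ j) w) x) atTop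
        (𝓝 (iteratedFDeriv ℝ i w x)) := by
    intro ε hε hε1
    refine contDiff_of_geometric (2 * m - 1)
      (fun j => contDiff_smear2 hη hs (by positivity) hw _) (fun i hi R => ?_) fun x => ?_
    · obtain ⟨M, hM⟩ := hMV R
      obtain ⟨K, hK, h⟩ := norm_iteratedFDeriv_smear2_sub_le' hη hs m (ℓ := i) (by omega)
      refine ⟨K * (ε * M), fun x hx j => ?_⟩
      have h1 : (1 : ℝ) ≤ 2 ^ j := one_le_pow₀ one_le_two
      have := h w hw x M (hM x hx) (ε / 2 ^ j) (by positivity) ((div_le_self hε.le h1).trans hε1)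
      rw [div_div, ← pow_succ] at this
      refine this.trans (le_of_eq ?_)
      rw [one_div, inv_pow]
      ring
    · obtain ⟨M, hM⟩ := hMV ‖x‖
      exact tendsto_smear2 hη hs hm hw (hM x (by simp)) hε hε1
  exact ⟨(key 1 one_pos le_rfl).1, fun ε hε hε1 => (key ε hε hε1).2⟩

theorem norm_iteratedFDeriv_le_of_isMV {η : Euc n → ℝ}
    (hη : ∀ N : ℕ, ContDiff ℝ N η) (hs : ∀ y, 1 ≤ ‖y‖ → η y = 0)
    {m : ℕ} (hm : 0 < m) {i : ℕ} (hi : i ≤ 2 * m - 1) :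
    ∃ K : ℝ, 0 ≤ K ∧ ∀ w : Euc n → ℝ, Continuous w →
      (∀ R : ℝ, ∃ M, ∀ x ∈ closedBall (0 : Euc n) R, IsMV m η w x M) →
      ∀ (x : Euc n) (N M ε : ℝ), 0 < ε → ε ≤ 1 → IsMV m η w x M →
        (∀ z ∈ closedBall x 2, |w z| ≤ N) →
        ‖iteratedFDeriv ℝ i w x‖ ≤ K * (ε⁻¹ ^ i * N + ε * M) := by
  obtain ⟨K, hK, h⟩ := norm_iteratedFDeriv_smear2_sub_le' hη hs m (ℓ := i) (by omega)
  obtain ⟨K', hK', h'⟩ := norm_iteratedFDeriv_smear2_le hη hs i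
  refine ⟨2 * K + K', by positivity, fun w hw hMV x N M ε hε hε1 hM hN => ?_⟩
  have hM0 : 0 ≤ M := by
    have := (abs_nonneg _).trans (hM x (mem_closedBall_self zero_le_one) 1 one_pos le_rfl)
    simpa using this
  have hN0 : 0 ≤ N := (abs_nonneg _).trans (hN x (mem_closedBall_self zero_le_two))
  have ht := (contDiff_of_isMV hη hs hm hw hMV).2 ε hε hε1 i hi x
  have h1 := dist_le_of_le_geometric_two_of_tendsto₀ (C := 2 * (K * (ε * M))) (fun j => ?_) ht
  · rw [dist_eq_norm, pow_zero, div_one] at h1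
    have h2 := h' w hw x ε N hε hε1 hN
    have h3 := norm_sub_norm_le (iteratedFDeriv ℝ i w x) (iteratedFDeriv ℝ i (smear2 η ε w) x)
    rw [norm_sub_rev] at h3
    have h4 : 0 ≤ K * (ε⁻¹ ^ i * N) := by positivity
    have h5 : 0 ≤ K' * (ε * M) := by positivity
    nlinarith
  · have h1 : (1 : ℝ) ≤ 2 ^ j := one_le_pow₀ one_le_two
    have := h w hw x M hM (ε / 2 ^ j) (by positivity) ((div_le_self hε.le h1).trans hε1)
    rw [div_div, ← pow_succ] at this
    rw [dist_eq_norm]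
    refine this.trans (le_of_eq ?_)
    ring

theorem holder_le_of_isMV {η : Euc n → ℝ}
    (hη : ∀ N : ℕ, ContDiff ℝ N η) (hs : ∀ y, 1 ≤ ‖y‖ → η y = 0)
    {m : ℕ} (hm : 0 < m) {α : ℝ} (hα0 : 0 ≤ α) (hα : α < 1) :
    ∃ K : ℝ, 0 ≤ K ∧ ∀ w : Euc n → ℝ, Continuous w →
      (∀ R : ℝ, ∃ M, ∀ x ∈ closedBall (0 : Euc n) R, IsMV m η w x M) →
      ∀ (x y : Euc n) (N M ε : ℝ), 0 < ε → ε ≤ 1 → dist x y ≤ 1 →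
        (∀ z ∈ closedBall x 1, IsMV m η w z M) → (∀ z ∈ closedBall x 3, |w z| ≤ N) →
        ‖iteratedFDeriv ℝ (2 * m - 1) w x - iteratedFDeriv ℝ (2 * m - 1) w y‖ ≤
          K * (ε⁻¹ ^ (2 * m) * N + ε ^ (1 - α) * M) * dist x y ^ α := by
  obtain ⟨K₁, hK₁, h₁⟩ := norm_iteratedFDeriv_smear2_sub_le' hη hs m (ℓ := 2 * m - 1) (by omega)
  obtain ⟨K₂, hK₂, h₂⟩ := norm_iteratedFDeriv_smear2_sub_le hη hs m (2 * m - 1 + 1)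
  obtain ⟨K₃, hK₃, h₃⟩ := norm_iteratedFDeriv_smear2_le hη hs (2 * m - 1 + 1)
  have hmm : 2 * m - 1 + 1 = 2 * m := by omega
  set r : ℝ := (1 / 2) ^ (1 - α) with hr
  have hr0 : 0 < r := by positivity
  have hr1 : r < 1 := Real.rpow_lt_one (by norm_num) (by norm_num) (by linarith)
  refine ⟨(2 * K₁ + K₂) / (1 - r) + K₃, by
    have : 0 < 1 - r := by linarith
    positivity, fun w hw hMV x y N M ε hε hε1 hxy hM hN => ?_⟩
  have hx1 : x ∈ closedBall x (1 : ℝ) := mem_closedBall_self zero_le_one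
  have hy1 : y ∈ closedBall x (1 : ℝ) := by rwa [mem_closedBall, dist_comm]
  have hM0 : 0 ≤ M := by
    have := (abs_nonneg _).trans (hM x hx1 x hx1 1 one_pos le_rfl)
    simpa using this
  have hN0 : 0 ≤ N := (abs_nonneg _).trans (hN x (mem_closedBall_self (by norm_num)))
  set d := dist x y with hd
  have hd0 : 0 ≤ d := dist_nonneg
  have hmv : ∀ (f : Euc n → ℝ) (B : ℝ), ContDiff ℝ (2 * m : ℕ) f →
      (∀ z ∈ closedBall x 1, ‖iteratedFDeriv ℝ (2 * m - 1 + 1) f z‖ ≤ B) →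
      ‖iteratedFDeriv ℝ (2 * m - 1) f x - iteratedFDeriv ℝ (2 * m - 1) f y‖ ≤ B * d := by
    intro f B hf hB
    rw [hd, dist_eq_norm]
    refine (convex_closedBall x 1).norm_image_sub_le_of_norm_fderiv_le (𝕜 := ℝ) (fun z _ => ?_)
      (fun z hz => ?_) hy1 hx1
    · refine (hf.differentiable_iteratedFDeriv ?_) z
      exact_mod_cast (by omega : 2 * m - 1 < 2 * m)
    · rw [norm_fderiv_iteratedFDeriv]
      exact hB z hz
  have hsm : ∀ j : ℕ, 0 < ε / 2 ^ j ∧ ε / 2 ^ j ≤ 1 := fun j =>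
    ⟨by positivity, (div_le_self hε.le (one_le_pow₀ one_le_two)).trans hε1⟩
  have hmin : ∀ a : ℝ, 0 < a → ∀ u : ℝ, u ≤ 2 * K₁ * M * a → u ≤ K₂ * M * d →
      u ≤ (2 * K₁ + K₂) * M * (a ^ (1 - α) * d ^ α) := by
    intro a ha u hu1 hu2
    rcases le_total a d with h | h
    · have h1 : a ≤ a ^ (1 - α) * d ^ α := by
        calc a = a ^ (1 - α) * a ^ α := by
              rw [← Real.rpow_add ha, sub_add_cancel, Real.rpow_one]
          _ ≤ _ := by gcongr
      have h2 : 2 * K₁ * M * a ≤ 2 * K₁ * M * (a ^ (1 - α) * d ^ α) := by gcongr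
      have h3 : 0 ≤ K₂ * M * (a ^ (1 - α) * d ^ α) := by positivity
      linarith
    · have h1 : d ≤ a ^ (1 - α) * d ^ α := by
        rcases hd0.eq_or_lt with h0 | h0
        · rw [← h0]
          positivity
        · calc d = d ^ (1 - α) * d ^ α := by
                rw [← Real.rpow_add h0, sub_add_cancel, Real.rpow_one]
            _ ≤ _ := by gcongr
      have h2 : K₂ * M * d ≤ K₂ * M * (a ^ (1 - α) * d ^ α) := by gcongr
      have h3 : 0 ≤ 2 * K₁ * M * (a ^ (1 - α) * d ^ α) := by positivity
      linarith
  have ht := ((contDiff_of_isMV hη hs hm hw hMV).2 ε hε hε1 _ le_rfl x).sub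
    ((contDiff_of_isMV hη hs hm hw hMV).2 ε hε hε1 _ le_rfl y)
  have h1 := dist_le_of_le_geometric_of_tendsto₀ r
    ((2 * K₁ + K₂) * M * (ε ^ (1 - α) * d ^ α)) hr1 (fun j => ?_) ht
  · rw [dist_eq_norm, pow_zero, div_one] at h1
    have h2 := hmv (smear2 η ε w) (K₃ * (ε⁻¹ ^ (2 * m) * N))
      (contDiff_smear2 hη hs hε hw _) (fun z hz => by
        have := h₃ w hw z ε N hε hε1 fun y hy => hN y (by
          rw [mem_closedBall] at *
          linarith [dist_triangle y z x])
        rwa [hmm] at this ⊢)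
    have hdα : d ≤ d ^ α := by
      rcases hd0.eq_or_lt with h0 | h0
      · rw [← h0]
        positivity
      · calc d = d ^ (1 : ℝ) := (Real.rpow_one d).symm
          _ ≤ d ^ α := Real.rpow_le_rpow_of_exponent_ge h0 hxy hα.le
    have h3 : K₃ * (ε⁻¹ ^ (2 * m) * N) * d ≤ K₃ * (ε⁻¹ ^ (2 * m) * N) * d ^ α := by gcongr
    have h4 := norm_le_norm_add_norm_sub
      (iteratedFDeriv ℝ (2 * m - 1) (smear2 η ε w) x -
        iteratedFDeriv ℝ (2 * m - 1) (smear2 η ε w) y)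
      (iteratedFDeriv ℝ (2 * m - 1) w x - iteratedFDeriv ℝ (2 * m - 1) w y)
    have h5 : 0 ≤ K₃ * (ε ^ (1 - α) * M) * d ^ α := by positivity
    have h6 : 0 ≤ (2 * K₁ + K₂) / (1 - r) * (ε⁻¹ ^ (2 * m) * N) * d ^ α := by
      have : 0 < 1 - r := by linarith
      positivity
    have h7 : (2 * K₁ + K₂) * M * (ε ^ (1 - α) * d ^ α) / (1 - r) =
      (2 * K₁ + K₂) / (1 - r) * (ε ^ (1 - α) * M) * d ^ α := by ring
    rw [h7] at h1
    have h8 : ((2 * K₁ + K₂) / (1 - r) + K₃) * (ε⁻¹ ^ (2 * m) * N + ε ^ (1 - α) * M) * d ^ α =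
        (2 * K₁ + K₂) / (1 - r) * (ε ^ (1 - α) * M) * d ^ α + K₃ * (ε⁻¹ ^ (2 * m) * N) * d ^ α +
        K₃ * (ε ^ (1 - α) * M) * d ^ α + (2 * K₁ + K₂) / (1 - r) * (ε⁻¹ ^ (2 * m) * N) * d ^ α := by
      ring
    rw [h8]
    linarith
  · obtain ⟨hj0, hj1⟩ := hsm j
    set a := ε / 2 ^ j with ha
    have haj : ε / 2 ^ (j + 1) = a / 2 := by
      rw [ha, pow_succ, div_div]
    have hapow : a ^ (1 - α) = ε ^ (1 - α) * r ^ j := by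
      rw [ha, div_eq_mul_inv, Real.mul_rpow hε.le (by positivity), hr, ← inv_pow, ← one_div,
        ← Real.rpow_natCast, ← Real.rpow_natCast, ← Real.rpow_mul (by norm_num),
        ← Real.rpow_mul (by norm_num), mul_comm (j : ℝ)]
    rw [haj, dist_eq_norm]
    refine (hmin a hj0 _ ?_ ?_).trans (le_of_eq (by rw [hapow]; ring))
    · have hx := h₁ w hw x M (hM x hx1) a hj0 hj1
      have hy := h₁ w hw y M (hM y hy1) a hj0 hj1
      rw [sub_sub_sub_comm]
      refine (norm_sub_le _ _).trans ?_
      linarith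
    · have hc1 := contDiff_smear2 hη hs hj0 hw
      have hc2 := contDiff_smear2 hη hs (half_pos hj0) hw
      have := hmv (fun z => smear2 η a w z - smear2 η (a / 2) w z) (K₂ * M)
        ((hc1 _).sub (hc2 _)) (fun z hz => by
          have := h₂ w hw z M (hM z hz) a hj0 hj1
          rwa [hmm, inv_pow, inv_mul_cancel₀ (by positivity), one_mul, ← hmm] at this)
      have hsub : ∀ z, iteratedFDeriv ℝ (2 * m - 1)
          (fun z => smear2 η a w z - smear2 η (a / 2) w z) z =
          iteratedFDeriv ℝ (2 * m - 1) (smear2 η a w) z -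
            iteratedFDeriv ℝ (2 * m - 1) (smear2 η (a / 2) w) z := fun z =>
        iteratedFDeriv_sub_apply (hc1 _).contDiffAt (hc2 _).contDiffAt
      rw [hsub, hsub, sub_sub_sub_comm] at this
      exact this

end MeanValueEstimates

section Compactness

variable {n : ℕ}

/-- A sequential form of the Arzelà–Ascoli theorem. -/
theorem exists_subseq_tendstoLocallyUniformly {v : ℕ → Euc n → ℝ} (hv : ∀ k, Continuous (v k))
    (hB : ∀ x, ∃ B, ∀ k, |v k x| ≤ B)
    (hE : ∀ x, ∀ ε : ℝ, 0 < ε → ∃ δ : ℝ, 0 < δ ∧ ∀ k, ∀ y ∈ ball x δ, dist (v k x) (v k y) ≤ ε) :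
    ∃ (φ : ℕ → ℕ) (g : Euc n → ℝ), StrictMono φ ∧ Continuous g ∧
      TendstoLocallyUniformly (fun k => v (φ k)) g atTop := by
  choose B hB using hB
  choose! δ hδ hE using hE
  have hcont : ∀ f : Euc n → ℝ, (∀ x, ∀ ε : ℝ, 0 < ε → ∀ y ∈ ball x (δ x ε),
      dist (f x) (f y) ≤ ε) → Continuous f := by
    intro f hf
    rw [Metric.continuous_iff']
    intro x ε hε
    filter_upwards [ball_mem_nhds x (hδ x (ε / 2) (half_pos hε))] with y hy
    rw [dist_comm]
    exact (hf x (ε / 2) (half_pos hε) y hy).trans_lt (half_lt_self hε)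
  set S : Set C(Euc n, ℝ) := {f | (∀ x, f x ∈ Icc (-B x) (B x)) ∧
    ∀ x, ∀ ε : ℝ, 0 < ε → ∀ y ∈ ball x (δ x ε), dist (f x) (f y) ≤ ε} with hS
  have himg : ContinuousMap.toFun '' S = {f : Euc n → ℝ | ∀ x, f x ∈ Icc (-B x) (B x)} ∩
      {f | ∀ x, ∀ ε : ℝ, 0 < ε → ∀ y ∈ ball x (δ x ε), dist (f x) (f y) ≤ ε} := by
    ext f
    constructor
    · rintro ⟨f, hf, rfl⟩
      exact hf
    · rintro ⟨h1, h2⟩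
      exact ⟨⟨f, hcont f h2⟩, ⟨h1, h2⟩, rfl⟩
  have hcpt : IsCompact S := by
    refine ArzelaAscoli.isCompact_of_equicontinuous S ?_ ?_
    · rw [himg]
      refine IsCompact.inter_right ?_ ?_
      · have : {f : Euc n → ℝ | ∀ x, f x ∈ Icc (-B x) (B x)} =
            Set.pi univ fun x => Icc (-B x) (B x) := by
          ext f
          exact ⟨fun h x _ => h x, fun h x => h x (mem_univ x)⟩
        rw [this]
        exact isCompact_univ_pi fun x => isCompact_Icc
      · simp only [Set.ofPred_forall]
        refine isClosed_iInter fun x => isClosed_iInter fun ε => isClosed_iInter fun _ =>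
          isClosed_iInter fun y => isClosed_iInter fun _ => ?_
        exact isClosed_le ((continuous_apply x).dist (continuous_apply y)) continuous_const
    · intro x
      rw [Metric.equicontinuousAt_iff_right]
      intro ε hε
      filter_upwards [ball_mem_nhds x (hδ x (ε / 2) (half_pos hε))] with y hy f
      exact (f.2.2 x (ε / 2) (half_pos hε) y hy).trans_lt (half_lt_self hε)
  obtain ⟨g, -, φ, hφ, hg⟩ := hcpt.tendsto_subseq (x := fun k => ⟨v k, hv k⟩)
    fun k => ⟨fun x => abs_le.1 (hB x k), fun x ε hε y hy => hE x ε hε k y hy⟩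
  exact ⟨φ, g, hφ, g.continuous, ContinuousMap.tendsto_iff_tendstoLocallyUniformly.1 hg⟩

theorem tendsto_smear {k : Euc n → ℝ} (hk : Continuous k) (hs : ∀ y, 1 ≤ ‖y‖ → k y = 0)
    {v : ℕ → Euc n → ℝ} {g : Euc n → ℝ} (hv : ∀ k, Continuous (v k)) (hg : Continuous g)
    (h : TendstoLocallyUniformly v g atTop) {a : ℝ} (ha : 0 ≤ a) (x : Euc n) :
    Tendsto (fun j => smear k a (v j) x) atTop (𝓝 (smear k a g x)) := by
  rw [tendstoLocallyUniformly_iff_forall_isCompact] at h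
  have h1 := h (closedBall x a) (isCompact_closedBall x a)
  rw [Metric.tendstoUniformlyOn_iff] at h1
  rw [Metric.tendsto_nhds]
  intro ε hε
  set I := ∫ y, |k y| with hI
  have hI0 : 0 ≤ I := integral_nonneg fun _ => abs_nonneg _
  filter_upwards [h1 (ε / (I + 1)) (by positivity)] with j hj
  rw [Real.dist_eq, ← smear_sub hk hs a (hv j) hg]
  refine (norm_smear_le (g := fun z => v j z - g z) hk hs ha (N := ε / (I + 1))
    fun z hz => ?_).trans_lt ?_
  · rw [← dist_eq_norm, dist_comm]
    exact (hj z hz).le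
  · rw [← hI, mul_div_assoc', div_lt_iff₀ (by positivity)]
    nlinarith

/-- Uniform approximation on closed balls. -/
theorem TendstoLocallyUniformly.eventually_abs_sub_le {v : ℕ → Euc n → ℝ} {g : Euc n → ℝ}
    (h : TendstoLocallyUniformly v g atTop) {ε : ℝ} (hε : 0 < ε) (R : ℝ) :
    ∀ᶠ k in atTop, ∀ x ∈ closedBall (0 : Euc n) R, |v k x - g x| ≤ ε := by
  rw [tendstoLocallyUniformly_iff_forall_isCompact] at h
  filter_upwards [Metric.tendstoUniformlyOn_iff.1
    (h (closedBall 0 R) (isCompact_closedBall 0 R)) ε hε] with k hk x hx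
  rw [← Real.dist_eq, dist_comm]
  exact (hk x hx).le

theorem tendstoLocallyUniformly_of_eventually {v : ℕ → Euc n → ℝ} {g : Euc n → ℝ}
    (h : ∀ ε : ℝ, 0 < ε → ∀ R : ℝ,
      ∀ᶠ k in atTop, ∀ x ∈ closedBall (0 : Euc n) R, |v k x - g x| ≤ ε) :
    TendstoLocallyUniformly v g atTop := by
  rw [tendstoLocallyUniformly_iff_forall_isCompact]
  intro K hK
  obtain ⟨R, hR⟩ := hK.isBounded.subset_closedBall (0 : Euc n)
  rw [Metric.tendstoUniformlyOn_iff]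
  intro ε hε
  filter_upwards [h (ε / 2) (half_pos hε) R] with k hk x hx
  rw [dist_comm, Real.dist_eq]
  exact (hk x (hR hx)).trans_lt (half_lt_self hε)

theorem exists_abs_le_closedBall {g : Euc n → ℝ} (hg : Continuous g) (R : ℝ) :
    ∃ N : ℝ, 0 ≤ N ∧ ∀ x ∈ closedBall (0 : Euc n) R, |g x| ≤ N := by
  obtain ⟨N, hN⟩ := (isCompact_closedBall (0 : Euc n) R).exists_bound_of_continuousOn hg.continuousOn
  exact ⟨max N 0, le_max_right _ _, fun x hx => (hN x hx).trans (le_max_left _ _)⟩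

/-- Abbreviation for the properties of a kernel reproducing polyharmonic functions. -/
structure IsKernel (m : ℕ) (η : Euc n → ℝ) (C : ℝ) : Prop where
  smooth : ∀ N : ℕ, ContDiff ℝ N η
  supp : ∀ y, 1 ≤ ‖y‖ → η y = 0
  int : ∫ y, η y = 1
  nonneg : 0 ≤ C
  est : ∀ w : Euc n → ℝ, ContDiff ℝ (2 * m : ℕ) w → ∀ (x : Euc n) (a : ℝ), 0 ≤ a →
      ∀ M : ℝ, (∀ z ∈ closedBall x a, |lap^[m] w z| ≤ M) →
        |w x - smear η a w x| ≤ C * a ^ (2 * m) * M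

variable {m : ℕ} {η : Euc n → ℝ} {C : ℝ}

theorem IsKernel.isMV (hη : IsKernel m η C) {w : Euc n → ℝ} (hw : ContDiff ℝ (2 * m : ℕ) w)
    {x : Euc n} {M : ℝ} (hM : ∀ z ∈ closedBall x 2, |lap^[m] w z| ≤ M) :
    IsMV m η w x (C * M) := by
  intro z hz b hb hb1
  refine (hη.est w hw z b hb.le M fun y hy => hM y ?_).trans (le_of_eq (by ring))
  rw [mem_closedBall] at *
  linarith [dist_triangle y z x]

theorem IsKernel.isMV_closedBall (hη : IsKernel m η C) {w : Euc n → ℝ}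
    (hw : ContDiff ℝ (2 * m : ℕ) w) (R : ℝ) :
    ∃ M, ∀ x ∈ closedBall (0 : Euc n) R, IsMV m η w x M := by
  obtain ⟨M, -, hM⟩ := exists_abs_le_closedBall hw.continuous_lap_iterate (R + 2)
  refine ⟨C * M, fun x hx => hη.isMV hw fun z hz => hM z ?_⟩
  rw [mem_closedBall] at *
  linarith [dist_triangle z x 0]

theorem IsMV.sub (hη : Continuous η) (hs : ∀ y, 1 ≤ ‖y‖ → η y = 0) {f g : Euc n → ℝ}
    (hf : Continuous f) (hg : Continuous g) {x : Euc n} {M N : ℝ} (hM : IsMV m η f x M)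
    (hN : IsMV m η g x N) : IsMV m η (fun z => f z - g z) x (M + N) := by
  intro z hz b hb hb1
  have h1 := hM z hz b hb hb1
  have h2 := hN z hz b hb hb1
  rw [smear_sub hη hs b hf hg, mul_add]
  rw [abs_le] at *
  constructor <;> linarith [h1.1, h1.2, h2.1, h2.2]

theorem isMV_of_tendsto (hη : Continuous η) (hs : ∀ y, 1 ≤ ‖y‖ → η y = 0) {v : ℕ → Euc n → ℝ}
    {g : Euc n → ℝ} (hv : ∀ k, Continuous (v k)) (hg : Continuous g)
    (h : TendstoLocallyUniformly v g atTop) {x : Euc n} {M : ℝ}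
    (hM : ∀ᶠ k in atTop, IsMV m η (v k) x M) : IsMV m η g x M := by
  intro z hz b hb hb1
  have h1 : Tendsto (fun k => |v k z - smear η b (v k) z|) atTop (𝓝 |g z - smear η b g z|) :=
    ((h.tendstoLocallyUniformlyOn.tendsto_at (mem_univ z)).sub
      (tendsto_smear hη hs hv hg h hb.le z)).abs
  exact le_of_tendsto h1 (hM.mono fun k hk => hk z hz b hb hb1)

/-- Locally bounded sequences with locally bounded `Δ ^ m` are precompact. -/
theorem IsKernel.exists_subseq (hη : IsKernel m η C) (hm : 0 < m) {v : ℕ → Euc n → ℝ}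
    (hv : ∀ k, ContDiff ℝ (2 * m : ℕ) (v k))
    (hM : ∀ R : ℝ, ∃ M : ℝ, ∀ᶠ k in atTop, ∀ x ∈ closedBall (0 : Euc n) R, |lap^[m] (v k) x| ≤ M)
    (hN : ∀ R : ℝ, ∃ N : ℝ, ∀ᶠ k in atTop, ∀ x ∈ closedBall (0 : Euc n) R, |v k x| ≤ N) :
    ∃ (φ : ℕ → ℕ) (g : Euc n → ℝ), StrictMono φ ∧ Continuous g ∧
      TendstoLocallyUniformly (fun k => v (φ k)) g atTop := by
  have hsub : ∀ {x z : Euc n} {r s : ℝ}, x ∈ closedBall (0 : Euc n) s → z ∈ closedBall x r →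
      z ∈ closedBall (0 : Euc n) (s + r) := by
    intro x z r s hx hz
    rw [mem_closedBall] at *
    linarith [dist_triangle z x 0]
  obtain ⟨K, hK, hest⟩ := norm_iteratedFDeriv_le_of_isMV hη.smooth hη.supp hm (i := 1) (by omega)
  have hgrad : ∀ R : ℝ, ∃ L : ℝ, 0 ≤ L ∧ ∀ᶠ k in atTop, ∀ x ∈ closedBall (0 : Euc n) R,
      ‖fderiv ℝ (v k) x‖ ≤ L := by
    intro R
    obtain ⟨M, hM⟩ := hM (R + 2)
    obtain ⟨N, hN⟩ := hN (R + 2)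
    refine ⟨|K * (N + C * M)|, abs_nonneg _, ?_⟩
    filter_upwards [hM, hN] with k hMk hNk x hx
    have := hest (v k) (hv k).continuous (hη.isMV_closedBall (hv k)) x N (C * M) 1 one_pos le_rfl
      (hη.isMV (hv k) fun z hz => hMk z (hsub hx hz)) fun z hz => hNk z (hsub hx hz)
    rw [norm_iteratedFDeriv_one, inv_one, one_pow, one_mul, one_mul] at this
    exact this.trans (le_abs_self _)
  refine exists_subseq_tendstoLocallyUniformly (fun k => (hv k).continuous) (fun x => ?_)
    fun x ε hε => ?_
  · obtain ⟨N, hN⟩ := hN ‖x‖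
    obtain ⟨k₀, hk₀⟩ := eventually_atTop.1 hN
    refine ⟨N ⊔ ∑ k ∈ Finset.range k₀, |v k x|, fun k => ?_⟩
    rcases le_or_gt k₀ k with hk | hk
    · exact (hk₀ k hk x (by simp)).trans le_sup_left
    · exact (Finset.single_le_sum (f := fun k => |v k x|) (fun _ _ => abs_nonneg _)
        (Finset.mem_range.2 hk)).trans le_sup_right
  · obtain ⟨L, hL, hLk⟩ := hgrad (‖x‖ + 1)
    have hev : ∀ᶠ k in atTop, ∀ y ∈ ball x (min 1 (ε / (L + 1))), dist (v k x) (v k y) ≤ ε := by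
      filter_upwards [hLk] with k hk y hy
      rw [mem_ball, lt_min_iff] at hy
      have h1 := (convex_closedBall x 1).norm_image_sub_le_of_norm_fderiv_le (𝕜 := ℝ)
        (f := v k) (C := L) (fun z _ => (hv k).differentiable (by simp; omega) z)
        (fun z hz => hk z (hsub (by simp) hz))
        (mem_closedBall.2 hy.1.le) (mem_closedBall_self zero_le_one)
      rw [← dist_eq_norm, ← dist_eq_norm, dist_comm x y] at h1
      refine h1.trans ((mul_le_mul_of_nonneg_left hy.2.le hL).trans ?_)
      rw [mul_div_assoc', div_le_iff₀ (by positivity)]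
      nlinarith
    obtain ⟨k₀, hk₀⟩ := eventually_atTop.1 hev
    have hfin : ∀ᶠ y in 𝓝 x, ∀ k ∈ Finset.range k₀, dist (v k x) (v k y) ≤ ε := by
      rw [Finset.eventually_all]
      intro k _
      filter_upwards [Metric.continuousAt_iff'.1 (hv k).continuous.continuousAt ε hε] with y hy
      rw [dist_comm]
      exact hy.le
    obtain ⟨δ, hδ, hδ'⟩ := Metric.eventually_nhds_iff_ball.1 hfin
    refine ⟨min δ (min 1 (ε / (L + 1))), by positivity, fun k y hy => ?_⟩
    rcases le_or_gt k₀ k with hk | hk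
    · exact hk₀ k hk y (ball_subset_ball (min_le_right _ _) hy)
    · exact hδ' y (ball_subset_ball (min_le_left _ _) hy) k (Finset.mem_range.2 hk)

end Compactness

section HolderConvergence

variable {n m : ℕ} {η : Euc n → ℝ} {C : ℝ}

theorem exists_rpow_mul_le {s : ℝ} (hs : 0 < s) (A : ℝ) {δ : ℝ} (hδ : 0 < δ) :
    ∃ ε : ℝ, 0 < ε ∧ ε ≤ 1 ∧ A * ε ^ s ≤ δ := by
  have h1 : Tendsto (fun ε : ℝ => A * ε ^ s) (𝓝 0) (𝓝 (A * 0 ^ s)) :=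
    (Real.continuousAt_rpow_const 0 s (Or.inr hs.le)).tendsto.const_mul A
  rw [Real.zero_rpow hs.ne', mul_zero] at h1
  have h2 : ∀ᶠ ε in 𝓝[>] (0 : ℝ), A * ε ^ s ≤ δ :=
    (h1.mono_left nhdsWithin_le_nhds).eventually_le_const hδ
  have h3 : ∀ᶠ ε in 𝓝[>] (0 : ℝ), ε ∈ Ioc (0 : ℝ) 1 := Ioc_mem_nhdsGT one_pos
  obtain ⟨ε, h4, h5⟩ := (h2.and h3).exists
  exact ⟨ε, h5.1, h5.2, h4⟩

theorem mem_closedBall_zero_add {x z : Euc n} {r s : ℝ} (hx : x ∈ closedBall (0 : Euc n) s)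
    (hz : z ∈ closedBall x r) : z ∈ closedBall (0 : Euc n) (s + r) := by
  rw [mem_closedBall] at *
  linarith [dist_triangle z x 0]

variable {w : ℕ → Euc n → ℝ}

theorem eventually_norm_iteratedFDeriv_le (hη : ∀ N : ℕ, ContDiff ℝ N η)
    (hs : ∀ y, 1 ≤ ‖y‖ → η y = 0) (hm : 0 < m) (hw : ∀ k, Continuous (w k))
    (hMV : ∀ k, ∀ R : ℝ, ∃ M, ∀ x ∈ closedBall (0 : Euc n) R, IsMV m η (w k) x M)
    (hM : ∀ R : ℝ, ∃ M, ∀ᶠ k in atTop, ∀ x ∈ closedBall (0 : Euc n) R, IsMV m η (w k) x M)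
    (h0 : ∀ ε : ℝ, 0 < ε → ∀ R : ℝ,
      ∀ᶠ k in atTop, ∀ x ∈ closedBall (0 : Euc n) R, |w k x| ≤ ε)
    {i : ℕ} (hi : i ≤ 2 * m - 1) {δ : ℝ} (hδ : 0 < δ) (R : ℝ) :
    ∀ᶠ k in atTop, ∀ x ∈ closedBall (0 : Euc n) R, ‖iteratedFDeriv ℝ i (w k) x‖ ≤ δ := by
  obtain ⟨K, hK, hest⟩ := norm_iteratedFDeriv_le_of_isMV hη hs hm hi
  obtain ⟨M, hM⟩ := hM R
  obtain ⟨ε, hε, hε1, hεδ⟩ := exists_rpow_mul_le one_pos (K * M) (half_pos hδ)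
  rw [Real.rpow_one] at hεδ
  have hA : 0 ≤ K * ε⁻¹ ^ i := by positivity
  have hN : 0 < δ / 2 / (K * ε⁻¹ ^ i + 1) := by positivity
  filter_upwards [hM, h0 _ hN (R + 2)] with k hMk hNk x hx
  refine (hest (w k) (hw k) (hMV k) x _ M ε hε hε1 (hMk x hx)
    fun z hz => hNk z (mem_closedBall_zero_add hx hz)).trans ?_
  have h1 : K * ε⁻¹ ^ i * (δ / 2 / (K * ε⁻¹ ^ i + 1)) ≤ δ / 2 := by
    rw [mul_div_assoc', div_le_iff₀ (by positivity)]
    nlinarith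
  nlinarith

theorem eventually_holder_le (hη : ∀ N : ℕ, ContDiff ℝ N η)
    (hs : ∀ y, 1 ≤ ‖y‖ → η y = 0) (hm : 0 < m) (hw : ∀ k, Continuous (w k))
    (hMV : ∀ k, ∀ R : ℝ, ∃ M, ∀ x ∈ closedBall (0 : Euc n) R, IsMV m η (w k) x M)
    (hM : ∀ R : ℝ, ∃ M, ∀ᶠ k in atTop, ∀ x ∈ closedBall (0 : Euc n) R, IsMV m η (w k) x M)
    (h0 : ∀ ε : ℝ, 0 < ε → ∀ R : ℝ,
      ∀ᶠ k in atTop, ∀ x ∈ closedBall (0 : Euc n) R, |w k x| ≤ ε)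
    {α : ℝ} (hα : α ∈ Ico (0 : ℝ) 1) {δ : ℝ} (hδ : 0 < δ) (R : ℝ) :
    ∀ᶠ k in atTop, ∀ x ∈ closedBall (0 : Euc n) R, ∀ y ∈ closedBall (0 : Euc n) R,
      ‖iteratedFDeriv ℝ (2 * m - 1) (w k) x - iteratedFDeriv ℝ (2 * m - 1) (w k) y‖ ≤
        δ * dist x y ^ α := by
  obtain ⟨K, hK, hest⟩ := holder_le_of_isMV hη hs hm hα.1 hα.2
  have hd := eventually_norm_iteratedFDeriv_le hη hs hm hw hMV hM h0 le_rfl (half_pos hδ) R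
  obtain ⟨M, hM⟩ := hM (R + 1)
  obtain ⟨ε, hε, hε1, hεδ⟩ := exists_rpow_mul_le (sub_pos.2 hα.2) (K * M) (half_pos hδ)
  have hA : 0 ≤ K * ε⁻¹ ^ (2 * m) := by positivity
  have hN : 0 < δ / 2 / (K * ε⁻¹ ^ (2 * m) + 1) := by positivity
  filter_upwards [hM, h0 _ hN (R + 3), hd] with k hMk hNk hdk x hx y hy
  rcases le_or_gt (dist x y) 1 with h1 | h1
  · refine (hest (w k) (hw k) (hMV k) x y _ M ε hε hε1 h1
      (fun z hz => hMk z (mem_closedBall_zero_add hx hz))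
      fun z hz => hNk z (mem_closedBall_zero_add hx hz)).trans ?_
    refine mul_le_mul_of_nonneg_right ?_ (by positivity)
    have h1 : K * ε⁻¹ ^ (2 * m) * (δ / 2 / (K * ε⁻¹ ^ (2 * m) + 1)) ≤ δ / 2 := by
      rw [mul_div_assoc', div_le_iff₀ (by positivity)]
      nlinarith
    nlinarith
  · refine (norm_sub_le _ _).trans ((add_le_add (hdk x hx) (hdk y hy)).trans ?_)
    nlinarith [Real.one_le_rpow h1.le hα.1]

theorem IsKernel.isMV_limit (hη : IsKernel m η C) {v : ℕ → Euc n → ℝ} {g : Euc n → ℝ}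
    (hv : ∀ k, ContDiff ℝ (2 * m : ℕ) (v k)) (hg : Continuous g)
    (h : TendstoLocallyUniformly v g atTop)
    (hM : ∀ R : ℝ, ∃ M : ℝ, ∀ᶠ k in atTop, ∀ x ∈ closedBall (0 : Euc n) R, |lap^[m] (v k) x| ≤ M)
    (R : ℝ) : ∃ M, (∀ x ∈ closedBall (0 : Euc n) R, IsMV m η g x M) ∧
      ∀ᶠ k in atTop, ∀ x ∈ closedBall (0 : Euc n) R, IsMV m η (v k) x M := by
  obtain ⟨M, hM⟩ := hM (R + 2)
  have h1 : ∀ᶠ k in atTop, ∀ x ∈ closedBall (0 : Euc n) R, IsMV m η (v k) x (C * M) := by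
    filter_upwards [hM] with k hk x hx
    exact hη.isMV (hv k) fun z hz => hk z (mem_closedBall_zero_add hx hz)
  exact ⟨C * M, fun x hx => isMV_of_tendsto (by simpa using hη.smooth 0) hη.supp
    (fun k => (hv k).continuous) hg h (h1.mono fun k hk => hk x hx), h1⟩

theorem IsKernel.contDiff_limit (hη : IsKernel m η C) (hm : 0 < m) {v : ℕ → Euc n → ℝ}
    {g : Euc n → ℝ} (hv : ∀ k, ContDiff ℝ (2 * m : ℕ) (v k)) (hg : Continuous g)
    (h : TendstoLocallyUniformly v g atTop)
    (hM : ∀ R : ℝ, ∃ M : ℝ, ∀ᶠ k in atTop,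
      ∀ x ∈ closedBall (0 : Euc n) R, |lap^[m] (v k) x| ≤ M) :
    ContDiff ℝ (2 * m - 1 : ℕ) g :=
  (contDiff_of_isMV hη.smooth hη.supp hm hg fun R =>
    (hη.isMV_limit hv hg h hM R).imp fun _ h => h.1).1

/-- Locally uniform convergence of functions with locally bounded `Δ ^ m` improves to
convergence in `C^{2 m - 1,α}`. -/
theorem IsKernel.tendstoCLocHolder (hη : IsKernel m η C) (hm : 0 < m) {v : ℕ → Euc n → ℝ}
    {g : Euc n → ℝ} (hv : ∀ k, ContDiff ℝ (2 * m : ℕ) (v k)) (hg : Continuous g)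
    (h : TendstoLocallyUniformly v g atTop)
    (hM : ∀ R : ℝ, ∃ M : ℝ, ∀ᶠ k in atTop, ∀ x ∈ closedBall (0 : Euc n) R, |lap^[m] (v k) x| ≤ M)
    {f : ℕ → Euc n → ℝ}
    (hf : ∀ R : ℝ, ∀ᶠ k in atTop, ∀ x ∈ ball (0 : Euc n) R, f k x = v k x)
    {α : ℝ} (hα : α ∈ Ico (0 : ℝ) 1) : TendstoCLocHolder (2 * m - 1) α univ f g := by
  have hηc : Continuous η := by simpa using hη.smooth 0
  have hgd := hη.contDiff_limit hm hv hg h hM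
  set w : ℕ → Euc n → ℝ := fun k x => v k x - g x with hwdef
  have hw : ∀ k, Continuous (w k) := fun k => (hv k).continuous.sub hg
  have hMV : ∀ k, ∀ R : ℝ, ∃ M, ∀ x ∈ closedBall (0 : Euc n) R, IsMV m η (w k) x M := by
    intro k R
    obtain ⟨M₁, h1⟩ := hη.isMV_closedBall (hv k) R
    obtain ⟨M₂, h2, -⟩ := hη.isMV_limit hv hg h hM R
    exact ⟨M₁ + M₂, fun x hx => (h1 x hx).sub hηc hη.supp (hv k).continuous hg (h2 x hx)⟩
  have hMw : ∀ R : ℝ, ∃ M, ∀ᶠ k in atTop,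
      ∀ x ∈ closedBall (0 : Euc n) R, IsMV m η (w k) x M := by
    intro R
    obtain ⟨M, h1, h2⟩ := hη.isMV_limit hv hg h hM R
    exact ⟨M + M, h2.mono fun k hk x hx =>
      (hk x hx).sub hηc hη.supp (hv k).continuous hg (h1 x hx)⟩
  have h0 : ∀ ε : ℝ, 0 < ε → ∀ R : ℝ,
      ∀ᶠ k in atTop, ∀ x ∈ closedBall (0 : Euc n) R, |w k x| ≤ ε :=
    fun ε hε R => h.eventually_abs_sub_le hε R
  intro K _ hK
  obtain ⟨R, hR⟩ := hK.isBounded.subset_closedBall (0 : Euc n)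
  have hgerm : ∀ᶠ k in atTop, ∀ x ∈ closedBall (0 : Euc n) R, f k =ᶠ[𝓝 x] v k := by
    filter_upwards [hf (R + 1)] with k hk x hx
    filter_upwards [isOpen_ball.mem_nhds (show x ∈ ball (0 : Euc n) (R + 1) from
      (mem_closedBall.1 hx).trans_lt (lt_add_one R))] with z hz
    exact hk z hz
  constructor
  · intro j hj
    rw [Metric.tendstoUniformlyOn_iff]
    intro ε hε
    filter_upwards [hgerm, eventually_norm_iteratedFDeriv_le hη.smooth hη.supp hm hw hMV hMw h0 hj
      (half_pos hε) R] with k hk hd x hx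
    rw [(hk x (hR hx)).iteratedFDeriv ℝ j |>.eq_of_nhds, dist_comm, dist_eq_norm]
    have hj' : (j : WithTop ℕ∞) ≤ (2 * m - 1 : ℕ) := by exact_mod_cast hj
    have hj'' : (j : WithTop ℕ∞) ≤ (2 * m : ℕ) := by exact_mod_cast (by omega : j ≤ 2 * m)
    have := hd x (hR hx)
    rw [show w k = v k - g from rfl,
      iteratedFDeriv_sub_apply ((hv k).of_le hj'').contDiffAt (hgd.of_le hj').contDiffAt] at this
    exact this.trans_lt (half_lt_self hε)
  · rw [Metric.tendsto_nhds]
    intro ε hε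
    filter_upwards [hgerm, eventually_holder_le hη.smooth hη.supp hm hw hMV hMw h0 hα
      (half_pos hε) R] with k hk hd
    have hnn : 0 ≤ holderSeminormOn (2 * m - 1) α K (fun x => f k x - g x) :=
      Real.iSup_nonneg fun p => by positivity
    rw [Real.dist_eq, sub_zero, abs_of_nonneg hnn]
    refine (Real.iSup_le (fun p => ?_) (half_pos hε).le).trans_lt (half_lt_self hε)
    obtain ⟨⟨x, y⟩, hx, hy, hxy⟩ := p
    have hxy' : 0 < dist x y := dist_pos.2 hxy
    have hgx : ∀ x ∈ K, iteratedFDeriv ℝ (2 * m - 1) (fun x => f k x - g x) x =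
        iteratedFDeriv ℝ (2 * m - 1) (w k) x := fun x hx =>
      (((hk x (hR hx)).sub (EventuallyEq.refl _ g)).iteratedFDeriv ℝ _).eq_of_nhds
    simp only
    rw [div_le_iff₀ (by positivity), hgx x hx, hgx y hy]
    exact hd x (hR hx) y (hR hy)

end HolderConvergence

section Regularity

variable {n m : ℕ} {η : Euc n → ℝ} {C : ℝ}

theorem IsKernel.continuous (hη : IsKernel m η C) : Continuous η := by simpa using hη.smooth 0

theorem lap_iterate_eq_zero_of_unitBall {k : Euc n → ℝ} {m : ℕ} (hk : ContDiff ℝ (2 * m : ℕ) k)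
    (hs : ∀ y, 1 ≤ ‖y‖ → k y = 0) : ∀ y, 1 ≤ ‖y‖ → lap^[m] k y = 0 := by
  induction m generalizing k with
  | zero => exact hs
  | succ m ih =>
    exact ih (ContDiff.lap (N := 2 * m) (by rwa [show 2 * m + 2 = 2 * (m + 1) by ring]))
      (lap_eq_zero_of_unitBall (hk.of_le (by norm_cast; omega)) hs)

theorem IsKernel.tendsto_smear_zero (hη : IsKernel m η C) {g : Euc n → ℝ} (hg : Continuous g)
    (x : Euc n) : Tendsto (fun a => smear η a g x) (𝓝[>] 0) (𝓝 (g x)) := by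
  have h1 : Continuous fun a : ℝ => smear η a g x :=
    (continuous_smear_uncurry hη.continuous hη.supp hg).comp (Continuous.prodMk_left x)
  have h2 := (h1.tendsto 0).mono_left (nhdsWithin_le_nhds (s := Ioi 0))
  rwa [smear_zero, hη.int, one_smul] at h2

theorem IsKernel.lap_iterate_smear_of_tendsto (hη : IsKernel m η C) {v : ℕ → Euc n → ℝ}
    {g f : Euc n → ℝ} (hv : ∀ k, ContDiff ℝ (2 * m : ℕ) (v k)) (hg : Continuous g)
    (hf : Continuous f) (h : TendstoLocallyUniformly v g atTop)
    (hl : TendstoLocallyUniformly (fun k => lap^[m] (v k)) f atTop) {a : ℝ} (ha : 0 < a) :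
    lap^[m] (smear η a g) = smear η a f := by
  have hsm := hη.smooth (2 * m)
  ext x
  rw [lap_iterate_smear_kernel hsm hη.supp ha hg]
  have h1 := (tendsto_smear hsm.continuous_lap_iterate
    (lap_iterate_eq_zero_of_unitBall hsm hη.supp) (fun k => (hv k).continuous) hg h ha.le
    x).const_mul (a⁻¹ ^ (2 * m))
  have h2 := tendsto_smear hη.continuous hη.supp (fun k => (hv k).continuous_lap_iterate) hf hl
    ha.le x
  refine tendsto_nhds_unique h1 (h2.congr fun k => ?_)
  rw [← lap_iterate_smear hη.continuous hη.supp a (hv k),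
    lap_iterate_smear_kernel hsm hη.supp ha (hv k).continuous]

theorem IsKernel.lap_iterate_smear_fderiv (hη : IsKernel m η C) {g f : Euc n → ℝ}
    (hg : ContDiff ℝ 1 g) (hf : ContDiff ℝ 1 f) {a : ℝ} (ha : 0 < a)
    (hl : lap^[m] (smear η a g) = smear η a f) (e : Euc n) :
    lap^[m] (smear η a fun z => fderiv ℝ g z e) = smear η a fun z => fderiv ℝ f z e := by
  have hsm := hη.smooth (2 * m)
  have hge : Continuous fun z => fderiv ℝ g z e :=
    (hg.continuous_fderiv one_ne_zero).clm_apply continuous_const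
  have hk := hsm.continuous_lap_iterate
  have hks := lap_iterate_eq_zero_of_unitBall hsm hη.supp
  rw [lap_iterate_smear_kernel hsm hη.supp ha hge]
  ext x
  rw [← fderiv_smear_apply hk hks a hg, ← fderiv_smear_apply hη.continuous hη.supp a hf, ← hl,
    lap_iterate_smear_kernel hsm hη.supp ha hg.continuous]
  have hd : DifferentiableAt ℝ (smear (lap^[m] η) a g) x :=
    (contDiff_smear hk hks a 1 hg).differentiable one_ne_zero x
  rw [fderiv_const_mul hd]
  rfl

/-- A distributional solution of `Δ ^ m g = f` with `f` of class `C¹` is a classical one. -/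
theorem IsKernel.contDiff_two_mul (hη : IsKernel m η C) (hm : 0 < m) {g f : Euc n → ℝ}
    (hg : ContDiff ℝ (2 * m - 1 : ℕ) g) (hf : ContDiff ℝ 1 f)
    (hl : ∀ a : ℝ, 0 < a → lap^[m] (smear η a g) = smear η a f) :
    ContDiff ℝ (2 * m : ℕ) g ∧ lap^[m] g = f := by
  have hη' := hη.continuous
  have hg1 : ContDiff ℝ 1 g := hg.of_le (by norm_cast; omega)
  have hge : ∀ e, Continuous fun z => fderiv ℝ g z e := fun e =>
    (hg1.continuous_fderiv one_ne_zero).clm_apply continuous_const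
  have hfe : ∀ e, Continuous fun z => fderiv ℝ f z e := fun e =>
    (hf.continuous_fderiv one_ne_zero).clm_apply continuous_const
  have hmain : ∀ e, ContDiff ℝ (2 * m - 1 : ℕ) fun z => fderiv ℝ g z e := by
    intro e
    refine (contDiff_of_isMV hη.smooth hη.supp hm (hge e) fun R => ?_).1
    obtain ⟨M, hM0, hM⟩ := exists_abs_le_closedBall (hfe e) (R + 2 + 1)
    have ha : ∀ a : ℝ, 0 < a → a ≤ 1 → ∀ x ∈ closedBall (0 : Euc n) R,
        IsMV m η (smear η a fun z => fderiv ℝ g z e) x (C * ((∫ y, |η y|) * M)) := by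
      intro a ha ha1 x hx
      refine hη.isMV (contDiff_smear_kernel (hη.smooth _) hη.supp ha (hge e)) fun z hz => ?_
      rw [hη.lap_iterate_smear_fderiv hg1 hf ha (hl a ha) e]
      exact norm_smear_le (g := fun z => fderiv ℝ f z e) hη' hη.supp ha.le fun y hy =>
        hM y (mem_closedBall_zero_add (mem_closedBall_zero_add hx hz)
          (closedBall_subset_closedBall ha1 hy))
    refine ⟨C * ((∫ y, |η y|) * M), fun x hx z hz b hb hb1 => ?_⟩
    have h1 : Tendsto (fun a => |smear η a (fun z => fderiv ℝ g z e) z -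
        smear η b (smear η a fun z => fderiv ℝ g z e) z|) (𝓝[>] 0)
        (𝓝 |fderiv ℝ g z e - smear η b (fun z => fderiv ℝ g z e) z|) := by
      refine ((hη.tendsto_smear_zero (hge e) z).sub ?_).abs
      refine (hη.tendsto_smear_zero (continuous_smear hη' hη.supp b (hge e)) z).congr fun a => ?_
      exact smear_comm hη' hη.supp hη' hη.supp a b (hge e) z
    refine le_of_tendsto h1 ?_
    filter_upwards [Ioc_mem_nhdsGT (one_pos : (0 : ℝ) < 1)] with a ⟨ha0, ha1⟩
    exact ha a ha0 ha1 x hx z hz b hb hb1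
  have hg2 : ContDiff ℝ (2 * m : ℕ) g := by
    rw [show (2 * m : ℕ) = (2 * m - 1) + 1 by omega, Nat.cast_add, Nat.cast_one,
      contDiff_succ_iff_fderiv_apply]
    exact ⟨hg1.differentiable one_ne_zero, by simp, hmain⟩
  refine ⟨hg2, ?_⟩
  ext x
  refine tendsto_nhds_unique (hη.tendsto_smear_zero hg2.continuous_lap_iterate x)
    ((hη.tendsto_smear_zero hf.continuous x).congr' ?_)
  filter_upwards [self_mem_nhdsWithin] with a ha
  rw [← lap_iterate_smear hη' hη.supp a hg2, hl a ha]

end Regularity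

section Liouville

variable {n m : ℕ} {η : Euc n → ℝ} {C : ℝ}

theorem smear_eq_integral {k g : Euc n → ℝ} {a : ℝ} (ha : 0 < a) (x : Euc n) :
    smear k a g x = a⁻¹ ^ n * ∫ z, k (a⁻¹ • (x - z)) * g z := by
  have h1 := Measure.integral_comp_smul volume (fun y => k (a⁻¹ • y) * g (x - y)) a
  have h2 := integral_sub_left_eq_self (fun z => k (a⁻¹ • (x - z)) * g z) volume x
  simp only [sub_sub_cancel] at h2
  rw [h2, finrank_euclideanSpace_fin, abs_of_nonneg (by positivity), ← inv_pow, smul_eq_mul] at h1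
  rw [← h1]
  unfold smear
  simp only [smul_eq_mul, smul_smul, inv_mul_cancel₀ ha.ne', one_smul]

/-- Averages over a ball are controlled by weighted averages over larger balls. -/
theorem exists_abs_smear_le_radial {h : ℝ → ℝ} (hc : Continuous h) (hs : ∀ s, 1 ≤ s → h s = 0)
    (hnn : ∀ s, 0 ≤ h s) (hpos : ∀ s, s < 1 → 0 < h s) {k : Euc n → ℝ} (hk : Continuous k)
    (hks : ∀ y, 1 ≤ ‖y‖ → k y = 0) : ∃ B : ℝ, 0 ≤ B ∧ ∀ g : Euc n → ℝ, Continuous g →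
      ∀ (a R : ℝ) (x x' : Euc n), 0 < a → dist x x' + a ≤ R / 2 →
        |smear k a g x| ≤ B * (R / a) ^ n * smear (radial n h) R (fun z => |g z|) x' := by
  obtain ⟨A, hA⟩ := hk.bounded_above_of_compact_support (hasCompactSupport_of_unitBall hks)
  have hA0 : 0 ≤ A := (norm_nonneg _).trans (hA 0)
  obtain ⟨δ, hδ, hδh⟩ : ∃ δ : ℝ, 0 < δ ∧ ∀ s ∈ Icc (0 : ℝ) (1 / 4), δ ≤ h s := by
    obtain ⟨s₁, hs₁, hs₁'⟩ := isCompact_Icc.exists_isMinOn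
      (nonempty_Icc.2 (by norm_num : (0:ℝ) ≤ 1 / 4)) hc.continuousOn
    exact ⟨h s₁, hpos _ (by linarith [hs₁.2]), hs₁'⟩
  refine ⟨A / δ, by positivity, fun g hg a R x x' ha hR => ?_⟩
  have hR0 : 0 < R := by linarith [dist_nonneg (x := x) (y := x')]
  rw [smear_eq_integral ha, smear_eq_integral hR0, abs_mul, abs_of_nonneg (by positivity)]
  have hrc : HasCompactSupport fun z => radial n h (R⁻¹ • (x' - z)) * |g z| := by
    refine HasCompactSupport.of_support_subset_isCompact (isCompact_closedBall x' R) fun z hz => ?_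
    by_contra hz'
    refine hz ?_
    simp only
    rw [radial_eq_zero hs, zero_mul]
    rw [mem_closedBall, not_le, dist_comm, dist_eq_norm] at hz'
    rw [norm_smul, norm_inv, Real.norm_of_nonneg hR0.le, inv_mul_eq_div, le_div_iff₀ hR0]
    linarith
  have hrcont : Continuous fun z => radial n h (R⁻¹ • (x' - z)) * |g z| :=
    ((continuous_radial hc).comp (by fun_prop)).mul hg.abs
  have h1 : |∫ z : Euc n, k (a⁻¹ • (x - z)) * g z| ≤
      ∫ z : Euc n, A / δ * (radial n h (R⁻¹ • (x' - z)) * |g z|) := by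
    have hint : Integrable (fun z : Euc n => A / δ * (radial n h (R⁻¹ • (x' - z)) * |g z|)) volume :=
      (hrcont.integrable_of_hasCompactSupport hrc).const_mul _
    rw [← Real.norm_eq_abs]
    refine norm_integral_le_of_norm_le hint (Eventually.of_forall fun z => ?_)
    rw [norm_mul, Real.norm_eq_abs (g z), ← mul_assoc]
    refine mul_le_mul_of_nonneg_right ?_ (abs_nonneg _)
    rcases le_or_gt 1 ‖a⁻¹ • (x - z)‖ with h1 | h1
    · rw [hks _ h1, norm_zero]
      exact mul_nonneg (by positivity) (hnn _)
    · refine (hA _).trans ?_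
      rw [div_mul_eq_mul_div, le_div_iff₀ hδ]
      refine mul_le_mul_of_nonneg_left (hδh _ ⟨by positivity, ?_⟩) hA0
      rw [norm_smul, norm_inv, Real.norm_of_nonneg ha.le, inv_mul_eq_div, div_lt_one ha,
        ← dist_eq_norm] at h1
      have h2 : dist x' z ≤ R / 2 := by linarith [dist_triangle x' x z, dist_comm x' x]
      have h3 : ‖R⁻¹ • (x' - z)‖ ≤ 1 / 2 := by
        rw [norm_smul, norm_inv, Real.norm_of_nonneg hR0.le, inv_mul_eq_div, ← dist_eq_norm,
          div_le_iff₀ hR0]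
        linarith
      nlinarith [norm_nonneg (R⁻¹ • (x' - z))]
  rw [integral_const_mul] at h1
  have h4 : A / δ * (R / a) ^ n * (R⁻¹ ^ n * ∫ z, radial n h (R⁻¹ • (x' - z)) * |g z|) =
      a⁻¹ ^ n * (A / δ * ∫ z, radial n h (R⁻¹ • (x' - z)) * |g z|) := by
    rw [div_eq_mul_inv R a, mul_pow, inv_pow R]
    field_simp
  rw [h4]
  exact mul_le_mul_of_nonneg_left h1 (by positivity)

theorem smear_radial_abs_of_nonpos {h : ℝ → ℝ} (hs : ∀ s, 1 ≤ s → h s = 0)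
    {w : Euc n → ℝ} {R : ℝ} (hR : 0 < R) {x : Euc n} (hw : ∀ z ∈ ball x R, w z ≤ 0) :
    smear (radial n h) R (fun z => |w z|) x = -smear (radial n h) R w x := by
  unfold smear
  rw [← integral_neg]
  congr 1
  ext y
  rcases le_or_gt 1 ‖y‖ with hy | hy
  · rw [radial_eq_zero hs y hy]
    simp
  · simp only
    rw [abs_of_nonpos (hw _ _), smul_neg]
    rw [mem_ball, dist_eq_norm, sub_sub_cancel_left, norm_neg, norm_smul,
      Real.norm_of_nonneg hR.le]
    nlinarith

theorem IsKernel.smear_eq_self (hη : IsKernel m η C) {p : Euc n → ℝ}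
    (hp : ContDiff ℝ (2 * m : ℕ) p) (hl : lap^[m] p = 0) {a : ℝ} (ha : 0 ≤ a) :
    smear η a p = p := by
  ext x
  have := hη.est p hp x a ha 0 fun z _ => by simp [hl]
  rw [mul_zero, abs_nonpos_iff, sub_eq_zero] at this
  exact this.symm

theorem IsKernel.contDiff_of_lap_iterate_eq_zero (hη : IsKernel m η C) {p : Euc n → ℝ}
    (hp : ContDiff ℝ (2 * m : ℕ) p) (hl : lap^[m] p = 0) (N : ℕ) : ContDiff ℝ N p := by
  rw [← hη.smear_eq_self hp hl zero_le_one]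
  exact contDiff_smear_kernel (hη.smooth N) hη.supp one_pos hp.continuous

/-- A nonpositive entire polyharmonic function of order `m` is a polynomial of degree at most
`2 m - 2`. -/
theorem IsKernel.liouville (hη : IsKernel m η C) (hm : 0 < m) {p : Euc n → ℝ}
    (hp : ContDiff ℝ (2 * m : ℕ) p) (hl : lap^[m] p = 0) (hp0 : ∀ x, p x ≤ 0) (x : Euc n) :
    iteratedFDeriv ℝ (2 * m - 1) p x = 0 := by
  obtain ⟨h, hsm, hs, hnn, hpos, -⟩ := exists_profile n
  have hc := (hsm 0).continuous
  obtain ⟨c, C', -, -, hP⟩ := pizzetti (n := n) m h hc hs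
  have hkc : Continuous fun y => ‖iteratedFDeriv ℝ (2 * m - 1) η y‖ :=
    ((hη.smooth (2 * m - 1)).continuous_iteratedFDeriv le_rfl).norm
  obtain ⟨B, hB, hcmp⟩ := exists_abs_smear_le_radial hc hs hnn hpos hkc
    (iteratedFDeriv_eq_zero_of_unitBall _ (hη.smooth _) hη.supp)
  set A := ∑ i ∈ Finset.range m, |c i| * |lap^[i] p x| with hA
  have hgrow : ∀ R : ℝ, 1 ≤ R →
      smear (radial n h) R (fun z => |p z|) x ≤ A * R ^ (2 * m - 2) := by
    intro R hR
    have h1 := hP p hp x R (by linarith) 0 fun z _ => by simp [hl]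
    rw [mul_zero, abs_nonpos_iff, sub_eq_zero] at h1
    rw [smear_radial_abs_of_nonpos hs (by linarith) fun z _ => hp0 z, h1, hA, Finset.sum_mul]
    refine (neg_le_abs _).trans ((Finset.abs_sum_le_sum_abs _ _).trans
      (Finset.sum_le_sum fun i hi => ?_))
    have hi' := Finset.mem_range.1 hi
    rw [abs_mul, abs_mul, abs_of_nonneg (by positivity : (0:ℝ) ≤ R ^ (2 * i)), mul_right_comm]
    exact mul_le_mul_of_nonneg_left (pow_le_pow_right₀ hR (by omega)) (by positivity)
  have hbound : ∀ a : ℝ, 1 ≤ a → ‖iteratedFDeriv ℝ (2 * m - 1) p x‖ ≤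
      (B * 2 ^ n * A * 2 ^ (2 * m - 2)) * a⁻¹ := by
    intro a ha
    have ha0 : 0 < a := by linarith
    have h1 := norm_iteratedFDeriv_smear_le_integral (hη.smooth (2 * m - 1)) hη.supp ha0
      hp.continuous x
    rw [hη.smear_eq_self hp hl ha0.le] at h1
    have h2 := hcmp (fun z => |p z|) hp.continuous.abs a (2 * a) x x ha0 (by simp)
    simp only [abs_abs] at h2
    have h3 := hgrow (2 * a) (by linarith)
    have h4 : 2 * a / a = 2 := by field_simp
    rw [h4] at h2
    have h5 : smear (fun y => ‖iteratedFDeriv ℝ (2 * m - 1) η y‖) a (fun z => |p z|) x ≤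
        B * 2 ^ n * (A * (2 * a) ^ (2 * m - 2)) :=
      (le_abs_self _).trans (h2.trans (mul_le_mul_of_nonneg_left h3 (by positivity)))
    refine h1.trans ((mul_le_mul_of_nonneg_left h5 (by positivity)).trans (le_of_eq ?_))
    obtain ⟨k, hk⟩ : ∃ k, 2 * m - 2 = k := ⟨_, rfl⟩
    rw [show 2 * m - 1 = k + 1 by omega, hk, mul_pow, pow_succ, inv_pow]
    field_simp
  have h1 : Tendsto (fun a : ℝ => (B * 2 ^ n * A * 2 ^ (2 * m - 2)) * a⁻¹) atTop (𝓝 0) := by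
    simpa using tendsto_inv_atTop_zero.const_mul (B * 2 ^ n * A * 2 ^ (2 * m - 2))
  exact norm_le_zero_iff.1 (ge_of_tendsto h1 ((eventually_ge_atTop 1).mono hbound))

end Liouville

section ZeroSet

theorem Polynomial.exists_derivative_eq (P : Polynomial ℝ) :
    ∃ Q : Polynomial ℝ, Q.derivative = P := by
  induction P using Polynomial.induction_on' with
  | add p q hp hq =>
    obtain ⟨p', rfl⟩ := hp
    obtain ⟨q', rfl⟩ := hq
    exact ⟨p' + q', by simp⟩
  | monomial k a =>
    refine ⟨Polynomial.monomial (k + 1) (a / (k + 1)), ?_⟩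
    rw [Polynomial.derivative_monomial]
    congr 1
    push_cast
    field_simp

theorem exists_polynomial_of_iteratedDeriv_eq_zero (N : ℕ) : ∀ q : ℝ → ℝ, ContDiff ℝ N q →
    iteratedDeriv N q = 0 → ∃ P : Polynomial ℝ, ∀ t, q t = P.eval t := by
  induction N with
  | zero =>
    intro q _ hq
    rw [iteratedDeriv_zero] at hq
    exact ⟨0, by simp [hq]⟩
  | succ N ih =>
    intro q hqd hq
    rw [iteratedDeriv_succ'] at hq
    obtain ⟨P, hP⟩ := ih (deriv q) (ContDiff.deriv' (by exact_mod_cast hqd)) hq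
    obtain ⟨Q, rfl⟩ := P.exists_derivative_eq
    have hdq : Differentiable ℝ q := hqd.differentiable (by simp)
    have h1 : ∀ t, deriv (fun t => q t - Q.eval t) t = 0 := by
      intro t
      rw [deriv_fun_sub (hdq t) Q.differentiableAt, hP, Polynomial.deriv, sub_self]
    have h2 := is_const_of_deriv_eq_zero (hdq.sub Q.differentiable) h1
    refine ⟨Q + Polynomial.C (q 0 - Q.eval 0), fun t => ?_⟩
    have := h2 t 0
    simp only [Pi.sub_apply] at this
    simp only [Polynomial.eval_add, Polynomial.eval_C]
    linarith

variable {n : ℕ}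

theorem iteratedFDeriv_line_eq_zero {N : ℕ} {p : Euc n → ℝ} (hp : ContDiff ℝ N p)
    (h0 : ∀ x, iteratedFDeriv ℝ N p x = 0) (z y : Euc n) :
    iteratedDeriv N (fun t : ℝ => p (z + t • y)) = 0 := by
  ext t
  have h1 : (fun t : ℝ => p (z + t • y)) =
      (fun x => p (z + x)) ∘ (ContinuousLinearMap.toSpanSingleton ℝ y) := by
    ext t
    simp [ContinuousLinearMap.toSpanSingleton_apply]
  rw [iteratedDeriv_eq_iteratedFDeriv, h1,
    ContinuousLinearMap.iteratedFDeriv_comp_right (ContinuousLinearMap.toSpanSingleton ℝ y)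
      (f := fun x => p (z + x)) (hp.comp (contDiff_const.add contDiff_id)) t le_rfl, iteratedFDeriv_comp_add_left, h0]
  simp

/-- The zero set of a nonzero polynomial function is negligible. -/
theorem ae_ne_zero_of_iteratedFDeriv_eq_zero {N : ℕ} {p : Euc n → ℝ} (hp : ContDiff ℝ N p)
    (h0 : ∀ x, iteratedFDeriv ℝ N p x = 0) {z : Euc n} (hz : p z ≠ 0) :
    ∀ᵐ x ∂(volume : Measure (Euc n)), p x ≠ 0 := by
  have hline : ∀ y : Euc n, volume {t : ℝ | p (z + t • y) = 0} = 0 := by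
    intro y
    obtain ⟨P, hP⟩ := exists_polynomial_of_iteratedDeriv_eq_zero N
      (fun t : ℝ => p (z + t • y)) (by fun_prop) (iteratedFDeriv_line_eq_zero hp h0 z y)
    have hP0 : P ≠ 0 := by
      rintro rfl
      exact hz (by simpa using hP 0)
    refine Set.Finite.measure_zero ((P.roots.toFinset.finite_toSet).subset fun t ht => ?_) _
    simp only [mem_ofPred_eq] at ht
    simp [hP0, ← hP, ht]
  have hS : MeasurableSet {q : Euc n × ℝ | p (z + q.2 • q.1) = 0} := by
    have : Continuous fun q : Euc n × ℝ => p (z + q.2 • q.1) := hp.continuous.comp (by fun_prop)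
    exact (isClosed_singleton.preimage this).measurableSet
  have hprod : (volume : Measure (Euc n)).prod (volume : Measure ℝ)
      {q : Euc n × ℝ | p (z + q.2 • q.1) = 0} = 0 :=
    (Measure.measure_prod_null hS).2 (Eventually.of_forall fun y => hline y)
  have hswap : (volume : Measure ℝ).prod (volume : Measure (Euc n))
      {q : ℝ × Euc n | p (z + q.1 • q.2) = 0} = 0 := by
    rw [← Measure.prod_swap, Measure.map_apply measurable_swap] at hprod
    · exact hprod
    · exact hS
  have hae := Measure.measure_ae_null_of_prod_null hswap
  have hne : ∀ᵐ t ∂(volume : Measure ℝ), t ≠ 0 := by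
    simp [ae_iff]
  obtain ⟨t, ht, ht0⟩ := (hae.and hne).exists
  have h1 : (volume : Measure (Euc n)) ((fun y => t • y) ⁻¹' {y | p (z + y) = 0}) = 0 := ht
  rw [Measure.addHaar_preimage_smul _ ht0] at h1
  have h2 : (volume : Measure (Euc n)) {y | p (z + y) = 0} = 0 := by
    rcases mul_eq_zero.1 h1 with h | h
    · rw [ENNReal.ofReal_eq_zero] at h
      exact absurd h (not_le.2 (abs_pos.2 (inv_ne_zero (pow_ne_zero _ ht0))))
    · exact h
  have h3 : (volume : Measure (Euc n)) ((fun y => z + y) ⁻¹' {y | p y = 0}) = 0 := h2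
  rw [measure_preimage_add] at h3
  simpa [ae_iff] using h3

end ZeroSet

section Dichotomy

variable {n m : ℕ} {η : Euc n → ℝ} {C : ℝ}

theorem abs_exp_sub_exp_le {a b : ℝ} (ha : a ≤ 0) (hb : b ≤ 0) :
    |Real.exp a - Real.exp b| ≤ |a - b| := by
  wlog hab : b ≤ a generalizing a b
  · rw [abs_sub_comm, abs_sub_comm a]
    exact this hb ha (le_of_not_ge hab)
  rw [abs_of_nonneg (sub_nonneg.2 (Real.exp_le_exp.2 hab)), abs_of_nonneg (sub_nonneg.2 hab)]
  have h1 := Real.add_one_le_exp (b - a)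
  have h2 : Real.exp b = Real.exp a * Real.exp (b - a) := by rw [← Real.exp_add]; ring_nf
  have h3 : Real.exp a ≤ 1 := Real.exp_le_one_iff.2 ha
  rw [h2]
  nlinarith [Real.exp_pos a]

/-- Local bounds for functions which are nonpositive on a large ball and have bounded `Δ ^ m`, in
terms of finitely many averages. -/
theorem IsKernel.exists_abs_le_averages (hη : IsKernel m η C) {h : ℝ → ℝ} (hc : Continuous h)
    (hs : ∀ s, 1 ≤ s → h s = 0) (hnn : ∀ s, 0 ≤ h s) (hpos : ∀ s, s < 1 → 0 < h s) {R : ℝ}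
    (hR : 0 ≤ R) (M : ℝ) : ∃ A : ℝ, 0 ≤ A ∧ ∀ w : Euc n → ℝ, ContDiff ℝ (2 * m : ℕ) w →
      (∀ z ∈ closedBall (0 : Euc n) (2 * (R + 1)), w z ≤ 0) →
      (∀ z ∈ closedBall (0 : Euc n) (2 * (R + 1)), |lap^[m] w z| ≤ M) →
      ∀ x ∈ closedBall (0 : Euc n) R,
        |w x| ≤ A * (∑ j ∈ Finset.range m, smear (radial n h) ((j : ℝ) + 1)⁻¹ (fun z => |w z|) 0
          + 1) := by
  obtain ⟨B₁, hB₁, h1⟩ := abs_smear_radial_le n m hc hs (show 1 ≤ 2 * (R + 1) by linarith)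
  obtain ⟨B₂, hB₂, h2⟩ := exists_abs_smear_le_radial hc hs hnn hpos hη.continuous hη.supp
  set D := B₂ * (2 * (R + 1) / 1) ^ n with hD
  have hD0 : 0 ≤ D := by positivity
  have hC := hη.nonneg
  refine ⟨D * B₁ * (|M| + 1) + C * |M|, by positivity, fun w hw hneg hM x hx => ?_⟩
  have hx' := mem_closedBall.1 hx
  set S := ∑ j ∈ Finset.range m, smear (radial n h) ((j : ℝ) + 1)⁻¹ (fun z => |w z|) 0 with hS
  have hS0 : 0 ≤ S := Finset.sum_nonneg fun j _ => integral_nonneg fun y =>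
    mul_nonneg (hnn _) (abs_nonneg _)
  have h3 := hη.est w hw x 1 zero_le_one M fun z hz => hM z (by
    have := mem_closedBall_zero_add hx hz
    exact closedBall_subset_closedBall (by linarith) this)
  have h4 := h2 w hw.continuous 1 (2 * (R + 1)) x 0 one_pos (by linarith)
  have h5 := h1 w hw 0 M hM
  have h6 : smear (radial n h) (2 * (R + 1)) (fun z => |w z|) 0 ≤ B₁ * (S + M) := by
    rw [smear_radial_abs_of_nonpos hs (by linarith) fun z hz =>
      hneg z (ball_subset_closedBall hz)]
    refine (neg_le_abs _).trans (h5.trans (mul_le_mul_of_nonneg_left ?_ hB₁))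
    refine add_le_add (Finset.sum_le_sum fun j _ => ?_) le_rfl
    have hj : (0 : ℝ) < ((j : ℝ) + 1)⁻¹ := by positivity
    have hj1 : ((j : ℝ) + 1)⁻¹ ≤ 1 := inv_le_one_of_one_le₀ (by linarith [j.cast_nonneg (α := ℝ)])
    rw [smear_radial_abs_of_nonpos hs hj fun z hz => hneg z
      (closedBall_subset_closedBall (by linarith) (ball_subset_closedBall hz)), abs_of_nonpos]
    refine integral_nonpos fun y => ?_
    rcases le_or_gt 1 ‖y‖ with hy | hy
    · simp [radial_eq_zero hs y hy]
    · refine mul_nonpos_of_nonneg_of_nonpos (hnn _) (hneg _ ?_)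
      rw [mem_closedBall, dist_zero_right, zero_sub, norm_neg, norm_smul, Real.norm_of_nonneg hj.le]
      nlinarith [norm_nonneg y]
  have h7 : |w x| ≤ |smear η 1 w x| + C * M := by
    have := abs_sub_abs_le_abs_sub (w x) (smear η 1 w x)
    rw [one_pow, mul_one] at h3
    linarith
  have h8 := mul_le_mul_of_nonneg_left h6 hD0
  have hM1 := le_abs_self M
  have hM2 := abs_nonneg M
  have h9 : D * (B₁ * (S + M)) ≤ D * B₁ * ((|M| + 1) * (S + 1)) := by
    rw [← mul_assoc]
    refine mul_le_mul_of_nonneg_left ?_ (by positivity)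
    nlinarith
  have h10 : C * M ≤ C * |M| * (S + 1) := by
    nlinarith [mul_le_mul_of_nonneg_left hM1 hC, mul_nonneg (mul_nonneg hC hM2) hS0]
  nlinarith

variable {w f q : ℕ → Euc n → ℝ} {q₀ : ℝ}

theorem IsKernel.limit_of_bounded (hη : IsKernel m η C) (hm : 0 < m)
    (hw : ∀ k, ContDiff ℝ (2 * m : ℕ) (w k))
    (hfw : ∀ R : ℝ, ∀ᶠ k in atTop, ∀ x ∈ ball (0 : Euc n) R, f k x = w k x)
    (hneg : ∀ R : ℝ, ∀ᶠ k in atTop, ∀ x ∈ closedBall (0 : Euc n) R, w k x ≤ 0)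
    (hq : ∀ ε : ℝ, 0 < ε → ∀ R : ℝ,
      ∀ᶠ k in atTop, ∀ x ∈ closedBall (0 : Euc n) R, |q k x - q₀| ≤ ε)
    (hpde : ∀ R : ℝ, ∀ᶠ k in atTop, ∀ x ∈ closedBall (0 : Euc n) R,
      (-1 : ℝ) ^ m * lap^[m] (w k) x = q k x * Real.exp (2 * m * w k x))
    (hM : ∀ R : ℝ, ∃ M : ℝ, ∀ᶠ k in atTop, ∀ x ∈ closedBall (0 : Euc n) R, |lap^[m] (w k) x| ≤ M)
    (hN : ∀ R : ℝ, ∃ N : ℝ, ∀ᶠ k in atTop, ∀ x ∈ closedBall (0 : Euc n) R, |w k x| ≤ N) :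
    ∃ φ : ℕ → ℕ, StrictMono φ ∧ ∃ g : Euc n → ℝ, ContDiff ℝ (2 * m : ℕ) g ∧
      (∀ x, (-1 : ℝ) ^ m * lap^[m] g x = q₀ * Real.exp (2 * m * g x)) ∧
      ∀ α ∈ Ico (0 : ℝ) 1, TendstoCLocHolder (2 * m - 1) α univ (fun k => f (φ k)) g := by
  obtain ⟨φ, g, hφ, hg, hlim⟩ := hη.exists_subseq hm hw hM hN
  have hφt := hφ.tendsto_atTop
  have hw' : ∀ k, ContDiff ℝ (2 * m : ℕ) (w (φ k)) := fun k => hw _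
  have hM' : ∀ R : ℝ, ∃ M : ℝ, ∀ᶠ k in atTop,
      ∀ x ∈ closedBall (0 : Euc n) R, |lap^[m] (w (φ k)) x| ≤ M := fun R =>
    (hM R).imp fun M h => hφt.eventually h
  have hgd := hη.contDiff_limit hm hw' hg hlim hM'
  have hg0 : ∀ x, g x ≤ 0 := fun x =>
    le_of_tendsto (hlim.tendstoLocallyUniformlyOn.tendsto_at (mem_univ x))
      ((hφt.eventually (hneg ‖x‖)).mono fun k hk => hk x (by simp))
  have hsign : (-1 : ℝ) ^ m * (-1) ^ m = 1 := by rw [← mul_pow]; simp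
  have habs : |(-1 : ℝ) ^ m| = 1 := by simp
  set F : Euc n → ℝ := fun x => (-1) ^ m * (q₀ * Real.exp (2 * m * g x)) with hF
  have hgd1 : ContDiff ℝ 1 g := hgd.of_le (by norm_cast; omega)
  have hFd : ContDiff ℝ 1 F := by
    exact contDiff_const.mul (contDiff_const.mul (Real.contDiff_exp.comp (contDiff_const.mul hgd1)))
  have hlap : TendstoLocallyUniformly (fun k => lap^[m] (w (φ k))) F atTop := by
    refine tendstoLocallyUniformly_of_eventually fun ε hε R => ?_
    have hδ : 0 < ε / 2 / (|q₀| * (2 * m) + 1) := by positivity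
    filter_upwards [hφt.eventually (hpde R), hφt.eventually (hq (ε / 2) (half_pos hε) R),
      hφt.eventually (hneg R), hlim.eventually_abs_sub_le hδ R] with k h1 h2 h3 h4 x hx
    have h5 : lap^[m] (w (φ k)) x = (-1) ^ m * (q (φ k) x * Real.exp (2 * m * w (φ k) x)) := by
      rw [← h1 x hx, ← mul_assoc, hsign, one_mul]
    have hm0 : (0 : ℝ) ≤ 2 * m := by positivity
    have h6 : 2 * m * w (φ k) x ≤ 0 := mul_nonpos_of_nonneg_of_nonpos hm0 (h3 x hx)
    have h7 : 2 * m * g x ≤ 0 := mul_nonpos_of_nonneg_of_nonpos hm0 (hg0 x)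
    have h8 := abs_exp_sub_exp_le h6 h7
    rw [← mul_sub, abs_mul, abs_of_nonneg hm0] at h8
    have h9 : |Real.exp (2 * m * w (φ k) x)| ≤ 1 := by
      rw [abs_of_pos (Real.exp_pos _)]
      exact Real.exp_le_one_iff.2 h6
    rw [h5, hF]
    simp only
    rw [← mul_sub, abs_mul, habs, one_mul, show q (φ k) x * Real.exp (2 * m * w (φ k) x) -
      q₀ * Real.exp (2 * m * g x) = (q (φ k) x - q₀) * Real.exp (2 * m * w (φ k) x) +
        q₀ * (Real.exp (2 * m * w (φ k) x) - Real.exp (2 * m * g x)) by ring]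
    refine (abs_add_le _ _).trans ?_
    rw [abs_mul, abs_mul]
    have h10 : |q (φ k) x - q₀| * |Real.exp (2 * m * w (φ k) x)| ≤ ε / 2 * 1 :=
      mul_le_mul (h2 x hx) h9 (abs_nonneg _) (half_pos hε).le
    have h11 : |q₀| * |Real.exp (2 * m * w (φ k) x) - Real.exp (2 * m * g x)| ≤ ε / 2 := by
      refine (mul_le_mul_of_nonneg_left
        (h8.trans (mul_le_mul_of_nonneg_left (h4 x hx) hm0)) (abs_nonneg _)).trans ?_
      rw [← mul_assoc, mul_div_assoc', div_le_iff₀ (by positivity)]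
      nlinarith [mul_nonneg (abs_nonneg q₀) hm0]
    linarith
  obtain ⟨h1, h2⟩ := hη.contDiff_two_mul hm hgd hFd fun a ha =>
    hη.lap_iterate_smear_of_tendsto hw' hg hFd.continuous hlim hlap ha
  refine ⟨φ, hφ, g, h1, fun x => ?_, fun α hα => ?_⟩
  · rw [h2, hF, ← mul_assoc, hsign, one_mul]
  · exact hη.tendstoCLocHolder hm hw' hg hlim hM' (fun R => hφt.eventually (hfw R)) hα

theorem IsKernel.limit_of_unbounded (hη : IsKernel m η C) (hm : 0 < m) {h : ℝ → ℝ}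
    (hc : Continuous h) (hs : ∀ s, 1 ≤ s → h s = 0)
    (hw : ∀ k, ContDiff ℝ (2 * m : ℕ) (w k))
    (hfw : ∀ R : ℝ, ∀ᶠ k in atTop, ∀ x ∈ ball (0 : Euc n) R, f k x = w k x)
    (hneg : ∀ R : ℝ, ∀ᶠ k in atTop, ∀ x ∈ closedBall (0 : Euc n) R, w k x ≤ 0)
    {M : ℝ} (hM : ∀ R : ℝ, ∀ᶠ k in atTop,
      ∀ x ∈ closedBall (0 : Euc n) R, |lap^[m] (w k) x| ≤ M)
    {G : ℕ → ℝ}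
    (hG : ∀ k, G k = ∑ j ∈ Finset.range m, smear (radial n h) ((j : ℝ) + 1)⁻¹ (fun z => |w k z|) 0)
    (hGt : Tendsto G atTop atTop)
    (hA : ∀ R : ℝ, ∃ A : ℝ, 0 ≤ A ∧ ∀ᶠ k in atTop,
      ∀ x ∈ closedBall (0 : Euc n) R, |w k x| ≤ A * (G k + 1)) :
    ∃ φ : ℕ → ℕ, StrictMono φ ∧
      (∀ᵐ x ∂(volume : Measure (Euc n)), Tendsto (fun k => f (φ k) x) atTop atBot) ∧
      ∃ (γ : ℕ → ℝ) (p : Euc n → ℝ), (∀ k, 0 < γ k) ∧ Tendsto γ atTop atTop ∧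
        ContDiff ℝ (⊤ : ℕ∞) p ∧ (∀ x, iteratedFDeriv ℝ (2 * m - 1) p x = 0) ∧
        ∀ α ∈ Ico (0 : ℝ) 1,
          TendstoCLocHolder (2 * m - 1) α univ (fun k x => f (φ k) x / γ k) p := by
  set γ : ℕ → ℝ := fun k => max (G k) 1 with hγ
  have hγ1 : ∀ k, 1 ≤ γ k := fun k => le_max_right _ _
  have hγ0 : ∀ k, 0 < γ k := fun k => one_pos.trans_le (hγ1 k)
  have hγt : Tendsto γ atTop atTop := tendsto_atTop_mono (fun k => le_max_left _ _) hGt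
  set W : ℕ → Euc n → ℝ := fun k x => (γ k)⁻¹ * w k x with hW
  have hWd : ∀ k, ContDiff ℝ (2 * m : ℕ) (W k) := fun k => contDiff_const.mul (hw k)
  have hWl : ∀ k x, lap^[m] (W k) x = (γ k)⁻¹ * lap^[m] (w k) x := fun k x => by
    rw [hW]
    simp only
    rw [lap_iterate_const_mul _ (hw k)]
  have hWM : ∀ R : ℝ, ∃ M : ℝ, ∀ᶠ k in atTop,
      ∀ x ∈ closedBall (0 : Euc n) R, |lap^[m] (W k) x| ≤ M := by
    refine fun R => ⟨M, (hM R).mono fun k hk x hx => ?_⟩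
    rw [hWl, abs_mul, abs_of_pos (inv_pos.2 (hγ0 k))]
    exact (mul_le_of_le_one_left (abs_nonneg _) (inv_le_one_of_one_le₀ (hγ1 k))).trans (hk x hx)
  have hWN : ∀ R : ℝ, ∃ N : ℝ, ∀ᶠ k in atTop,
      ∀ x ∈ closedBall (0 : Euc n) R, |W k x| ≤ N := by
    intro R
    obtain ⟨A, hA0, hA⟩ := hA R
    refine ⟨A * 2, hA.mono fun k hk x hx => ?_⟩
    rw [hW]
    simp only
    rw [abs_mul, abs_of_pos (inv_pos.2 (hγ0 k)), inv_mul_le_iff₀ (hγ0 k)]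
    refine (hk x hx).trans ?_
    have : G k ≤ γ k := le_max_left _ _
    nlinarith [hγ1 k]
  obtain ⟨φ, p, hφ, hp, hlim⟩ := hη.exists_subseq hm hWd hWM hWN
  have hφt := hφ.tendsto_atTop
  have hWd' : ∀ k, ContDiff ℝ (2 * m : ℕ) (W (φ k)) := fun k => hWd _
  have hWM' : ∀ R : ℝ, ∃ M : ℝ, ∀ᶠ k in atTop,
      ∀ x ∈ closedBall (0 : Euc n) R, |lap^[m] (W (φ k)) x| ≤ M := fun R =>
    (hWM R).imp fun M h => hφt.eventually h
  have hlap : TendstoLocallyUniformly (fun k => lap^[m] (W (φ k))) 0 atTop := by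
    refine tendstoLocallyUniformly_of_eventually fun ε hε R => ?_
    filter_upwards [hφt.eventually (hM R), hφt.eventually (hγt.eventually_ge_atTop (|M| / ε))]
      with k h1 h2 x hx
    rw [hWl, Pi.zero_apply, sub_zero, abs_mul, abs_of_pos (inv_pos.2 (hγ0 _)),
      inv_mul_le_iff₀ (hγ0 _)]
    rw [div_le_iff₀ hε] at h2
    exact (h1 x hx).trans ((le_abs_self M).trans h2)
  have hpt : ∀ x, Tendsto (fun k => W (φ k) x) atTop (𝓝 (p x)) := fun x =>
    hlim.tendstoLocallyUniformlyOn.tendsto_at (mem_univ x)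
  have hp0 : ∀ x, p x ≤ 0 := fun x => le_of_tendsto (hpt x)
    ((hφt.eventually (hneg ‖x‖)).mono fun k hk =>
      mul_nonpos_of_nonneg_of_nonpos (inv_pos.2 (hγ0 _)).le (hk x (by simp)))
  obtain ⟨hpd, hpl⟩ := hη.contDiff_two_mul hm (hη.contDiff_limit hm hWd' hp hlim hWM')
    (contDiff_const (c := (0 : ℝ))) fun a ha =>
      hη.lap_iterate_smear_of_tendsto hWd' hp continuous_const hlim hlap ha
  have hpoly := hη.liouville hm hpd hpl hp0
  obtain ⟨z, hz⟩ : ∃ z, p z ≠ 0 := by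
    by_contra! hzero
    have h1 : Tendsto (fun k => ∑ j ∈ Finset.range m,
        smear (radial n h) ((j : ℝ) + 1)⁻¹ (W (φ k)) 0) atTop (𝓝 (∑ j ∈ Finset.range m,
        smear (radial n h) ((j : ℝ) + 1)⁻¹ p 0)) :=
      tendsto_finsetSum _ fun j _ => tendsto_smear (continuous_radial hc) (radial_eq_zero hs)
        (fun k => (hWd' k).continuous) hp hlim (by positivity) 0
    have h2 : ∑ j ∈ Finset.range m, smear (radial n h) ((j : ℝ) + 1)⁻¹ p 0 = 0 :=
      Finset.sum_eq_zero fun j _ => by simp [smear, hzero]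
    rw [h2] at h1
    have h3 : Tendsto (fun _ : ℕ => (-1 : ℝ)) atTop (𝓝 0) := by
      refine h1.congr' ?_
      filter_upwards [hφt.eventually (hneg 1), hφt.eventually (hGt.eventually_ge_atTop 1)]
        with k h4 h5
      have h6 : γ (φ k) = G (φ k) := max_eq_left h5
      have h7 : ∀ j ∈ Finset.range m, smear (radial n h) ((j : ℝ) + 1)⁻¹ (W (φ k)) 0 =
          -(γ (φ k))⁻¹ * smear (radial n h) ((j : ℝ) + 1)⁻¹ (fun z => |w (φ k) z|) 0 := by
        intro j _
        have hj1 : ((j : ℝ) + 1)⁻¹ ≤ 1 :=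
          inv_le_one_of_one_le₀ (by linarith [j.cast_nonneg (α := ℝ)])
        rw [smear_radial_abs_of_nonpos hs (by positivity) fun z hz => h4 z
          (closedBall_subset_closedBall hj1 (ball_subset_closedBall hz)), neg_mul_neg]
        unfold smear
        rw [← integral_const_mul]
        congr 1
        ext y
        simp only [hW, smul_eq_mul]
        ring
      rw [Finset.sum_congr rfl h7, ← Finset.mul_sum, ← hG, h6, neg_mul,
        inv_mul_cancel₀ (by linarith)]
    have := tendsto_nhds_unique h3 tendsto_const_nhds
    norm_num at this
  refine ⟨φ, hφ, ?_, fun k => γ (φ k), p, fun k => hγ0 _, hγt.comp hφt,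
    contDiff_infty.2 (hη.contDiff_of_lap_iterate_eq_zero hpd hpl), hpoly, fun α hα => ?_⟩
  · filter_upwards [ae_ne_zero_of_iteratedFDeriv_eq_zero
      (hη.contDiff_of_lap_iterate_eq_zero hpd hpl (2 * m - 1)) hpoly hz] with x hx
    have h1 := (hpt x).neg_mul_atTop (lt_of_le_of_ne (hp0 x) hx) (hγt.comp hφt)
    refine h1.congr' ?_
    filter_upwards [hφt.eventually (hfw (‖x‖ + 1))] with k hk
    rw [hk x (by simp)]
    simp only [hW, Function.comp_apply]
    have := hγ0 (φ k)
    field_simp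
  · refine hη.tendstoCLocHolder hm hWd' hp hlim hWM' (fun R => ?_) hα
    filter_upwards [hφt.eventually (hfw R)] with k hk x hx
    rw [hk x hx, hW, div_eq_inv_mul]

/-- The dichotomy for sequences of nonpositive solutions on exhausting balls. -/
theorem dichotomy (hm : 0 < m) (hw : ∀ k, ContDiff ℝ (2 * m : ℕ) (w k))
    (hfw : ∀ R : ℝ, ∀ᶠ k in atTop, ∀ x ∈ ball (0 : Euc n) R, f k x = w k x)
    (hneg : ∀ R : ℝ, ∀ᶠ k in atTop, ∀ x ∈ closedBall (0 : Euc n) R, w k x ≤ 0)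
    (hq : ∀ ε : ℝ, 0 < ε → ∀ R : ℝ,
      ∀ᶠ k in atTop, ∀ x ∈ closedBall (0 : Euc n) R, |q k x - q₀| ≤ ε)
    (hpde : ∀ R : ℝ, ∀ᶠ k in atTop, ∀ x ∈ closedBall (0 : Euc n) R,
      (-1 : ℝ) ^ m * lap^[m] (w k) x = q k x * Real.exp (2 * m * w k x)) :
    ∃ φ : ℕ → ℕ, StrictMono φ ∧
      ((∃ g : Euc n → ℝ, ContDiff ℝ (2 * m : ℕ) g ∧
        (∀ x, (-1 : ℝ) ^ m * lap^[m] g x = q₀ * Real.exp (2 * m * g x)) ∧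
        ∀ α ∈ Ico (0 : ℝ) 1, TendstoCLocHolder (2 * m - 1) α univ (fun k => f (φ k)) g) ∨
      ((∀ᵐ x ∂(volume : Measure (Euc n)), Tendsto (fun k => f (φ k) x) atTop atBot) ∧
      ∃ (γ : ℕ → ℝ) (p : Euc n → ℝ), (∀ k, 0 < γ k) ∧ Tendsto γ atTop atTop ∧
        ContDiff ℝ (⊤ : ℕ∞) p ∧ (∀ x, iteratedFDeriv ℝ (2 * m - 1) p x = 0) ∧
        ∀ α ∈ Ico (0 : ℝ) 1,
          TendstoCLocHolder (2 * m - 1) α univ (fun k x => f (φ k) x / γ k) p)) := by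
  obtain ⟨η, hηs, hη0, hηi, C, hC, hest⟩ := exists_meanValue_kernel n hm
  have hη : IsKernel m η C := ⟨hηs, hη0, hηi, hC, hest⟩
  obtain ⟨h, hsm, hs, hnn, hpos, -⟩ := exists_profile n
  have hc := (hsm 0).continuous
  have hM : ∀ R : ℝ, ∀ᶠ k in atTop,
      ∀ x ∈ closedBall (0 : Euc n) R, |lap^[m] (w k) x| ≤ |q₀| + 1 := by
    intro R
    filter_upwards [hneg R, hq 1 one_pos R, hpde R] with k h1 h2 h3 x hx
    have h4 : |lap^[m] (w k) x| = |q k x| * Real.exp (2 * m * w k x) := by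
      have := congrArg abs (h3 x hx)
      rwa [abs_mul, abs_pow, abs_neg, abs_one, one_pow, one_mul, abs_mul, Real.abs_exp] at this
    rw [h4]
    have h5 : Real.exp (2 * m * w k x) ≤ 1 := Real.exp_le_one_iff.2
      (mul_nonpos_of_nonneg_of_nonpos (by positivity) (h1 x hx))
    have h6 : |q k x| ≤ |q₀| + 1 := by
      have := abs_sub_abs_le_abs_sub (q k x) q₀
      linarith [h2 x hx]
    exact (mul_le_of_le_one_right (abs_nonneg _) h5).trans h6
  set G : ℕ → ℝ := fun k =>
    ∑ j ∈ Finset.range m, smear (radial n h) ((j : ℝ) + 1)⁻¹ (fun z => |w k z|) 0 with hG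
  have hA : ∀ R : ℝ, ∃ A : ℝ, 0 ≤ A ∧ ∀ᶠ k in atTop,
      ∀ x ∈ closedBall (0 : Euc n) R, |w k x| ≤ A * (G k + 1) := by
    intro R
    obtain ⟨A, hA0, hA⟩ := hη.exists_abs_le_averages hc hs hnn hpos (abs_nonneg R) (|q₀| + 1)
    refine ⟨A, hA0, ?_⟩
    filter_upwards [hneg (2 * (|R| + 1)), hM (2 * (|R| + 1))] with k h1 h2 x hx
    exact hA (w k) (hw k) h1 h2 x (closedBall_subset_closedBall (le_abs_self R) hx)
  by_cases hGt : Tendsto G atTop atTop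
  · obtain ⟨φ, hφ, h⟩ := hη.limit_of_unbounded hm hc hs hw hfw hneg hM (fun _ => rfl) hGt hA
    exact ⟨φ, hφ, Or.inr h⟩
  · rw [Filter.tendsto_atTop] at hGt
    push Not at hGt
    obtain ⟨B, hB⟩ := hGt
    obtain ⟨φ, hφ, hφB⟩ := extraction_of_frequently_atTop hB
    have hφt := hφ.tendsto_atTop
    obtain ⟨ψ, hψ, g, h⟩ := hη.limit_of_bounded (w := fun k => w (φ k)) (f := fun k => f (φ k))
      (q := fun k => q (φ k)) (q₀ := q₀) hm (fun k => hw _) (fun R => hφt.eventually (hfw R))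
      (fun R => hφt.eventually (hneg R)) (fun ε hε R => hφt.eventually (hq ε hε R))
      (fun R => hφt.eventually (hpde R)) (fun R => ⟨_, hφt.eventually (hM R)⟩) fun R => by
        obtain ⟨A, hA0, hA⟩ := hA R
        refine ⟨A * (B + 1), (hφt.eventually hA).mono fun k hk x hx => (hk x hx).trans ?_⟩
        exact mul_le_mul_of_nonneg_left (by linarith [hφB k]) hA0
    exact ⟨φ ∘ ψ, hφ.comp hψ, Or.inl ⟨g, h⟩⟩

end Dichotomy

section Rescaling

variable {n : ℕ}

theorem exists_contDiff_eq_on_ball {N : ℕ} {f : Euc n → ℝ} {ρ : ℝ} (hρ : 0 < ρ)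
    (hf : ContDiffOn ℝ N f (ball 0 ρ)) :
    ∃ w : Euc n → ℝ, ContDiff ℝ N w ∧ ∀ x ∈ ball (0 : Euc n) (ρ / 2), w x = f x := by
  let b : ContDiffBump (0 : Euc n) := ⟨ρ / 2, 3 * ρ / 4, by linarith, by linarith⟩
  refine ⟨fun x => b x * f x, contDiff_iff_contDiffAt.2 fun x => ?_, fun x hx => ?_⟩
  · rcases lt_or_ge (dist x 0) ρ with h | h
    · exact b.contDiff.contDiffAt.mul (hf.contDiffAt (isOpen_ball.mem_nhds h))
    · have h1 : (fun x => b x * f x) =ᶠ[𝓝 x] fun _ => 0 := by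
        have h2 : x ∈ (closedBall (0 : Euc n) (3 * ρ / 4))ᶜ := by
          rw [mem_compl_iff, mem_closedBall, not_le]
          linarith
        filter_upwards [isClosed_closedBall.isOpen_compl.mem_nhds h2] with y hy
        rw [b.zero_of_le_dist, zero_mul]
        rw [mem_compl_iff, mem_closedBall, not_le] at hy
        exact hy.le
      exact contDiffAt_const.congr_of_eventuallyEq h1
  · simp only
    rw [b.one_of_mem_closedBall (ball_subset_closedBall hx), one_mul]

theorem lap_const_mul_comp_affine (c r : ℝ) (a : Euc n) (f : Euc n → ℝ) :
    lap (fun x => c * f (a + r • x)) = fun x => c * r ^ 2 * lap f (a + r • x) := by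
  have h1 : ∀ (c : ℝ) (g : Euc n → ℝ) (x e : Euc n),
      fderiv ℝ (fun x => c * g (a + r • x)) x e = c * r * fderiv ℝ g (a + r • x) e := by
    intro c g x e
    have h2 : fderiv ℝ (fun x => g (a + r • x)) x = r • fderiv ℝ g (a + r • x) := by
      rw [fderiv_comp_smul (f := fun y => g (a + y)), fderiv_comp_add_left]
    have h3 : fderiv ℝ (fun x => c * g (a + r • x)) x = c • fderiv ℝ (fun x => g (a + r • x)) x :=
      congrFun (fderiv_const_smul_field (R := ℝ) c (f := fun x => g (a + r • x))) x
    rw [h3, h2]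
    simp [mul_assoc]
  ext x
  unfold lap
  rw [Finset.mul_sum]
  refine Finset.sum_congr rfl fun i _ => ?_
  simp only [h1]
  rw [h1 (c * r) (fun y => fderiv ℝ f y (EuclideanSpace.single i 1))]
  ring

theorem lap_iterate_const_mul_comp_affine (m : ℕ) (r : ℝ) (a : Euc n) (f : Euc n → ℝ) : ∀ c : ℝ,
    lap^[m] (fun x => c * f (a + r • x)) = fun x => c * r ^ (2 * m) * lap^[m] f (a + r • x) := by
  induction m generalizing f with
  | zero => simp
  | succ m ih =>
    intro c
    simp only [Function.iterate_succ, Function.comp_apply]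
    rw [lap_const_mul_comp_affine, ih]
    ext x
    ring

theorem lap_add_const (f : Euc n → ℝ) (c : ℝ) : lap (fun x => f x + c) = lap f := by
  ext x
  unfold lap
  simp only [fderiv_add_const]

theorem lap_iterate_rescale {m : ℕ} (hm : 0 < m) (r c : ℝ) (a : Euc n) (f : Euc n → ℝ)
    (x : Euc n) :
    lap^[m] (fun x => f (a + r • x) + c) x = r ^ (2 * m) * lap^[m] f (a + r • x) := by
  obtain ⟨m, rfl⟩ : ∃ k, m = k + 1 := ⟨m - 1, by omega⟩
  rw [Function.iterate_succ_apply, lap_add_const, ← Function.iterate_succ_apply (f := lap)]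
  have := lap_iterate_const_mul_comp_affine (m + 1) r a f 1
  simp only [one_mul] at this
  rw [this]

theorem exists_diagonal {P : ℕ → ℕ → Prop} (h : ∀ N, ∀ᶠ k in atTop, P N k) :
    ∃ N : ℕ → ℕ, Tendsto N atTop atTop ∧ ∀ᶠ k in atTop, P (N k) k := by
  classical
  have hN : Tendsto (fun k => Nat.findGreatest (fun N => P N k) k) atTop atTop := by
    refine Filter.tendsto_atTop.2 fun N => ?_
    filter_upwards [h N, eventually_ge_atTop N] with k hk hNk
    exact Nat.le_findGreatest hNk hk
  refine ⟨_, hN, ?_⟩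
  filter_upwards [hN.eventually (eventually_ge_atTop 1)] with k hk
  exact Nat.findGreatest_of_ne_zero (P := fun N => P N k) rfl (by omega)

/-- Selection of a concentration point. -/
theorem exists_concentration_point {x₀ : Euc n} {R Λ : ℝ} (hΛ : 1 ≤ Λ) {u : Euc n → ℝ}
    (hu : ContinuousOn u (closedBall x₀ R))
    (hP : ∃ x ∈ ball x₀ R, Λ < (R - dist x x₀) * Real.exp (u x)) :
    ∃ (a : Euc n) (r : ℝ), dist a x₀ < R ∧ 0 < r ∧ r ≤ R ∧ u a + Real.log r = -Real.log 2 ∧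
      ∀ x ∈ ball (0 : Euc n) Λ, a + r • x ∈ ball x₀ R ∧ u (a + r • x) + Real.log r ≤ 0 := by
  obtain ⟨y, hy, hyΛ⟩ := hP
  obtain ⟨a, ha, hmax⟩ := (isCompact_closedBall x₀ R).exists_isMaxOn ⟨y, ball_subset_closedBall hy⟩
    (f := fun x => (R - dist x x₀) * Real.exp (u x))
    ((continuousOn_const.sub (by fun_prop)).mul (Real.continuous_exp.comp_continuousOn hu))
  have h1 : Λ < (R - dist a x₀) * Real.exp (u a) := hyΛ.trans_le (hmax (ball_subset_closedBall hy))
  have hexp := Real.exp_pos (u a)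
  have hσ : 0 < R - dist a x₀ := by
    by_contra! h
    nlinarith
  have hr : 0 < Real.exp (-u a) / 2 := by positivity
  have hre : Real.exp (-u a) / 2 * Real.exp (u a) = 1 / 2 := by
    rw [div_mul_eq_mul_div, ← Real.exp_add]
    simp
  have hlog : Real.log (Real.exp (-u a) / 2) = -u a - Real.log 2 := by
    rw [Real.log_div (Real.exp_pos _).ne' two_ne_zero, Real.log_exp]
  set r := Real.exp (-u a) / 2 with hrdef
  have hrΛ : r * Λ < (R - dist a x₀) / 2 := by
    have := mul_lt_mul_of_pos_left h1 hr
    calc r * Λ < r * ((R - dist a x₀) * Real.exp (u a)) := this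
      _ = (R - dist a x₀) * (r * Real.exp (u a)) := by ring
      _ = _ := by rw [hre]; ring
  refine ⟨a, r, by linarith, hr, by nlinarith [dist_nonneg (x := a) (y := x₀)], by rw [hlog]; ring,
    fun x hx => ?_⟩
  have hx' : ‖x‖ < Λ := by simpa using hx
  have h2 : dist (a + r • x) a < (R - dist a x₀) / 2 := by
    rw [dist_eq_norm, add_sub_cancel_left, norm_smul, Real.norm_of_nonneg hr.le]
    nlinarith
  have h3 := dist_triangle (a + r • x) a x₀
  have h4 : a + r • x ∈ ball x₀ R := by
    rw [mem_ball]
    linarith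
  refine ⟨h4, ?_⟩
  have h5 : (R - dist (a + r • x) x₀) * Real.exp (u (a + r • x)) ≤
      (R - dist a x₀) * Real.exp (u a) := hmax (ball_subset_closedBall h4)
  have h6 : Real.exp (u (a + r • x)) ≤ 2 * Real.exp (u a) := by
    have := Real.exp_pos (u (a + r • x))
    by_contra! h
    nlinarith
  have h7 : u (a + r • x) ≤ Real.log 2 + u a := by
    rw [← Real.exp_le_exp, Real.exp_add, Real.exp_log two_pos]
    exact h6
  rw [hlog]
  linarith

end Rescaling

theorem stmt_2
    (m : ℕ) (hm : 1 < m)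
    (Ω : Set (EuclideanSpace ℝ (Fin (2*m)))) (hΩo : IsOpen Ω) (hΩc : IsConnected Ω)
    (Q : ℕ → EuclideanSpace ℝ (Fin (2*m)) → ℝ) (Q0 : EuclideanSpace ℝ (Fin (2*m)) → ℝ)
    (hQ : ∀ k, ContinuousOn (Q k) Ω)
    (hQ0 : ContinuousOn Q0 Ω) (hQ0b : ∃ M : ℝ, ∀ x ∈ Ω, |Q0 x| ≤ M)
    (hQconv : TendstoLocallyUniformlyOn Q Q0 atTop Ω)
    (u : ℕ → EuclideanSpace ℝ (Fin (2*m)) → ℝ)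
    (hu : ∀ k, ContDiffOn ℝ (2*m) (u k) Ω)
    (hpde : ∀ k, ∀ x ∈ Ω,
      (-1 : ℝ)^m * lap^[m] (u k) x = Q k x * Real.exp (2*m * u k x))
    (C : ℝ)
    (hvol : ∀ k, (∫⁻ x in Ω, ENNReal.ofReal (Real.exp (2*m * u k x))) ≤ ENNReal.ofReal C)
    (x0 : EuclideanSpace ℝ (Fin (2*m))) (hx0 : x0 ∈ Ω)
    (hblow : ∀ R : ℝ, 0 < R → ball x0 R ⊆ Ω →
      ∀ M : ℝ, ∀ᶠ k in atTop, ∃ x ∈ ball x0 R, M < u k x) :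
    ∃ (xk : ℕ → EuclideanSpace ℝ (Fin (2*m))) (rk : ℕ → ℝ) (L : ℕ → ℝ),
      Tendsto xk atTop (𝓝 x0) ∧
      (∀ k, 0 < rk k) ∧ Tendsto rk atTop (𝓝 0) ∧
      Tendsto L atTop atTop ∧
      (∀ k, ∀ x ∈ ball (0 : EuclideanSpace ℝ (Fin (2*m))) (L k),
        u k (xk k + rk k • x) + Real.log (rk k) ≤ 0) ∧
      (∀ k, -Real.log 2 ≤ u k (xk k) + Real.log (rk k)) ∧
      ∃ φ : ℕ → ℕ, StrictMono φ ∧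
        ((∃ v : EuclideanSpace ℝ (Fin (2*m)) → ℝ,
            ContDiff ℝ (2*m) v ∧
            (∀ x, (-1 : ℝ)^m * lap^[m] v x = Q0 x0 * Real.exp (2*m * v x)) ∧
            (∀ α ∈ Set.Ico (0:ℝ) 1,
              TendstoCLocHolder (2*m-1) α Set.univ
                (fun k x => u (φ k) (xk (φ k) + rk (φ k) • x) + Real.log (rk (φ k))) v)) ∨
         ((∀ᵐ x ∂(volume : Measure (EuclideanSpace ℝ (Fin (2*m)))),
            Tendsto (fun k => u (φ k) (xk (φ k) + rk (φ k) • x) + Real.log (rk (φ k)))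
              atTop atBot) ∧
          ∃ (γ : ℕ → ℝ) (p : EuclideanSpace ℝ (Fin (2*m)) → ℝ),
            (∀ k, 0 < γ k) ∧ Tendsto γ atTop atTop ∧
            ContDiff ℝ (⊤ : ℕ∞) p ∧ (∀ x, iteratedFDeriv ℝ (2*m-1) p x = 0) ∧
            (∀ α ∈ Set.Ico (0:ℝ) 1,
              TendstoCLocHolder (2*m-1) α Set.univ
                (fun k x => (u (φ k) (xk (φ k) + rk (φ k) • x) + Real.log (rk (φ k))) / γ k)
                p))) := by
  obtain ⟨δ, hδ, hδΩ⟩ := Metric.nhds_basis_closedBall.mem_iff.1 (hΩo.mem_nhds hx0)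
  set R : ℕ → ℝ := fun N => δ / (N + 1) with hRdef
  have hRpos : ∀ N, 0 < R N := fun N => by simp only [hRdef]; positivity
  have hRδ : ∀ N, R N ≤ δ := fun N =>
    div_le_self hδ.le (by have : (0 : ℝ) ≤ N := N.cast_nonneg; linarith)
  have hRΩ : ∀ N, closedBall x0 (R N) ⊆ Ω := fun N =>
    (closedBall_subset_closedBall (hRδ N)).trans hδΩ
  have hR0 : Tendsto R atTop (𝓝 0) := by
    have := (tendsto_one_div_add_atTop_nhds_zero_nat (𝕜 := ℝ)).const_mul δ
    simpa [hRdef, div_eq_mul_inv] using this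
  obtain ⟨N, hN, hNP⟩ := exists_diagonal (P := fun N k => ∃ x ∈ ball x0 (R N),
      (N : ℝ) + 1 < (R N - dist x x0) * Real.exp (u k x)) fun N => by
    have hsub : ball x0 (R N / 2) ⊆ ball x0 (R N) := ball_subset_ball (by linarith [hRpos N])
    filter_upwards [hblow (R N / 2) (half_pos (hRpos N))
      (hsub.trans (ball_subset_closedBall.trans (hRΩ N))) (Real.log (2 * (N + 1) / R N))]
      with k ⟨x, hx, hxM⟩
    refine ⟨x, hsub hx, ?_⟩
    have hpos : 0 < 2 * ((N : ℝ) + 1) / R N := div_pos (by positivity) (hRpos N)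
    have h1 : 2 * ((N : ℝ) + 1) / R N < Real.exp (u k x) := (Real.log_lt_iff_lt_exp hpos).1 hxM
    rw [div_lt_iff₀ (hRpos N)] at h1
    have h2 : dist x x0 < R N / 2 := hx
    have := Real.exp_pos (u k x)
    nlinarith
  have hsel : ∀ k, ∃ (a : Euc (2 * m)) (r L : ℝ), 0 < r ∧ -Real.log 2 ≤ u k a + Real.log r ∧
      (∀ x ∈ ball (0 : Euc (2 * m)) L, u k (a + r • x) + Real.log r ≤ 0) ∧
      ((∃ x ∈ ball x0 (R (N k)), (N k : ℝ) + 1 < (R (N k) - dist x x0) * Real.exp (u k x)) →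
        L = N k + 1 ∧ dist a x0 < R (N k) ∧ r ≤ R (N k) ∧
        ∀ x ∈ ball (0 : Euc (2 * m)) (N k + 1), a + r • x ∈ ball x0 (R (N k))) := by
    intro k
    by_cases hP : ∃ x ∈ ball x0 (R (N k)),
        (N k : ℝ) + 1 < (R (N k) - dist x x0) * Real.exp (u k x)
    · obtain ⟨a, r, ha, hr, hrR, hur, hball⟩ := exists_concentration_point
        (by have : (0 : ℝ) ≤ N k := Nat.cast_nonneg _; linarith)
        ((hu k).continuousOn.mono (hRΩ (N k))) hP
      exact ⟨a, r, N k + 1, hr, hur.ge, fun x hx => (hball x hx).2, fun _ =>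
        ⟨rfl, ha, hrR, fun x hx => (hball x hx).1⟩⟩
    · refine ⟨x0, Real.exp (-u k x0), 0, Real.exp_pos _, ?_, by simp, fun h => absurd h hP⟩
      have := Real.log_nonneg one_le_two
      rw [Real.log_exp]
      linarith
  choose xk rk L hrk hlow hneg hsel using hsel
  have hgood : ∀ᶠ k in atTop, L k = N k + 1 ∧ dist (xk k) x0 < R (N k) ∧ rk k ≤ R (N k) ∧
      ∀ x ∈ ball (0 : Euc (2 * m)) (N k + 1), xk k + rk k • x ∈ ball x0 (R (N k)) :=
    hNP.mono fun k hk => hsel k hk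
  have hRN : Tendsto (fun k => R (N k)) atTop (𝓝 0) := hR0.comp hN
  have hN' : Tendsto (fun k => (N k : ℝ) + 1) atTop atTop :=
    tendsto_atTop_add_const_right _ _ (tendsto_natCast_atTop_atTop.comp hN)
  have hcut : ∀ k, ∃ w : Euc (2 * m) → ℝ, ContDiff ℝ (2 * m : ℕ) w ∧
      ((∀ x ∈ ball (0 : Euc (2 * m)) (N k + 1), xk k + rk k • x ∈ ball x0 (R (N k))) →
        ∀ x ∈ ball (0 : Euc (2 * m)) (((N k : ℝ) + 1) / 2),
          w x = u k (xk k + rk k • x) + Real.log (rk k)) := by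
    intro k
    by_cases h : ∀ x ∈ ball (0 : Euc (2 * m)) (N k + 1), xk k + rk k • x ∈ ball x0 (R (N k))
    · have hf : ContDiffOn ℝ (2 * m : ℕ) (fun x => u k (xk k + rk k • x) + Real.log (rk k))
          (ball (0 : Euc (2 * m)) (N k + 1)) := by
        have hu' : ContDiffOn ℝ (2 * m : ℕ) (u k) Ω := by exact_mod_cast hu k
        have haff : ContDiff ℝ (2 * m : ℕ) fun x : Euc (2 * m) => xk k + rk k • x :=
          contDiff_const.add (contDiff_id.const_smul (rk k))
        exact (hu'.comp haff.contDiffOn fun x hx =>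
          hRΩ (N k) (ball_subset_closedBall (h x hx))).add contDiffOn_const
      obtain ⟨w, hw, hwf⟩ := exists_contDiff_eq_on_ball (by positivity) hf
      exact ⟨w, hw, fun _ => hwf⟩
    · exact ⟨0, contDiff_const, fun h' => absurd h' h⟩
  choose w hw hwf using hcut
  have hev : ∀ T : ℝ, ∀ᶠ k in atTop, T < (N k + 1) / 2 := fun T => by
    filter_upwards [hN'.eventually (eventually_gt_atTop (2 * T))] with k hk
    linarith
  have hmem : ∀ T : ℝ, ∀ᶠ k in atTop, ∀ x ∈ closedBall (0 : Euc (2 * m)) T,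
      x ∈ ball (0 : Euc (2 * m)) (((N k : ℝ) + 1) / 2) ∧ x ∈ ball (0 : Euc (2 * m)) (N k + 1) := by
    intro T
    filter_upwards [hev T] with k hk x hx
    have h1 : dist x 0 ≤ T := hx
    have h2 : (0 : ℝ) ≤ N k := Nat.cast_nonneg _
    exact ⟨mem_ball.2 (by linarith), mem_ball.2 (by linarith)⟩
  have hxk : Tendsto xk atTop (𝓝 x0) := by
    rw [tendsto_iff_dist_tendsto_zero]
    exact squeeze_zero' (.of_forall fun _ => dist_nonneg) (hgood.mono fun k hk => hk.2.1.le) hRN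
  have hrk0 : Tendsto rk atTop (𝓝 0) :=
    squeeze_zero' (.of_forall fun k => (hrk k).le) (hgood.mono fun k hk => hk.2.2.1) hRN
  have hL : Tendsto L atTop atTop := hN'.congr' (hgood.mono fun k hk => hk.1.symm)
  refine ⟨xk, rk, L, hxk, hrk, hrk0, hL, hneg, hlow, ?_⟩
  have key := dichotomy (n := 2 * m) (m := m) (w := w)
    (f := fun k x => u k (xk k + rk k • x) + Real.log (rk k))
    (q := fun k x => Q k (xk k + rk k • x)) (q₀ := Q0 x0) (by omega) hw
    (fun T => by
      filter_upwards [hgood, hmem T] with k hk hk' x hx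
      exact (hwf k hk.2.2.2 x (hk' x (ball_subset_closedBall hx)).1).symm)
    (fun T => by
      filter_upwards [hgood, hmem T] with k hk hk' x hx
      rw [hwf k hk.2.2.2 x (hk' x hx).1]
      exact hneg k x (by rw [hk.1]; exact (hk' x hx).2))
    (fun ε hε T => by
      obtain ⟨t, ht, htQ⟩ := Metric.tendstoLocallyUniformlyOn_iff.1 hQconv (ε / 2) (half_pos hε)
        x0 hx0
      rw [hΩo.nhdsWithin_eq hx0] at ht
      have hc : ∀ᶠ y in 𝓝 x0, dist (Q0 y) (Q0 x0) < ε / 2 :=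
        Metric.tendsto_nhds.1 (hQ0.continuousAt (hΩo.mem_nhds hx0)) _ (half_pos hε)
      obtain ⟨η, hη, hηt⟩ := Metric.mem_nhds_iff.1 (Filter.inter_mem ht hc)
      filter_upwards [hgood, hmem T, htQ, hRN.eventually (eventually_lt_nhds hη)]
        with k hk hk' hkQ hkR x hx
      have h1 := hηt (ball_subset_ball hkR.le (hk.2.2.2 x (hk' x hx).2))
      have h2 := hkQ _ h1.1
      have h3 : dist (Q0 (xk k + rk k • x)) (Q0 x0) < ε / 2 := h1.2
      rw [dist_comm] at h2
      have h4 := dist_triangle (Q k (xk k + rk k • x)) (Q0 (xk k + rk k • x)) (Q0 x0)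
      rw [← Real.dist_eq]
      linarith)
    (fun T => by
      filter_upwards [hgood, hmem T] with k hk hk' x hx
      have h1 : w k =ᶠ[𝓝 x] fun x => u k (xk k + rk k • x) + Real.log (rk k) := by
        filter_upwards [isOpen_ball.mem_nhds (hk' x hx).1] with y hy
        exact hwf k hk.2.2.2 y hy
      rw [(h1.lap_iterate m).self_of_nhds, h1.self_of_nhds, lap_iterate_rescale (by omega),
        mul_left_comm, hpde k _ (hRΩ (N k) (ball_subset_closedBall (hk.2.2.2 x (hk' x hx).2))),
        mul_add, Real.exp_add]
      have h2 : Real.exp (2 * m * Real.log (rk k)) = rk k ^ (2 * m) := by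
        rw [← Real.exp_log (hrk k), ← Real.exp_nat_mul, Real.log_exp]
        push_cast
        rfl
      rw [h2]
      ring)
  obtain ⟨φ, hφ, h⟩ := key
  refine ⟨φ, hφ, ?_⟩
  rcases h with ⟨g, hg, hgpde, hgc⟩ | h
  · exact Or.inl ⟨g, by exact_mod_cast hg, hgpde, hgc⟩
  · exact Or.inr h
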